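/- Let Ω be an open subset of ℂ and let E be a closed polar subset of Ω. Let J be a C¹ almost complex structure on ℝ^{2n} and let u : Ω → ℝ^{2n} be a continuous map that is J-holomorphic on Ω \ E (in particular u is C¹ on Ω \ E). Then u is C¹ on all of Ω and is J-holomorphic on Ω. -/

import Mathlib

open MeasureTheory Metric Set

noncomputable section

/-- Subharmonicity on an open set `U ⊆ ℂ` for `[−∞,∞)`-valued functions:
upper semicontinuous, never `+∞`, and satisfying the sub-mean value inequality
on every closed disc contained in `U` (formulated against continuous majorants
on the boundary circle, which for upper semicontinuous functions is equivalent
to the usual mean value inequality). -/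
def SubharmonicERealOn (lam : ℂ → EReal) (U : Set ℂ) : Prop :=
  UpperSemicontinuousOn lam U ∧ (∀ z ∈ U, lam z ≠ ⊤) ∧
  ∀ (c : ℂ) (r : ℝ), 0 < r → Metric.closedBall c r ⊆ U →
    ∀ g : ℝ → ℝ, Continuous g →
      (∀ θ : ℝ, lam (circleMap c r θ) ≤ (g θ : EReal)) →
      lam c ≤ (((2 * Real.pi)⁻¹ * ∫ θ in (0:ℝ)..(2 * Real.pi), g θ : ℝ) : EReal)

/-- Subharmonicity on an open set `U ⊆ ℂ` for real-valued functions: upper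
semicontinuous and satisfying the sub-mean value inequality on closed discs. -/
def SubharmonicRealOn (v : ℂ → ℝ) (U : Set ℂ) : Prop :=
  UpperSemicontinuousOn v U ∧
  ∀ (c : ℂ) (r : ℝ), 0 < r → Metric.closedBall c r ⊆ U →
    v c ≤ (2 * Real.pi)⁻¹ * ∫ θ in (0:ℝ)..(2 * Real.pi), v (circleMap c r θ)

/-- `E` is a polar subset of the open set `Ω ⊆ ℂ`: every `z ∈ Ω` has an open
neighborhood `V` carrying a subharmonic function `λ`, not identically `−∞` near
`z`, with `E ∩ V ⊆ λ⁻¹(−∞)`. -/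
def PolarIn (E Ω : Set ℂ) : Prop :=
  ∀ z ∈ Ω, ∃ V : Set ℂ, IsOpen V ∧ z ∈ V ∧
    ∃ lam : ℂ → EReal, SubharmonicERealOn lam V ∧
      (∀ t ∈ nhds z, ∃ w ∈ t ∩ V, lam w ≠ ⊥) ∧
      E ∩ V ⊆ lam ⁻¹' {⊥}

/-- `J` is a `C¹` almost complex structure on `ℝ^{2n}`: a `C¹` field of
endomorphisms with `J(x)² = −Id`. -/
def IsAcs (n : ℕ)
    (J : (Fin (2 * n) → ℝ) → ((Fin (2 * n) → ℝ) →L[ℝ] (Fin (2 * n) → ℝ))) : Prop :=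
  ContDiff ℝ 1 J ∧
  ∀ x, (J x).comp (J x) = - ContinuousLinearMap.id ℝ (Fin (2 * n) → ℝ)

/-- `w` is `J`-holomorphic on the open set `U ⊆ ℂ`: it is `C¹` there and satisfies
`∂w/∂y = J(w) ∂w/∂x` at every point of `U` (with `z = x + iy`). -/
def JHoloOn (n : ℕ)
    (J : (Fin (2 * n) → ℝ) → ((Fin (2 * n) → ℝ) →L[ℝ] (Fin (2 * n) → ℝ)))
    (w : ℂ → Fin (2 * n) → ℝ) (U : Set ℂ) : Prop :=
  ContDiffOn ℝ 1 w U ∧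
  ∀ z ∈ U, fderiv ℝ w z Complex.I = J (w z) (fderiv ℝ w z 1)

section Part1
open MeasureTheory Metric Set
open scoped ENNReal

lemma lsc_lintegral_le (h : ℝ → ℝ≥0∞) (hl : LowerSemicontinuous h) (T : ℝ)
    (hp : Function.Periodic h T) (s : Set ℝ) (X : ℝ≥0∞)
    (H : ∀ g : ℝ → ℝ, Continuous g → Function.Periodic g T → (∀ θ, 0 ≤ g θ) →
      (∀ θ, ENNReal.ofReal (g θ) ≤ h θ) → ∫⁻ θ in s, ENNReal.ofReal (g θ) ≤ X) :
    ∫⁻ θ in s, h θ ≤ X := by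
  set m : ℕ → ℝ → ℝ := fun k y => (min (h y) (k:ℝ≥0∞)).toReal with hm
  have m0 : ∀ k y, 0 ≤ m k y := fun k y => ENNReal.toReal_nonneg
  have mfin : ∀ (k:ℕ) y, min (h y) (k:ℝ≥0∞) ≠ ⊤ := fun k y =>
    ne_top_of_le_ne_top (ENNReal.natCast_ne_top k) (min_le_right _ _)
  have mmono : ∀ k l y, k ≤ l → m k y ≤ m l y := by
    intro k l y hkl
    apply ENNReal.toReal_mono (mfin l y)
    have : (k:ℝ≥0∞) ≤ l := by exact_mod_cast hkl
    gcongr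
  set g : ℕ → ℝ → ℝ := fun k x => ⨅ y, (m k y + k * |x - y|) with hg
  have hbdd : ∀ k x, BddBelow (range fun y => (m k y + k * |x - y|)) := by
    intro k x
    refine ⟨0, ?_⟩
    rintro _ ⟨y, rfl⟩
    have := m0 k y
    positivity
  have gnn : ∀ k x, 0 ≤ g k x := fun k x => Real.iInf_nonneg fun y => by
    have := m0 k y
    positivity
  have gle : ∀ k x, g k x ≤ m k x := by
    intro k x
    refine (ciInf_le (hbdd k x) x).trans (by simp)
  have glip : ∀ k x y, g k x ≤ g k y + k * |x - y| := by
    intro k x y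
    rw [← sub_le_iff_le_add]
    apply le_ciInf
    intro w
    rw [sub_le_iff_le_add]
    refine (ciInf_le (hbdd k x) w).trans ?_
    have : |x - w| ≤ |y - w| + |x - y| := by
      have := abs_sub_le x y w
      linarith
    have hk : (0:ℝ) ≤ k := by positivity
    nlinarith
  have gcont : ∀ k, Continuous (g k) := by
    intro k
    have : LipschitzWith (k : NNReal) (g k) := by
      apply LipschitzWith.of_le_add_mul
      intro x y
      have := glip k x y
      simpa [Real.dist_eq] using this
    exact this.continuous
  have gper : ∀ k, Function.Periodic (g k) T := by
    intro k x
    simp only [hg]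
    symm
    apply Equiv.iInf_congr (Equiv.addRight T)
    intro y
    have : m k (y + T) = m k y := by simp only [hm]; rw [hp y]
    simp [this]
  have gofle : ∀ k x, ENNReal.ofReal (g k x) ≤ h x := by
    intro k x
    calc ENNReal.ofReal (g k x) ≤ ENNReal.ofReal (m k x) := ENNReal.ofReal_le_ofReal (gle k x)
      _ = min (h x) k := ENNReal.ofReal_toReal (mfin k x)
      _ ≤ h x := min_le_left _ _
  have gmono : ∀ x, Monotone fun k => g k x := by
    intro x k l hkl
    apply ciInf_mono (hbdd k x)
    intro y
    have h1 := mmono k l y hkl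
    have h2 : (k:ℝ) ≤ l := by exact_mod_cast hkl
    gcongr
  have hsup : ∀ x, h x = ⨆ k, ENNReal.ofReal (g k x) := by
    intro x
    apply le_antisymm _ (iSup_le fun k => gofle k x)
    apply le_of_forall_lt
    intro c hc
    obtain ⟨c', hcc, hc'⟩ := exists_between hc
    have hctop : c' ≠ ⊤ := hc'.ne_top
    have hev := hl x c' hc'
    rw [Metric.eventually_nhds_iff] at hev
    obtain ⟨δ, hδ, hδh⟩ := hev
    obtain ⟨k, hk⟩ := exists_nat_ge (max c'.toReal (c'.toReal / δ))
    have hk1 : c'.toReal ≤ k := (le_max_left _ _).trans hk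
    have hk2 : c'.toReal ≤ k * δ := by
      have := (le_max_right _ _).trans hk
      rwa [div_le_iff₀ hδ] at this
    refine lt_of_lt_of_le hcc (le_trans ?_ (le_iSup _ k))
    rw [← ENNReal.ofReal_toReal hctop]
    apply ENNReal.ofReal_le_ofReal
    apply le_ciInf
    intro y
    by_cases hy : dist y x < δ
    · have h1 : c' ≤ min (h y) k := by
        apply le_min (hδh hy).le
        rw [← ENNReal.ofReal_toReal hctop]
        rw [← ENNReal.ofReal_natCast]
        exact ENNReal.ofReal_le_ofReal hk1
      have h2 : c'.toReal ≤ m k y := ENNReal.toReal_mono (mfin k y) h1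
      have : 0 ≤ (k:ℝ) * |x - y| := by positivity
      linarith
    · have h1 : δ ≤ |x - y| := by rw [dist_comm, Real.dist_eq] at hy; linarith
      have h2 := m0 k y
      have : (k:ℝ) * δ ≤ k * |x - y| := by gcongr
      linarith
  calc ∫⁻ θ in s, h θ = ∫⁻ θ in s, ⨆ k, ENNReal.ofReal (g k θ) := by simp_rw [← hsup]
    _ = ⨆ k, ∫⁻ θ in s, ENNReal.ofReal (g k θ) := by
      apply lintegral_iSup
      · intro k; exact ENNReal.measurable_ofReal.comp (gcont k).measurable
      · intro k l hkl x; exact ENNReal.ofReal_le_ofReal (gmono x hkl)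
    _ ≤ X := iSup_le fun k => H (g k) (gcont k) (gper k) (gnn k) (gofle k)

/-- From a polar set, an ENNReal superharmonic function. -/
lemma polar_p (E Ω : Set ℂ) (hΩ : IsOpen Ω) (hpolar : PolarIn E Ω) (z0 : ℂ) (hz : z0 ∈ Ω) :
    ∃ R > 0, closedBall z0 R ⊆ Ω ∧ ∃ p : ℂ → ℝ≥0∞, LowerSemicontinuous p ∧
      (∀ c r, 0 < r → closedBall c r ⊆ ball z0 R →
        ∫⁻ θ in Ioo (-Real.pi) Real.pi, p (circleMap c r θ) ≤ ENNReal.ofReal (2 * Real.pi) * p c) ∧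
      (∀ z ∈ E ∩ ball z0 R, p z = ⊤) ∧ (∀ t ∈ nhds z0, ∃ w ∈ t, p w ≠ ⊤) := by
  obtain ⟨V, hV, hzV, lam, ⟨husc, htop, hsub⟩, hnb, hEV⟩ := hpolar z0 hz
  obtain ⟨M, hM⟩ : ∃ M : ℝ, lam z0 < M := by
    have := lt_top_iff_ne_top.2 (htop z0 hzV)
    obtain ⟨M, hM, _⟩ := EReal.lt_iff_exists_real_btwn.1 this
    exact ⟨M, hM⟩
  have hev : ∀ᶠ z in nhds z0, lam z < M ∧ z ∈ V ∧ z ∈ Ω := by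
    have h1 := husc z0 hzV M hM
    rw [hV.nhdsWithin_eq hzV] at h1
    filter_upwards [h1, hV.mem_nhds hzV, hΩ.mem_nhds hz] with w a b c using ⟨a, b, c⟩
  obtain ⟨R', hR', hR⟩ := Metric.eventually_nhds_iff.1 hev
  set R := R' / 2 with hRdef
  have hR0 : 0 < R := by positivity
  have hcb : ∀ z ∈ closedBall z0 R, lam z < M ∧ z ∈ V ∧ z ∈ Ω := by
    intro z hz
    apply hR
    rw [mem_closedBall] at hz
    linarith
  classical
  set p : ℂ → ℝ≥0∞ := fun z => if z ∈ ball z0 R then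
    (if lam z = ⊥ then ⊤ else ENNReal.ofReal (M - (lam z).toReal)) else 0 with hp
  -- key equivalence
  have key : ∀ z ∈ ball z0 R, ∀ y : ℝ, 0 ≤ y →
      ((ENNReal.ofReal y < p z ↔ lam z < ((M - y : ℝ) : EReal)) ∧
       (ENNReal.ofReal y ≤ p z ↔ lam z ≤ ((M - y : ℝ) : EReal))) := by
    intro z hz y hy
    have hlt := (hcb z (ball_subset_closedBall hz)).1
    have hpz : p z = (if lam z = ⊥ then ⊤ else ENNReal.ofReal (M - (lam z).toReal)) := by
      simp only [hp, if_pos hz]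
    rw [hpz]
    generalize hx : lam z = x at *
    induction x with
    | bot =>
      simp only [if_true]
      exact ⟨⟨fun _ => EReal.bot_lt_coe _, fun _ => ENNReal.ofReal_lt_top⟩,
        ⟨fun _ => bot_le, fun _ => le_top⟩⟩
    | top => simp at hlt
    | coe x =>
      have hxM : x < M := by exact_mod_cast hlt
      simp only [EReal.coe_ne_bot, if_false, EReal.toReal_coe, EReal.coe_lt_coe_iff,
        EReal.coe_le_coe_iff]
      rw [ENNReal.ofReal_lt_ofReal_iff (by linarith), ENNReal.ofReal_le_ofReal_iff (by linarith)]
      constructor <;> constructor <;> intro h <;> linarith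
  have hlsc : LowerSemicontinuous p := by
    intro z y hy
    have hzb : z ∈ ball z0 R := by
      by_contra h
      have : p z = 0 := by simp only [hp, if_neg h]
      rw [this] at hy
      exact not_lt_bot hy
    have hyt : y ≠ ⊤ := ne_top_of_lt hy
    have hyy : y = ENNReal.ofReal y.toReal := (ENNReal.ofReal_toReal hyt).symm
    have hV' : ∀ᶠ w in nhds z, lam w < ((M - y.toReal : ℝ) : EReal) := by
      have hh : y < p z := hy
      rw [hyy, (key z hzb _ ENNReal.toReal_nonneg).1] at hh
      have h1 := husc z (hcb z (ball_subset_closedBall hzb)).2.1 _ hh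
      rwa [hV.nhdsWithin_eq (hcb z (ball_subset_closedBall hzb)).2.1] at h1
    filter_upwards [hV', isOpen_ball.mem_nhds hzb] with w hw hwb
    rw [← (key w hwb _ ENNReal.toReal_nonneg).1, ← hyy] at hw
    exact hw
  refine ⟨R, hR0, fun z hz => (hcb z hz).2.2, p, hlsc, ?_, ?_, ?_⟩
  · intro c r hr hcr
    have hcm : ∀ θ, circleMap c r θ ∈ ball z0 R := fun θ =>
      hcr (sphere_subset_closedBall (circleMap_mem_sphere c hr.le θ))
    apply lsc_lintegral_le (fun θ => p (circleMap c r θ)) (hlsc.comp (continuous_circleMap c r))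
      (2 * Real.pi)
    · intro θ; beta_reduce; rw [periodic_circleMap c r θ]
    · intro g hg hgp hg0 hgle
      have hcc : c ∈ ball z0 R := hcr (mem_closedBall_self hr.le)
      have h1 := hsub c r hr (fun z hz => (hcb z (ball_subset_closedBall (hcr hz))).2.1)
        (fun θ => M - g θ) (by fun_prop) (fun θ => ((key _ (hcm θ) _ (hg0 θ)).2).1 (hgle θ))
      have e1 : (2 * Real.pi)⁻¹ * ∫ θ in (0:ℝ)..(2 * Real.pi), (M - g θ) =
          M - (2 * Real.pi)⁻¹ * ∫ θ in (0:ℝ)..(2 * Real.pi), g θ := by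
        rw [intervalIntegral.integral_sub (by simp) (hg.intervalIntegrable _ _)]
        simp
        field_simp
      have hgi : 0 ≤ ∫ θ in (0:ℝ)..(2 * Real.pi), g θ :=
        intervalIntegral.integral_nonneg (by positivity) fun θ _ => hg0 θ
      rw [e1, ← ((key c hcc _ (by positivity)).2)] at h1
      have e2 : ∫ θ in (0:ℝ)..(2 * Real.pi), g θ = ∫ θ in Ioo (-Real.pi) Real.pi, g θ := by
        have := hgp.intervalIntegral_add_eq 0 (-Real.pi)
        rw [zero_add] at this
        rw [this, show -Real.pi + 2 * Real.pi = Real.pi by ring,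
          intervalIntegral.integral_of_le (by linarith [Real.pi_pos]), integral_Ioc_eq_integral_Ioo]
      have hint : IntegrableOn g (Ioo (-Real.pi) Real.pi) :=
        (hg.integrableOn_Icc (a := -Real.pi) (b := Real.pi)).mono_set Ioo_subset_Icc_self
      rw [← ofReal_integral_eq_lintegral_ofReal hint (Filter.Eventually.of_forall hg0), ← e2]
      calc _ = ENNReal.ofReal (2 * Real.pi) *
          ENNReal.ofReal ((2 * Real.pi)⁻¹ * ∫ θ in (0:ℝ)..(2 * Real.pi), g θ) := by
            rw [← ENNReal.ofReal_mul (by positivity)]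
            congr 1
            field_simp
        _ ≤ _ := by gcongr
  · intro z hz
    have : lam z = ⊥ := hEV ⟨hz.1, (hcb z (ball_subset_closedBall hz.2)).2.1⟩
    simp only [hp, if_pos hz.2, if_pos this]
  · intro t ht
    obtain ⟨w, hw, hwl⟩ := hnb (t ∩ ball z0 R) (Filter.inter_mem ht (ball_mem_nhds z0 hR0))
    refine ⟨w, hw.1.1, ?_⟩
    simp only [hp, if_pos hw.1.2, if_neg hwl]
    exact ENNReal.ofReal_ne_top

end Part1

section Part2
open MeasureTheory Metric Set
open scoped ENNReal ContDiff

lemma p_ball (p : ℂ → ℝ≥0∞) (z0 : ℂ) (R : ℝ)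
    (hci : ∀ c r, 0 < r → closedBall c r ⊆ ball z0 R →
        ∫⁻ θ in Ioo (-Real.pi) Real.pi, p (circleMap c r θ) ≤ ENNReal.ofReal (2 * Real.pi) * p c)
    (w : ℂ) (ρ : ℝ) (hw : closedBall w ρ ⊆ ball z0 R) :
    ∫⁻ z in ball w ρ, p z ≤
      ENNReal.ofReal ρ * (ENNReal.ofReal (2 * Real.pi) * p w) * ENNReal.ofReal ρ := by
  rw [← lintegral_indicator measurableSet_ball, ← lintegral_add_left_eq_self _ w,
    ← Complex.lintegral_comp_polarCoord_symm]
  have ht : polarCoord.target = Ioi (0:ℝ) ×ˢ Ioo (-Real.pi) Real.pi := rfl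
  rw [ht, Measure.volume_eq_prod, ← Measure.prod_restrict]
  refine (lintegral_prod_le _).trans ?_
  have h1 : ∀ r ∈ Ioi (0:ℝ), (∫⁻ θ in Ioo (-Real.pi) Real.pi, ENNReal.ofReal (r, θ).1 •
      (ball w ρ).indicator p (w + Complex.polarCoord.symm (r, θ))) ≤
      (Iio ρ).indicator (fun _ => ENNReal.ofReal ρ * (ENNReal.ofReal (2 * Real.pi) * p w)) r := by
    intro r hr
    have hr : 0 < r := hr
    have hc : ∀ θ, w + Complex.polarCoord.symm (r, θ) = circleMap w r θ := by
      intro θ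
      rw [Complex.polarCoord_symm_apply, circleMap, Complex.exp_mul_I]
      simp
    simp only [hc]
    by_cases h : r < ρ
    · rw [indicator_of_mem (by exact h)]
      calc _ ≤ ∫⁻ θ in Ioo (-Real.pi) Real.pi, ENNReal.ofReal ρ * p (circleMap w r θ) := by
            apply lintegral_mono; intro θ
            beta_reduce
            rw [smul_eq_mul]
            gcongr
            exact indicator_le_self _ _ _
        _ = ENNReal.ofReal ρ * ∫⁻ θ in Ioo (-Real.pi) Real.pi, p (circleMap w r θ) :=
            lintegral_const_mul' _ _ ENNReal.ofReal_ne_top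
        _ ≤ _ := by
            gcongr
            exact hci w r hr ((closedBall_subset_closedBall h.le).trans hw)
    · rw [indicator_of_notMem (by exact h)]
      have : ∀ θ, (ball w ρ).indicator p (circleMap w r θ) = 0 := by
        intro θ
        apply indicator_of_notMem
        rw [mem_ball, dist_eq_norm, circleMap_sub_center, norm_circleMap_zero, abs_of_pos hr]
        exact h
      simp [this]
  refine (setLIntegral_mono' measurableSet_Ioi h1).trans ?_
  rw [setLIntegral_indicator measurableSet_Iio, setLIntegral_const]
  gcongr
  have : Iio ρ ∩ Ioi (0:ℝ) = Ioo 0 ρ := by rw [inter_comm]; rfl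
  rw [this, Real.volume_Ioo]; simp

lemma mollified (E : Set ℂ) (z0 : ℂ) (R : ℝ) (hR : 0 < R) (hE : IsCompact (E ∩ closedBall z0 (R / 16)))
    (p : ℂ → ℝ≥0∞) (hl : LowerSemicontinuous p)
    (hci : ∀ c r, 0 < r → closedBall c r ⊆ ball z0 R →
        ∫⁻ θ in Ioo (-Real.pi) Real.pi, p (circleMap c r θ) ≤ ENNReal.ofReal (2 * Real.pi) * p c)
    (hpE : ∀ z ∈ E ∩ ball z0 R, p z = ⊤) (hne : ∀ t ∈ nhds z0, ∃ w ∈ t, p w ≠ ⊤) :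
    ∃ M1 : ℝ, ∀ k : ℝ, 0 ≤ k → ∃ P : ℂ → ℝ, ContDiff ℝ ∞ P ∧ (∀ x, 0 ≤ P x) ∧ Integrable P ∧
      ∫ x, P x ≤ M1 ∧
      (∀ c r, 0 < r → closedBall c r ⊆ ball z0 (R / 8) →
        ∫ θ in Ioo (-Real.pi) Real.pi, P (circleMap c r θ) ≤ 2 * Real.pi * P c) ∧
      ∃ U, IsOpen U ∧ E ∩ closedBall z0 (R / 16) ⊆ U ∧ ∀ x ∈ U, k ≤ P x := by
  obtain ⟨w, hw, hpw⟩ := hne (ball z0 (R / 8)) (ball_mem_nhds _ (by positivity))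
  rw [mem_ball] at hw
  have hmeas : Measurable p := hl.measurable
  set q : ℂ → ℝ≥0∞ := (ball z0 (R / 4)).indicator p with hq
  have hqm : Measurable q := hmeas.indicator measurableSet_ball
  have hqfin : ∫⁻ z, q z ≠ ⊤ := by
    rw [hq, lintegral_indicator measurableSet_ball]
    have h1 : ∫⁻ z in ball z0 (R / 4), p z ≤ ∫⁻ z in ball w (R / 2), p z := by
      apply lintegral_mono_set
      apply ball_subset_ball'
      rw [dist_comm]; linarith
    have h2 := p_ball p z0 R hci w (R / 2) (by
      intro y hy
      rw [mem_closedBall] at hy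
      rw [mem_ball]
      have := dist_triangle y w z0
      linarith)
    refine ne_top_of_le_ne_top ?_ (h1.trans h2)
    finiteness
  have hqae : ∀ᵐ z, q z < ⊤ := ae_lt_top hqm hqfin
  set qr : ℂ → ℝ := fun z => (q z).toReal with hqr
  have hqi : Integrable qr := integrable_toReal_of_lintegral_ne_top hqm.aemeasurable hqfin
  have hq0 : ∀ z, 0 ≤ qr z := fun z => ENNReal.toReal_nonneg
  refine ⟨∫ z, qr z, fun k hk => ?_⟩
  -- the open set where p > k
  set G : Set ℂ := p ⁻¹' Ioi (ENNReal.ofReal k) ∩ ball z0 (R / 4) with hG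
  have hGo : IsOpen G := (hl.isOpen_preimage _).inter isOpen_ball
  have hKG : E ∩ closedBall z0 (R / 16) ⊆ G := by
    intro z hz
    have hz2 := hz.2
    rw [mem_closedBall] at hz2
    refine ⟨?_, ?_⟩
    · rw [mem_preimage, hpE z ⟨hz.1, by rw [mem_ball]; linarith⟩]
      exact ENNReal.ofReal_lt_top
    · rw [mem_ball]; linarith
  obtain ⟨δ, hδ, hδG⟩ := hE.exists_thickening_subset_open hGo hKG
  set ε := min (δ / 2) (R / 16) with hε
  have hε0 : 0 < ε := by positivity
  let φ : ContDiffBump (0:ℂ) := ⟨ε / 2, ε, by positivity, by linarith⟩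
  set ρ : ℂ → ℝ := φ.normed volume with hρ
  have hρ0 : ∀ t, 0 ≤ ρ t := φ.nonneg_normed
  have hρc : HasCompactSupport ρ := φ.hasCompactSupport_normed
  have hρs : ContDiff ℝ ∞ ρ := φ.contDiff_normed
  have hρcont : Continuous ρ := hρs.continuous
  have hρi : Integrable ρ := hρcont.integrable_of_hasCompactSupport hρc
  have hρ1 : ∫ t, ρ t = 1 := φ.integral_normed
  have hρsupp : ∀ t, ρ t ≠ 0 → ‖t‖ < ε := by
    intro t ht
    have : t ∈ Function.support ρ := ht
    rw [hρ, φ.support_normed_eq, mem_ball_zero_iff] at this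
    exact this
  set P : ℂ → ℝ := convolution ρ qr (ContinuousLinearMap.lsmul ℝ ℝ) volume with hP
  have hPx : ∀ x, P x = ∫ t, ρ t * qr (x - t) := by
    intro x; simp [hP, convolution_def]
  have hPint : ∀ x, Integrable (fun t => ρ t * qr (x - t)) := by
    intro x
    have := (hρc.convolutionExists_left (ContinuousLinearMap.lsmul ℝ ℝ) hρcont
      hqi.locallyIntegrable (μ := volume)) x
    simpa [ConvolutionExistsAt] using this
  have hP0 : ∀ x, 0 ≤ P x := by
    intro x; rw [hPx]
    exact integral_nonneg fun t => mul_nonneg (hρ0 t) (hq0 _)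
  have hPs : ContDiff ℝ ∞ P :=
    hρc.contDiff_convolution_left (ContinuousLinearMap.lsmul ℝ ℝ) hρs hqi.locallyIntegrable
  have hPof : ∀ x, ENNReal.ofReal (P x) = ∫⁻ t, ENNReal.ofReal (ρ t) * q (x - t) := by
    intro x
    rw [hPx, ofReal_integral_eq_lintegral_ofReal (hPint x)
      (Filter.Eventually.of_forall fun t => mul_nonneg (hρ0 t) (hq0 _))]
    apply lintegral_congr_ae
    have : ∀ᵐ t, q (x - t) < ⊤ :=
      (quasiMeasurePreserving_sub_left volume x).ae hqae
    filter_upwards [this] with t ht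
    rw [ENNReal.ofReal_mul (hρ0 t), hqr, ENNReal.ofReal_toReal ht.ne]
  have hρl : ∫⁻ t, ENNReal.ofReal (ρ t) = 1 := by
    rw [← ofReal_integral_eq_lintegral_ofReal hρi (Filter.Eventually.of_forall hρ0), hρ1,
      ENNReal.ofReal_one]
  refine ⟨P, hPs, hP0, hρi.integrable_convolution _ hqi, ?_, ?_, ?_⟩
  · rw [hP, integral_convolution _ hρi hqi, hρ1]; simp
  · intro c r hr hcr
    have hcont : Continuous fun θ => P (circleMap c r θ) :=
      hPs.continuous.comp (continuous_circleMap c r)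
    have hint : IntegrableOn (fun θ => P (circleMap c r θ)) (Ioo (-Real.pi) Real.pi) :=
      (hcont.integrableOn_Icc (a := -Real.pi) (b := Real.pi)).mono_set Ioo_subset_Icc_self
    have h2 : 0 ≤ 2 * Real.pi * P c := by have := hP0 c; positivity
    rw [← ENNReal.ofReal_le_ofReal_iff h2,
      ofReal_integral_eq_lintegral_ofReal hint (Filter.Eventually.of_forall fun θ => hP0 _)]
    simp only [hPof]
    rw [lintegral_lintegral_swap (by fun_prop), ENNReal.ofReal_mul (by positivity), hPof,
      ← lintegral_const_mul' _ _ (by finiteness)]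
    apply lintegral_mono
    intro t
    beta_reduce
    by_cases ht : ρ t = 0
    · simp [ht]
    · have htε := hρsupp t ht
      have hεR : ε ≤ R / 16 := min_le_right _ _
      rw [lintegral_const_mul' _ _ (by finiteness)]
      have e : ∀ θ, circleMap c r θ - t = circleMap (c - t) r θ := by
        intro θ; simp only [circleMap]; ring
      have hcb : closedBall (c - t) r ⊆ ball z0 (R / 4) := by
        intro y hy
        have h3 : y + t ∈ ball z0 (R / 8) := by
          apply hcr
          rw [mem_closedBall, dist_eq_norm] at *
          convert hy using 2; ring
        rw [mem_ball, dist_eq_norm] at *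
        have : y - z0 = (y + t - z0) - t := by ring
        rw [this]
        have := norm_sub_le (y + t - z0) t
        linarith
      have hqp : ∀ y ∈ closedBall (c - t) r, q y = p y := fun y hy =>
        indicator_of_mem (hcb hy) _
      have h4 := hci (c - t) r hr (hcb.trans (ball_subset_ball (by linarith)))
      rw [← hqp _ (mem_closedBall_self hr.le)] at h4
      simp only [e]
      have h5 : ∀ θ, q (circleMap (c - t) r θ) = p (circleMap (c - t) r θ) := fun θ =>
        hqp _ (sphere_subset_closedBall (circleMap_mem_sphere _ hr.le θ))
      simp only [h5]
      calc _ ≤ ENNReal.ofReal (ρ t) * (ENNReal.ofReal (2 * Real.pi) * q (c - t)) := by gcongr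
        _ = _ := by ring
  · refine ⟨thickening (δ / 2) (E ∩ closedBall z0 (R / 16)), isOpen_thickening,
      self_subset_thickening (by positivity) _, ?_⟩
    intro x hx
    rw [← ENNReal.ofReal_le_ofReal_iff (hP0 x), hPof]
    calc ENNReal.ofReal k = ∫⁻ t, ENNReal.ofReal (ρ t) * ENNReal.ofReal k := by
          rw [lintegral_mul_const' _ _ (by finiteness), hρl, one_mul]
      _ ≤ _ := by
        apply lintegral_mono
        intro t
        beta_reduce
        by_cases ht : ρ t = 0
        · simp [ht]
        · have htε := hρsupp t ht
          have hεδ : ε ≤ δ / 2 := min_le_left _ _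
          gcongr
          have hxt : x - t ∈ G := by
            apply hδG
            rw [mem_thickening_iff] at *
            obtain ⟨y, hy, hyd⟩ := hx
            refine ⟨y, hy, ?_⟩
            have : dist (x - t) x = ‖t‖ := by simp [dist_eq_norm]
            have := dist_triangle (x - t) x y
            linarith
          have hqx : q (x - t) = p (x - t) := indicator_of_mem hxt.2 _
          rw [hqx]
          exact le_of_lt hxt.1

end Part2

section Part5
open MeasureTheory Metric Set

lemma aux_conv_deriv (k f : ℂ → ℝ) (hk : Continuous k) (hf : ContDiff ℝ 1 f)
    (hc : HasCompactSupport f) (v : ℂ) :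
    fderiv ℝ (fun x => ∫ t, k t * f (x - t)) 0 v = ∫ t, k t * fderiv ℝ f (0 - t) v := by
  have h := hc.hasFDerivAt_convolution_right (μ := volume) (ContinuousLinearMap.mul ℝ ℝ)
    (hk.locallyIntegrable) hf 0
  have e : (fun x => ∫ t, k t * f (x - t))
      = (convolution k f (ContinuousLinearMap.mul ℝ ℝ) volume) := by
    ext x; simp [convolution_def]
  rw [e, h.fderiv, convolution_precompR_apply _ hk.locallyIntegrable (hc.fderiv ℝ)
    (hf.continuous_fderiv one_ne_zero)]
  simp [convolution_def]

lemma aux_ibp (f g : ℂ → ℝ) (hf : ContDiff ℝ 1 f) (hfc : HasCompactSupport f)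
    (hg : ContDiff ℝ 1 g) (w : ℂ) :
    ∫ t, f t * fderiv ℝ g t w = - ∫ t, fderiv ℝ f t w * g t := by
  have cf : Continuous (fun t => fderiv ℝ f t w) :=
    (hf.continuous_fderiv one_ne_zero).clm_apply continuous_const
  have cg : Continuous (fun t => fderiv ℝ g t w) :=
    (hg.continuous_fderiv one_ne_zero).clm_apply continuous_const
  apply integral_mul_fderiv_eq_neg_fderiv_mul_of_integrable
  · refine (cf.mul hg.continuous).integrable_of_hasCompactSupport ?_
    exact (hfc.fderiv_apply ℝ w).mul_right
  · exact (hf.continuous.mul cg).integrable_of_hasCompactSupport hfc.mul_right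
  · exact (hf.continuous.mul hg.continuous).integrable_of_hasCompactSupport hfc.mul_right
  · exact fun x _ => hf.differentiable one_ne_zero x
  · exact fun x _ => hg.differentiable one_ne_zero x

lemma aux_fderiv_sub (f : ℂ → ℝ) (hf : ContDiff ℝ 1 f) (x t w : ℂ) :
    fderiv ℝ (fun s => f (x - s)) t w = - fderiv ℝ f (x - t) w := by
  have h1 : HasFDerivAt (fun s : ℂ => x - s) (-(ContinuousLinearMap.id ℝ ℂ)) t := by
    simpa using (hasFDerivAt_id (𝕜 := ℝ) t).const_sub x
  have h2 : HasFDerivAt f (fderiv ℝ f (x - t)) (x - t) :=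
    (hf.differentiable one_ne_zero _).hasFDerivAt
  have h3 := h2.comp t h1
  have : (fun s => f (x - s)) = f ∘ (fun s : ℂ => x - s) := rfl
  rw [this, h3.fderiv]; simp

lemma cross_identity (f g : ℂ → ℝ) (hf : ContDiff ℝ 1 f) (hfc : HasCompactSupport f)
    (hg : ContDiff ℝ 1 g) (hgc : HasCompactSupport g) (v w : ℂ) :
    ∫ t, fderiv ℝ f t v * fderiv ℝ g t w = ∫ t, fderiv ℝ f t w * fderiv ℝ g t v := by
  have cf : ∀ w, Continuous (fun t => fderiv ℝ f t w) := fun w =>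
    (hf.continuous_fderiv one_ne_zero).clm_apply continuous_const
  -- G t = g (-t)
  set G : ℂ → ℝ := fun t => g (0 - t) with hG
  have hGd : ContDiff ℝ 1 G := hg.comp (contDiff_const.sub contDiff_id)
  have hGc : HasCompactSupport G := by
    have := hgc.comp_homeomorph (Homeomorph.neg ℂ)
    convert this using 1
    ext t; simp [hG]
  have cG : ∀ w, Continuous (fun t => fderiv ℝ G t w) := fun w =>
    (hGd.continuous_fderiv one_ne_zero).clm_apply continuous_const
  have key : (fun x => ∫ t, fderiv ℝ f t v * G (x - t))
      = fun x => ∫ t, fderiv ℝ G t v * f (x - t) := by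
    ext x
    have h1 := aux_ibp f (fun s => G (x - s)) hf hfc
      (hGd.comp (contDiff_const.sub contDiff_id)) v
    simp_rw [aux_fderiv_sub G hGd x] at h1
    rw [← neg_eq_iff_eq_neg] at h1
    rw [← h1, ← integral_neg, ← integral_sub_left_eq_self _ volume x]
    congr 1; ext t; simp [mul_comm]
  have k1 := aux_conv_deriv _ G (cf v) hGd hGc w
  have k2 := aux_conv_deriv _ f (cG v) hf hfc w
  rw [key, k2] at k1
  have dG : ∀ t w, fderiv ℝ G (0 - t) w = - fderiv ℝ g t w := by
    intro t w; rw [hG, aux_fderiv_sub g hg]; simp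
  simp_rw [dG] at k1
  rw [← integral_sub_left_eq_self _ volume 0] at k1
  simp_rw [dG] at k1
  simp only [zero_sub, neg_neg] at k1
  simp only [neg_mul, mul_neg, integral_neg, neg_inj] at k1
  rw [← k1]
  congr 1; ext t; ring

lemma integrable_normsq {F : Type*} [NormedAddCommGroup F] {c : ℂ → F}
    (hc : Continuous c) (hs : HasCompactSupport c) : Integrable (fun z => ‖c z‖ ^ 2) := by
  apply Continuous.integrable_of_hasCompactSupport (by fun_prop)
  have := hs.comp_left (g := fun x : F => ‖x‖ ^ 2) (by simp)
  exact this

lemma energy_form (m : ℕ) (J0 : (Fin m → ℝ) →L[ℝ] (Fin m → ℝ))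
    (hJJ : ∀ a, J0 (J0 a) = - a) :
    ∃ q : (Fin m → ℝ) → ℝ, Continuous q ∧ q 0 = 0 ∧ (∀ a, ‖a‖ ^ 2 ≤ q a) ∧
      (∀ a, q a ≤ (m * (1 + ‖J0‖ ^ 2)) * ‖a‖ ^ 2) ∧
      ∀ a b, q (a + J0 b) = q a + q b + ∑ i, 2 * (a i * J0 b i - J0 a i * b i) := by
  set q : (Fin m → ℝ) → ℝ := fun a => ∑ i, ((a i) ^ 2 + (J0 a i) ^ 2) with hq
  have qlow : ∀ a, ‖a‖ ^ 2 ≤ q a := by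
    intro a
    have hq0 : 0 ≤ q a := by rw [hq]; positivity
    have : ‖a‖ ≤ √(q a) := by
      rw [pi_norm_le_iff_of_nonneg (Real.sqrt_nonneg _)]
      intro i
      apply Real.abs_le_sqrt
      have : (a i) ^ 2 + (J0 a i) ^ 2 ≤ q a :=
        Finset.single_le_sum (f := fun i => (a i) ^ 2 + (J0 a i) ^ 2)
          (fun i _ => by positivity) (Finset.mem_univ i)
      nlinarith [sq_nonneg (J0 a i)]
    calc ‖a‖ ^ 2 ≤ (√(q a)) ^ 2 := by gcongr
      _ = q a := Real.sq_sqrt hq0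
  have qup : ∀ a, q a ≤ (m * (1 + ‖J0‖ ^ 2)) * ‖a‖ ^ 2 := by
    intro a
    have : ∀ i ∈ Finset.univ, (a i) ^ 2 + (J0 a i) ^ 2 ≤ (1 + ‖J0‖ ^ 2) * ‖a‖ ^ 2 := by
      intro i _
      have h1 : |a i| ≤ ‖a‖ := norm_le_pi_norm a i
      have h2 : |J0 a i| ≤ ‖J0‖ * ‖a‖ := (norm_le_pi_norm (J0 a) i).trans (J0.le_opNorm a)
      have h3 : (a i) ^ 2 ≤ ‖a‖ ^ 2 := by rw [← sq_abs]; gcongr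
      have h4 : (J0 a i) ^ 2 ≤ (‖J0‖ * ‖a‖) ^ 2 := by rw [← sq_abs]; gcongr
      nlinarith
    have := Finset.sum_le_card_nsmul _ _ _ this
    simp only [Finset.card_univ, Fintype.card_fin, nsmul_eq_mul] at this
    rw [hq]; linarith
  have cq : Continuous q := by rw [hq]; fun_prop
  refine ⟨q, cq, by simp [hq], qlow, qup, fun a b => ?_⟩
  simp only [hq, map_add, hJJ, ← Finset.sum_add_distrib]
  refine Finset.sum_congr rfl fun i _ => ?_
  simp only [Pi.add_apply, Pi.neg_apply]; ring

lemma energy_ineq (m : ℕ) (J0 : (Fin m → ℝ) →L[ℝ] (Fin m → ℝ))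
    (hJ : J0.comp J0 = - ContinuousLinearMap.id ℝ (Fin m → ℝ)) :
    ∃ C : ℝ, 0 < C ∧ ∀ φ : ℂ → Fin m → ℝ, ContDiff ℝ 1 φ → HasCompactSupport φ →
      ∫ z, ‖fderiv ℝ φ z Complex.I‖ ^ 2 ≤
        C * ∫ z, ‖fderiv ℝ φ z 1 + J0 (fderiv ℝ φ z Complex.I)‖ ^ 2 := by
  have hJJ : ∀ a, J0 (J0 a) = - a := fun a => by
    have := congrArg (fun L => L a) hJ; simpa using this
  obtain ⟨q, cq, q0, qlow, qup, qexp⟩ := energy_form m J0 hJJ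
  refine ⟨m * (1 + ‖J0‖ ^ 2) + 1, by positivity, fun φ hφ hc => ?_⟩
  set a := fun z => fderiv ℝ φ z 1 with ha
  set b := fun z => fderiv ℝ φ z Complex.I with hb
  have ca : Continuous a := (hφ.continuous_fderiv one_ne_zero).clm_apply continuous_const
  have cb : Continuous b := (hφ.continuous_fderiv one_ne_zero).clm_apply continuous_const
  have sa : HasCompactSupport a := hc.fderiv_apply ℝ 1
  have sb : HasCompactSupport b := hc.fderiv_apply ℝ Complex.I
  have qn : ∀ a, 0 ≤ q a := fun a => (by positivity : (0:ℝ) ≤ ‖a‖ ^ 2).trans (qlow a)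
  have int_q : ∀ c : ℂ → Fin m → ℝ, Continuous c → HasCompactSupport c →
      Integrable (fun z => q (c z)) := fun c hc hs =>
    (cq.comp hc).integrable_of_hasCompactSupport (hs.comp_left q0)
  have scomp : ∀ i, HasCompactSupport (fun z => φ z i) := fun i =>
    hc.comp_left (g := fun x : Fin m → ℝ => x i) rfl
  have sJ : ∀ i, HasCompactSupport (fun z => J0 (φ z) i) := fun i =>
    hc.comp_left (g := fun x : Fin m → ℝ => J0 x i) (by simp)
  have dcomp : ∀ i, ContDiff ℝ 1 (fun z => φ z i) := fun i => contDiff_pi.1 hφ i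
  have dJ : ∀ i, ContDiff ℝ 1 (fun z => J0 (φ z) i) := fun i =>
    contDiff_pi.1 (J0.contDiff.comp hφ) i
  have f1 : ∀ i z v, fderiv ℝ (fun z => φ z i) z v = fderiv ℝ φ z v i := by
    intro i z v
    have := (hasFDerivAt_pi'.1 (hφ.differentiable one_ne_zero z).hasFDerivAt) i
    rw [this.fderiv]; rfl
  have f2 : ∀ i z v, fderiv ℝ (fun z => J0 (φ z) i) z v = J0 (fderiv ℝ φ z v) i := by
    intro i z v
    have h1 := (J0.hasFDerivAt (x := φ z)).comp z (hφ.differentiable one_ne_zero z).hasFDerivAt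
    have := (hasFDerivAt_pi'.1 h1) i
    have e : (fun z => J0 (φ z) i) = fun z => (J0 ∘ φ) z i := rfl
    rw [e, this.fderiv]; rfl
  have cross : ∀ i, ∫ z, (a z i * J0 (b z) i - J0 (a z) i * b z i) = 0 := by
    intro i
    have h := cross_identity _ _ (dcomp i) (scomp i) (dJ i) (sJ i) 1 Complex.I
    simp_rw [f1, f2] at h
    rw [integral_sub, sub_eq_zero]
    · rw [h]; congr 1; ext z; simp [ha, hb, mul_comm]
    · apply Continuous.integrable_of_hasCompactSupport (by fun_prop)
      exact (sa.comp_left (g := fun x : Fin m → ℝ => x i) rfl).mul_right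
    · apply Continuous.integrable_of_hasCompactSupport (by fun_prop)
      exact (sb.comp_left (g := fun x : Fin m → ℝ => x i) rfl).mul_left
  have expand : ∀ z, q (a z + J0 (b z)) = q (a z) + q (b z) +
      ∑ i, 2 * (a z i * J0 (b z) i - J0 (a z) i * b z i) := by
    exact fun z => qexp _ _
  have icross : ∀ i, Integrable (fun z => 2 * (a z i * J0 (b z) i - J0 (a z) i * b z i)) := by
    intro i
    apply Continuous.integrable_of_hasCompactSupport (by fun_prop)
    apply HasCompactSupport.mul_left
    apply HasCompactSupport.sub
    · exact (sa.comp_left (g := fun x : Fin m → ℝ => x i) rfl).mul_right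
    · exact (sb.comp_left (g := fun x : Fin m → ℝ => x i) rfl).mul_left
  have tot : ∫ z, q (a z + J0 (b z)) = (∫ z, q (a z)) + ∫ z, q (b z) := by
    simp_rw [expand]
    have i1 : Integrable (fun z => q (a z) + q (b z)) := (int_q a ca sa).add (int_q b cb sb)
    have i2 : Integrable (fun z => ∑ i, 2 * (a z i * J0 (b z) i - J0 (a z) i * b z i)) :=
      integrable_finsetSum _ fun i _ => icross i
    rw [integral_add i1 i2,
      integral_add (int_q a ca sa) (int_q b cb sb), integral_finsetSum _ fun i _ => icross i]
    simp_rw [integral_const_mul, cross]; simp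
  have sab : HasCompactSupport (fun z => a z + J0 (b z)) := by
    have h2 : HasCompactSupport (fun z => J0 (b z)) :=
      sb.comp_left (g := fun x => J0 x) (map_zero J0)
    exact sa.add h2
  have cab : Continuous (fun z => a z + J0 (b z)) := ca.add (J0.continuous.comp cb)
  have nn : Integrable (fun z => ‖a z + J0 (b z)‖ ^ 2) :=
    integrable_normsq cab sab
  calc ∫ z, ‖b z‖ ^ 2 ≤ ∫ z, q (b z) := by
        apply integral_mono _ (int_q b cb sb) (fun z => qlow _)
        exact integrable_normsq cb sb
    _ ≤ ∫ z, q (a z + J0 (b z)) := by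
        rw [tot]; linarith [integral_nonneg (f := fun z => q (a z)) (μ := volume) fun z => qn _]
    _ ≤ ∫ z, (m * (1 + ‖J0‖ ^ 2)) * ‖a z + J0 (b z)‖ ^ 2 :=
        integral_mono (int_q _ cab sab) (nn.const_mul _) (fun z => qup _)
    _ = (m * (1 + ‖J0‖ ^ 2)) * ∫ z, ‖a z + J0 (b z)‖ ^ 2 := integral_const_mul _ _
    _ ≤ _ := by
        have : 0 ≤ ∫ z, ‖a z + J0 (b z)‖ ^ 2 := integral_nonneg fun z => by positivity
        nlinarith

end Part5

section Part3
open MeasureTheory Metric Set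
open scoped ENNReal ContDiff

lemma taylor2 (P : ℂ → ℝ) (hP : ContDiff ℝ ∞ P) (c : ℂ) (ε : ℝ) (hε : 0 < ε) :
    ∃ δ > 0, ∀ h : ℂ, ‖h‖ < δ →
      |P (c + h) - P c - fderiv ℝ P c h - (1/2) * fderiv ℝ (fderiv ℝ P) c h h| ≤ ε * ‖h‖ ^ 2 := by
  have hd : Differentiable ℝ P := hP.differentiable (by simp)
  have hP1 : ContDiff ℝ ∞ (fderiv ℝ P) := hP.fderiv_right (by simp)
  have hd1 : HasFDerivAt (fderiv ℝ P) (fderiv ℝ (fderiv ℝ P) c) c :=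
    (hP1.differentiable (by simp) c).hasFDerivAt
  have hsym : IsSymmSndFDerivAt ℝ P c := hP.contDiffAt.isSymmSndFDerivAt (by
    simpa using (show (2 : WithTop ℕ∞) ≤ ((⊤ : ℕ∞) : WithTop ℕ∞) from WithTop.coe_le_coe.2 (le_top : (2:ℕ∞) ≤ ⊤)))
  set Q := fderiv ℝ (fderiv ℝ P) c with hQ
  have hQs : ∀ v w, Q v w = Q w v := fun v w => hsym v w
  rw [hasFDerivAt_iff_isLittleO_nhds_zero] at hd1
  have := hd1.bound hε
  obtain ⟨δ, hδ, hb⟩ := Metric.eventually_nhds_iff.1 this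
  refine ⟨δ, hδ, fun h hh => ?_⟩
  set G : ℂ → ℝ := fun x => P (c + x) - P c - fderiv ℝ P c x - (1/2) * Q x x with hG
  have hG' : ∀ x, HasFDerivAt G (fderiv ℝ P (c + x) - fderiv ℝ P c - Q x) x := by
    intro x
    have h1 : HasFDerivAt (fun x => P (c + x)) (fderiv ℝ P (c + x)) x :=
      ((hd (c + x)).hasFDerivAt.comp x ((hasFDerivAt_id x).const_add c)).congr_fderiv (by ext v; simp)
    have h2 : HasFDerivAt (fun x => fderiv ℝ P c x) (fderiv ℝ P c) x := (fderiv ℝ P c).hasFDerivAt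
    have h3 : HasFDerivAt (fun x => Q x x) (Q x + Q.flip x) x := by
      have := (Q.hasFDerivAt (x := x)).clm_apply (hasFDerivAt_id x)
      refine this.congr_fderiv ?_
      ext v; simp
    refine (((h1.sub_const (P c)).sub h2).sub (h3.const_mul (1/2 : ℝ))).congr_fderiv ?_
    ext v
    have := hQs v x
    simp only [one_div, sub_apply, smul_apply, add_apply, ContinuousLinearMap.flip_apply, smul_eq_mul, this]
    ring
  have hconv := (convex_closedBall (0:ℂ) ‖h‖).norm_image_sub_le_of_norm_hasFDerivWithin_le
    (f := G) (C := ε * ‖h‖) (fun x _ => (hG' x).hasFDerivWithinAt) (fun x hx => by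
      rw [mem_closedBall_zero_iff] at hx
      have := hb (y := x) (by rw [dist_zero_right]; linarith)
      exact this.trans (by gcongr)) (x := 0) (y := h) (by simp) (by simp)
  have e0 : G 0 = 0 := by simp [hG]
  rw [e0, sub_zero, sub_zero, Real.norm_eq_abs] at hconv
  calc _ ≤ ε * ‖h‖ * ‖h‖ := hconv
    _ = _ := by ring

lemma lap_nonpos (P : ℂ → ℝ) (hP : ContDiff ℝ ∞ P) (c : ℂ) (r0 : ℝ) (hr0 : 0 < r0)
    (hc : ∀ r, 0 < r → r < r0 →
      ∫ θ in Ioo (-Real.pi) Real.pi, P (circleMap c r θ) ≤ 2 * Real.pi * P c) :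
    fderiv ℝ (fderiv ℝ P) c 1 1 + fderiv ℝ (fderiv ℝ P) c Complex.I Complex.I ≤ 0 := by
  by_contra hcon
  push Not at hcon
  set Q := fderiv ℝ (fderiv ℝ P) c
  set D := Q 1 1 + Q Complex.I Complex.I with hD
  obtain ⟨δ, hδ, hT⟩ := taylor2 P hP c (D / 8) (by positivity)
  set r := min (δ / 2) (r0 / 2) with hr
  have hrp : 0 < r := by positivity
  have h1 := hc r hrp ((min_le_right _ _).trans_lt (by linarith))
  set L := fderiv ℝ P c
  have hpt : ∀ θ : ℝ, P c + (r * (Real.cos θ) * L 1 + r * (Real.sin θ) * L Complex.I)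
      + (1/2) * r ^ 2 * (Real.cos θ ^ 2 * Q 1 1 + Real.sin θ * Real.cos θ * (Q 1 Complex.I + Q Complex.I 1)
        + Real.sin θ ^ 2 * Q Complex.I Complex.I) - D / 8 * r ^ 2 ≤ P (circleMap c r θ) := by
    intro θ
    set h : ℂ := circleMap 0 r θ with hh
    have hn : ‖h‖ = r := by rw [hh, norm_circleMap_zero, abs_of_pos hrp]
    have e1 : circleMap c r θ = c + h := by simp [hh, circleMap]
    have e2 : h = (r * Real.cos θ) • (1:ℂ) + (r * Real.sin θ) • Complex.I := by
      rw [hh, circleMap, Complex.exp_mul_I]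
      simp
      ring
    have := hT h (by rw [hn]; exact (min_le_left _ _).trans_lt (by linarith))
    rw [hn] at this
    have h3 := (abs_le.1 this).1
    rw [e1]
    have e3 : L h = r * (Real.cos θ) * L 1 + r * (Real.sin θ) * L Complex.I := by
      rw [e2, map_add, map_smul, map_smul]; simp
    have e4 : Q h h = r ^ 2 * (Real.cos θ ^ 2 * Q 1 1 + Real.sin θ * Real.cos θ * (Q 1 Complex.I + Q Complex.I 1)
        + Real.sin θ ^ 2 * Q Complex.I Complex.I) := by
      rw [e2]
      simp only [map_add, map_smul, add_apply, smul_apply,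
        smul_eq_mul]
      ring
    change -(D / 8 * r ^ 2) ≤ P (c + h) - P c - L h - 1 / 2 * Q h h at h3
    rw [e3, e4] at h3
    linarith
  have hcont : Continuous fun θ => P (circleMap c r θ) := hP.continuous.comp (continuous_circleMap c r)
  rw [← integral_Ioc_eq_integral_Ioo, ← intervalIntegral.integral_of_le (by linarith [Real.pi_pos])] at h1
  have h2 := intervalIntegral.integral_mono (a := -Real.pi) (b := Real.pi) (μ := volume)
    (by linarith [Real.pi_pos]) (Continuous.intervalIntegrable (by fun_prop) _ _)
    (hcont.intervalIntegrable _ _) hpt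
  have e : ∫ θ in (-Real.pi)..Real.pi, (P c + (r * (Real.cos θ) * L 1 + r * (Real.sin θ) * L Complex.I)
      + (1/2) * r ^ 2 * (Real.cos θ ^ 2 * Q 1 1 + Real.sin θ * Real.cos θ * (Q 1 Complex.I + Q Complex.I 1)
        + Real.sin θ ^ 2 * Q Complex.I Complex.I) - D / 8 * r ^ 2) =
      2 * Real.pi * P c + (1/2) * r ^ 2 * (Real.pi * D) - 2 * Real.pi * (D / 8 * r ^ 2) := by
    have ii : ∀ f : ℝ → ℝ, Continuous f → IntervalIntegrable f volume (-Real.pi) Real.pi :=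
      fun f hf => hf.intervalIntegrable _ _
    rw [intervalIntegral.integral_sub (ii _ (by fun_prop)) (ii _ (by fun_prop)),
      intervalIntegral.integral_add (ii _ (by fun_prop)) (ii _ (by fun_prop)),
      intervalIntegral.integral_add (ii _ (by fun_prop)) (ii _ (by fun_prop)),
      intervalIntegral.integral_add (ii _ (by fun_prop)) (ii _ (by fun_prop)),
      intervalIntegral.integral_const_mul,
      intervalIntegral.integral_add (ii _ (by fun_prop)) (ii _ (by fun_prop)),
      intervalIntegral.integral_add (ii _ (by fun_prop)) (ii _ (by fun_prop))]
    simp only [intervalIntegral.integral_mul_const, intervalIntegral.integral_const_mul,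
      intervalIntegral.integral_const, integral_cos, integral_sin, integral_cos_sq, integral_sin_sq,
      integral_sin_mul_cos₁]
    simp
    rw [hD]; ring
  rw [e] at h2
  have := h2.trans h1
  have h3 : 0 < Real.pi * D * r ^ 2 := by have := Real.pi_pos; positivity
  nlinarith

lemma log_grad (P : ℂ → ℝ) (hP : ContDiff ℝ ∞ P) (hP0 : ∀ x, 0 ≤ P x) (z0 : ℂ) (ρ : ℝ)
    (hc : ∀ c r, 0 < r → closedBall c r ⊆ ball z0 ρ →
      ∫ θ in Ioo (-Real.pi) Real.pi, P (circleMap c r θ) ≤ 2 * Real.pi * P c)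
    (φ : ℂ → ℝ) (hφ : ContDiff ℝ 1 φ) (hφc : HasCompactSupport φ)
    (hφs : ∀ z, z ∉ ball z0 ρ → φ z = 0) :
    ∫ z, φ z ^ 2 * ((fderiv ℝ P z 1 / (1 + P z)) ^ 2 + (fderiv ℝ P z Complex.I / (1 + P z)) ^ 2) ≤
      4 * ∫ z, ((fderiv ℝ φ z 1) ^ 2 + (fderiv ℝ φ z Complex.I) ^ 2) := by
  have hd : Differentiable ℝ P := hP.differentiable (by simp)
  have hP1 : ContDiff ℝ ∞ (fderiv ℝ P) := hP.fderiv_right (by simp)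
  have hd1 : Differentiable ℝ (fderiv ℝ P) := hP1.differentiable (by simp)
  have hPC1 : ContDiff ℝ 1 P := hP.of_le (by simp)
  have hpos : ∀ z, 0 < 1 + P z := fun z => by have := hP0 z; linarith
  have hφd : Differentiable ℝ φ := hφ.differentiable (by simp)
  have hlap : ∀ z ∈ ball z0 ρ,
      fderiv ℝ (fderiv ℝ P) z 1 1 + fderiv ℝ (fderiv ℝ P) z Complex.I Complex.I ≤ 0 := by
    intro z hz
    rw [mem_ball] at hz
    apply lap_nonpos P hP z (ρ - dist z z0) (by linarith)
    intro r hr hr2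
    apply hc z r hr
    intro y hy
    rw [mem_closedBall] at hy
    rw [mem_ball]
    have := dist_triangle y z z0
    linarith
  set ψ : ℂ → ℝ := fun z => φ z ^ 2 * (1 + P z)⁻¹ with hψ
  have hψC : ContDiff ℝ 1 ψ :=
    (hφ.pow 2).mul ((contDiff_const.add hPC1).inv fun z => (hpos z).ne')
  have hsupp : ∀ g : ℂ → ℝ, (∀ z, φ z = 0 → g z = 0) → HasCompactSupport g := by
    intro g hg
    apply hφc.mono
    intro z hz hz2
    exact hz (hg z hz2)
  have hψc : HasCompactSupport ψ := hsupp ψ (fun z hz => by simp [hψ, hz])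
  have hψ' : ∀ z w, fderiv ℝ ψ z w = 2 * φ z * fderiv ℝ φ z w * (1 + P z)⁻¹
      - φ z ^ 2 * (fderiv ℝ P z w) * ((1 + P z)⁻¹) ^ 2 := by
    intro z w
    have h1 : HasFDerivAt (fun z => φ z ^ 2) ((2 * φ z) • fderiv ℝ φ z) z := by
      have := (hφd z).hasFDerivAt.pow 2
      simpa using this
    have h2 : HasFDerivAt (fun z => (1 + P z)⁻¹) (-((1 + P z) ^ 2)⁻¹ • fderiv ℝ P z) z :=
      (hasDerivAt_inv (hpos z).ne').comp_hasFDerivAt z ((hd z).hasFDerivAt.const_add 1)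
    have h3 : HasFDerivAt ψ _ z := h1.mul h2
    rw [h3.fderiv]
    simp only [add_apply, smul_apply, smul_eq_mul]
    have := (hpos z).ne'
    field_simp
    ring
  have hg : ∀ w, ContDiff ℝ 1 (fun z => fderiv ℝ P z w) := fun w =>
    (hP1.clm_apply contDiff_const).of_le (by simp)
  have hibp : ∀ w, ∫ z, ψ z * fderiv ℝ (fderiv ℝ P) z w w = - ∫ z, fderiv ℝ ψ z w * fderiv ℝ P z w := by
    intro w
    rw [← aux_ibp ψ (fun z => fderiv ℝ P z w) hψC hψc (hg w) w]
    congr 1; ext z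
    rw [fderiv_clm_apply (hd1 z) (differentiableAt_const w)]
    simp
  have c0 : Continuous φ := hφ.continuous
  have c1 : Continuous P := hP.continuous
  have c2 : ∀ w, Continuous fun z => fderiv ℝ φ z w := fun w =>
    (hφ.continuous_fderiv (by simp)).clm_apply continuous_const
  have c3 : ∀ w, Continuous fun z => fderiv ℝ P z w := fun w => (hg w).continuous
  have c4 : Continuous fun z => (1 + P z)⁻¹ := (continuous_const.add c1).inv₀ fun z => (hpos z).ne'
  have c5 : ∀ w, Continuous fun z => fderiv ℝ (fderiv ℝ P) z w w := fun w =>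
    ((hP1.continuous_fderiv (by simp)).clm_apply continuous_const).clm_apply continuous_const
  have c6 : ∀ w, Continuous fun z => fderiv ℝ P z w / (1 + P z) := fun w => by
    simp only [div_eq_mul_inv]; exact (c3 w).mul c4
  have iψ : ∀ w, Integrable fun z => ψ z * fderiv ℝ (fderiv ℝ P) z w w := fun w =>
    (hψC.continuous.mul (c5 w)).integrable_of_hasCompactSupport
      (hsupp _ fun z hz => by simp [hψ, hz])
  have hle : ∫ z, ψ z * fderiv ℝ (fderiv ℝ P) z 1 1 + ψ z * fderiv ℝ (fderiv ℝ P) z Complex.I Complex.I ≤ 0 := by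
    apply integral_nonpos
    intro z
    by_cases hz : z ∈ ball z0 ρ
    · have h1 := hlap z hz
      have h2 : 0 ≤ ψ z := by have := hpos z; simp only [hψ]; positivity
      have h3 := mul_nonpos_of_nonneg_of_nonpos h2 h1
      rw [mul_add] at h3
      exact h3
    · simp [hψ, hφs z hz]
  rw [integral_add (iψ 1) (iψ Complex.I), hibp, hibp] at hle
  set T : ℂ → ℂ → ℝ := fun w z => fderiv ℝ P z w / (1 + P z) with hTdef
  have iA : ∀ w, Integrable fun z => φ z ^ 2 * T w z ^ 2 := fun w =>
    ((c0.pow 2).mul ((c6 w).pow 2)).integrable_of_hasCompactSupport (hsupp _ fun z hz => by simp [hz])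
  have iB : ∀ w, Integrable fun z => 2 * φ z * fderiv ℝ φ z w * T w z := fun w =>
    (((continuous_const.mul c0).mul (c2 w)).mul (c6 w)).integrable_of_hasCompactSupport
      (hsupp _ fun z hz => by simp [hz])
  have iC : ∀ w, Integrable fun z => (fderiv ℝ φ z w) ^ 2 := fun w => by
    have hcs : HasCompactSupport fun z => fderiv ℝ φ z w := hφc.fderiv_apply ℝ w
    have h := integrable_normsq (c2 w) hcs
    simp only [Real.norm_eq_abs, sq_abs] at h
    exact h
  have hsplit : ∀ w, ∫ z, fderiv ℝ ψ z w * fderiv ℝ P z w =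
      (∫ z, 2 * φ z * fderiv ℝ φ z w * T w z) - ∫ z, φ z ^ 2 * T w z ^ 2 := by
    intro w
    rw [← integral_sub (iB w) (iA w)]
    congr 1; ext z
    rw [hψ']
    have := (hpos z).ne'
    simp only [hTdef]
    field_simp
  have hyoung : ∀ w, ∫ z, 2 * φ z * fderiv ℝ φ z w * T w z ≤
      (1/2) * (∫ z, φ z ^ 2 * T w z ^ 2) + 2 * ∫ z, (fderiv ℝ φ z w) ^ 2 := by
    intro w
    rw [← integral_const_mul, ← integral_const_mul, ← integral_add ((iA w).const_mul _) ((iC w).const_mul _)]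
    apply integral_mono (iB w) (((iA w).const_mul _).add ((iC w).const_mul _))
    intro z
    show 2 * φ z * fderiv ℝ φ z w * T w z ≤ 1/2 * (φ z ^ 2 * T w z ^ 2) + 2 * (fderiv ℝ φ z w) ^ 2
    nlinarith [sq_nonneg (φ z * T w z - 2 * fderiv ℝ φ z w)]
  rw [hsplit, hsplit] at hle
  have y1 := hyoung 1
  have y2 := hyoung Complex.I
  have e1 : ∫ z, φ z ^ 2 * ((fderiv ℝ P z 1 / (1 + P z)) ^ 2 + (fderiv ℝ P z Complex.I / (1 + P z)) ^ 2)
      = (∫ z, φ z ^ 2 * T 1 z ^ 2) + ∫ z, φ z ^ 2 * T Complex.I z ^ 2 := by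
    rw [← integral_add (iA 1) (iA Complex.I)]
    congr 1; ext z; simp only [hTdef]; ring
  rw [e1, integral_add (iC 1) (iC Complex.I)]
  linarith

end Part3

section Part4
open MeasureTheory Metric Set
open scoped ENNReal ContDiff

lemma clm_norm_le_two {F : Type*} [NormedAddCommGroup F] [NormedSpace ℝ F] (A : ℂ →L[ℝ] F) :
    ‖A‖ ≤ ‖A 1‖ + ‖A Complex.I‖ := by
  apply ContinuousLinearMap.opNorm_le_bound _ (by positivity)
  intro z
  have e : A z = z.re • A 1 + z.im • A Complex.I := by
    rw [← map_smul, ← map_smul, ← map_add]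
    congr 1
    apply Complex.ext <;> simp
  rw [e]
  calc _ ≤ ‖z.re • A 1‖ + ‖z.im • A Complex.I‖ := norm_add_le _ _
    _ = |z.re| * ‖A 1‖ + |z.im| * ‖A Complex.I‖ := by simp [norm_smul]
    _ ≤ ‖z‖ * ‖A 1‖ + ‖z‖ * ‖A Complex.I‖ := by
      have := Complex.abs_re_le_norm z
      have := Complex.abs_im_le_norm z
      gcongr
    _ = _ := by ring

lemma smoothTransition_bounds : ∃ C > 0, (∀ x, |deriv Real.smoothTransition x| ≤ C) ∧
    ∀ x, 0 ≤ x → Real.smoothTransition x ≤ C * x := by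
  have hs : ContDiff ℝ 1 Real.smoothTransition := Real.smoothTransition.contDiff
  have hc : Continuous (deriv Real.smoothTransition) := hs.continuous_deriv le_rfl
  obtain ⟨C, hC⟩ := (isCompact_Icc (a := (0:ℝ)) (b := 1)).exists_bound_of_continuousOn hc.continuousOn
  have hC0 : 0 ≤ C := (norm_nonneg _).trans (hC 0 (by simp))
  have hd : ∀ x, |deriv Real.smoothTransition x| ≤ C + 1 := by
    intro x
    by_cases h0 : x < 0
    · have : Real.smoothTransition =ᶠ[nhds x] fun _ => 0 := by
        filter_upwards [Iio_mem_nhds h0] with y hy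
        exact Real.smoothTransition.zero_of_nonpos (le_of_lt hy)
      rw [this.deriv_eq]; simp; linarith
    by_cases h1 : 1 < x
    · have : Real.smoothTransition =ᶠ[nhds x] fun _ => 1 := by
        filter_upwards [Ioi_mem_nhds h1] with y hy
        exact Real.smoothTransition.one_of_one_le (le_of_lt hy)
      rw [this.deriv_eq]; simp; linarith
    have := hC x ⟨by linarith, by linarith⟩
    rw [Real.norm_eq_abs] at this
    linarith
  refine ⟨C + 1, by linarith, hd, fun x hx => ?_⟩
  have := convex_univ.norm_image_sub_le_of_norm_deriv_le (f := Real.smoothTransition) (C := C + 1)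
    (fun y _ => hs.differentiable (by simp) y) (fun y _ => hd y) (mem_univ (0:ℝ)) (mem_univ x)
  rw [Real.smoothTransition.zero_of_nonpos le_rfl] at this
  simp only [sub_zero, Real.norm_eq_abs, abs_of_nonneg hx] at this
  exact (le_abs_self _).trans this

lemma cutoffs (E Ω : Set ℂ) (hΩ : IsOpen Ω)
    (hEclosed : ∀ z ∈ Ω, z ∈ closure E → z ∈ E) (hpolar : PolarIn E Ω) (z0 : ℂ) (hz : z0 ∈ Ω) :
    ∃ R > 0, closedBall z0 R ⊆ Ω ∧ ∀ ε > 0, ∃ χ : ℂ → ℝ, ContDiff ℝ 1 χ ∧ (∀ z, 0 ≤ χ z ∧ χ z ≤ 1) ∧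
      (∃ U, IsOpen U ∧ E ∩ closedBall z0 R ⊆ U ∧ ∀ x ∈ U, χ x = 1) ∧
      ∫ z in ball z0 R, χ z ^ 2 ≤ ε ∧ ∫ z in ball z0 R, ‖fderiv ℝ χ z‖ ^ 2 ≤ ε := by
  obtain ⟨R1, hR1, hsub, p, hl, hci, hpE, hne⟩ := polar_p E Ω hΩ hpolar z0 hz
  have hcomp : IsCompact (E ∩ closedBall z0 (R1 / 16)) := by
    have : E ∩ closedBall z0 (R1 / 16) = closure E ∩ closedBall z0 (R1 / 16) := by
      apply Subset.antisymm
      · exact inter_subset_inter_left _ subset_closure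
      · rintro x ⟨hx1, hx2⟩
        exact ⟨hEclosed x (hsub (closedBall_subset_closedBall (by linarith) hx2)) hx1, hx2⟩
    rw [this]
    exact (isCompact_closedBall _ _).inter_left isClosed_closure
  obtain ⟨M1, hM⟩ := mollified E z0 R1 hR1 hcomp p hl hci hpE hne
  obtain ⟨C, hC, hCd, hCv⟩ := smoothTransition_bounds
  let φ : ContDiffBump z0 := ⟨R1 / 32, R1 / 16, by positivity, by linarith⟩
  have hφ : ContDiff ℝ 1 φ := φ.contDiff
  have hφc : HasCompactSupport φ := φ.hasCompactSupport
  set D := ∫ z, ((fderiv ℝ φ z 1) ^ 2 + (fderiv ℝ φ z Complex.I) ^ 2) with hD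
  have hD0 : 0 ≤ D := integral_nonneg fun z => by positivity
  refine ⟨R1 / 32, by positivity, (closedBall_subset_closedBall (by linarith)).trans hsub, ?_⟩
  intro ε hε
  set L := max 1 (max (C * |M1| / ε) (C ^ 2 * 8 * D / ε)) with hL
  have hL1 : 1 ≤ L := le_max_left _ _
  have hL2 : C * |M1| / L ≤ ε := by
    rw [div_le_iff₀ (by linarith)]
    have : C * |M1| / ε ≤ L := (le_max_left _ _).trans (le_max_right _ _)
    rw [div_le_iff₀ hε] at this
    linarith
  have hL3 : C ^ 2 * 8 * D / L ^ 2 ≤ ε := by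
    rw [div_le_iff₀ (by positivity)]
    have : C ^ 2 * 8 * D / ε ≤ L := (le_max_right _ _).trans (le_max_right _ _)
    rw [div_le_iff₀ hε] at this
    have h2 : L * ε ≤ L ^ 2 * ε := by
      have : L ≤ L ^ 2 := by nlinarith
      gcongr
    linarith
  have hL0 : 0 < L := by linarith
  obtain ⟨P, hPs, hP0, hPi, hPM, hPc, U, hUo, hEU, hUk⟩ := hM (Real.exp L - 1) (by
    have := Real.add_one_le_exp L; linarith)
  have hpos : ∀ z, 0 < 1 + P z := fun z => by have := hP0 z; linarith
  have hPC1 : ContDiff ℝ 1 P := hPs.of_le (by simp)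
  set t : ℂ → ℝ := fun z => Real.log (1 + P z) / L with ht
  have htC : ContDiff ℝ 1 t := by
    apply ContDiff.div_const
    exact (contDiff_const.add hPC1).log fun z => (hpos z).ne'
  have ht0 : ∀ z, 0 ≤ t z := fun z =>
    div_nonneg (Real.log_nonneg (by have := hP0 z; linarith)) hL0.le
  have htP : ∀ z, t z ≤ P z / L := by
    intro z
    have := Real.log_le_sub_one_of_pos (hpos z)
    simp only [ht]
    gcongr
    linarith
  have hsC : ContDiff ℝ 1 Real.smoothTransition := Real.smoothTransition.contDiff
  set χ : ℂ → ℝ := fun z => Real.smoothTransition (t z) with hχ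
  have hχC : ContDiff ℝ 1 χ := hsC.comp htC
  have hχ01 : ∀ z, 0 ≤ χ z ∧ χ z ≤ 1 := fun z =>
    ⟨Real.smoothTransition.nonneg _, Real.smoothTransition.le_one _⟩
  have hfin : IsFiniteMeasure (volume.restrict (ball z0 (R1 / 32))) :=
    ⟨by rw [Measure.restrict_apply_univ]; exact measure_ball_lt_top⟩
  have hio : ∀ f : ℂ → ℝ, Continuous f → IntegrableOn f (ball z0 (R1 / 32)) := fun f hf =>
    (hf.continuousOn.integrableOn_compact (isCompact_closedBall z0 (R1 / 32))).mono_set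
      ball_subset_closedBall
  refine ⟨χ, hχC, hχ01, ⟨U, hUo, ?_, ?_⟩, ?_, ?_⟩
  · exact (inter_subset_inter_right _ (closedBall_subset_closedBall (by linarith))).trans hEU
  · intro x hx
    apply Real.smoothTransition.one_of_one_le
    simp only [ht]
    rw [le_div_iff₀ hL0, one_mul, Real.le_log_iff_exp_le (hpos x)]
    have := hUk x hx
    linarith
  · calc ∫ z in ball z0 (R1 / 32), χ z ^ 2 ≤ ∫ z in ball z0 (R1 / 32), C / L * P z := by
          apply integral_mono (hio _ (hχC.continuous.pow 2)) (hPi.integrableOn.const_mul _)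
          intro z
          have h1 := hχ01 z
          have h2 : χ z ≤ C * (P z / L) := (hCv _ (ht0 z)).trans (by gcongr; exact htP z)
          show χ z ^ 2 ≤ C / L * P z
          have e : C / L * P z = C * (P z / L) := by ring
          rw [e]
          nlinarith
      _ = C / L * ∫ z in ball z0 (R1 / 32), P z := by rw [integral_const_mul]
      _ ≤ C / L * |M1| := by
          gcongr
          refine (setIntegral_le_integral hPi (Filter.Eventually.of_forall hP0)).trans
            (hPM.trans (le_abs_self _))
      _ ≤ ε := by rw [div_mul_eq_mul_div]; exact hL2
  · have hlg := log_grad P hPs hP0 z0 (R1 / 8) hPc φ hφ hφc (fun z hz => by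
      apply φ.zero_of_le_dist
      rw [mem_ball] at hz
      show R1 / 16 ≤ _
      linarith)
    set F : ℂ → ℝ := fun z =>
      (fderiv ℝ P z 1 / (1 + P z)) ^ 2 + (fderiv ℝ P z Complex.I / (1 + P z)) ^ 2 with hF
    have cF : ∀ w, Continuous fun z => fderiv ℝ P z w / (1 + P z) := fun w =>
      ((hPC1.continuous_fderiv (by simp)).clm_apply continuous_const).div
        (continuous_const.add hPC1.continuous) fun z => (hpos z).ne'
    have cF2 : Continuous F := ((cF 1).pow 2).add ((cF Complex.I).pow 2)
    have hgr : ∀ z, ‖fderiv ℝ χ z‖ ^ 2 ≤ 2 * C ^ 2 / L ^ 2 * F z := by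
      intro z
      have h1 : HasFDerivAt t (L⁻¹ • (1 + P z)⁻¹ • fderiv ℝ P z) z := by
        have h := ((hPC1.differentiable (by simp) z).hasFDerivAt.const_add 1).log (hpos z).ne'
        have h3 := h.const_mul L⁻¹
        refine h3.congr_of_eventuallyEq (Filter.Eventually.of_forall fun y => ?_)
        simp only [ht]; ring
      have h2 : HasFDerivAt χ (deriv Real.smoothTransition (t z) • (L⁻¹ • (1 + P z)⁻¹ • fderiv ℝ P z)) z :=
        (hsC.differentiable (by simp) (t z)).hasDerivAt.comp_hasFDerivAt z h1
      rw [h2.fderiv, norm_smul, norm_smul, mul_pow, mul_pow, Real.norm_eq_abs, Real.norm_eq_abs]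
      have h4 := clm_norm_le_two ((1 + P z)⁻¹ • fderiv ℝ P z)
      have h5 : ‖(1 + P z)⁻¹ • fderiv ℝ P z‖ ^ 2 ≤ 2 * F z := by
        refine (pow_le_pow_left₀ (norm_nonneg _) h4 2).trans ?_
        have e1 : ∀ w, ((1 + P z)⁻¹ • fderiv ℝ P z) w = fderiv ℝ P z w / (1 + P z) := by
          intro w; simp [div_eq_inv_mul]
        rw [e1, e1, Real.norm_eq_abs, Real.norm_eq_abs]
        simp only [hF]
        rw [← sq_abs (fderiv ℝ P z 1 / (1 + P z)), ← sq_abs (fderiv ℝ P z Complex.I / (1 + P z))]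
        nlinarith [sq_nonneg (|fderiv ℝ P z 1 / (1 + P z)| - |fderiv ℝ P z Complex.I / (1 + P z)|)]
      have h6 := hCd (t z)
      have h7 : |L⁻¹| ^ 2 = (L ^ 2)⁻¹ := by rw [sq_abs, inv_pow]
      rw [h7]
      calc _ ≤ C ^ 2 * ((L ^ 2)⁻¹ * (2 * F z)) := by gcongr
        _ = _ := by ring
    have iall : Integrable fun z => φ z ^ 2 * F z :=
      ((φ.continuous.pow 2).mul cF2).integrable_of_hasCompactSupport
        (hφc.mono fun z hz hz2 => hz (by simp [hz2]))
    calc _ ≤ ∫ z in ball z0 (R1 / 32), 2 * C ^ 2 / L ^ 2 * F z := by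
          apply integral_mono (hio _ ((hχC.continuous_fderiv (by simp)).norm.pow 2))
            ((hio _ cF2).const_mul _)
          exact hgr
      _ = 2 * C ^ 2 / L ^ 2 * ∫ z in ball z0 (R1 / 32), F z := by rw [integral_const_mul]
      _ = 2 * C ^ 2 / L ^ 2 * ∫ z in ball z0 (R1 / 32), φ z ^ 2 * F z := by
          congr 1
          apply setIntegral_congr_fun measurableSet_ball
          intro z hz
          have : φ z = 1 := φ.one_of_mem_closedBall (ball_subset_closedBall hz)
          simp [this]
      _ ≤ 2 * C ^ 2 / L ^ 2 * ∫ z, φ z ^ 2 * F z := by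
          refine mul_le_mul_of_nonneg_left (setIntegral_le_integral iall ?_) (by positivity)
          refine Filter.Eventually.of_forall fun z => ?_
          have : 0 ≤ F z := by simp only [hF]; positivity
          show 0 ≤ φ z ^ 2 * F z
          positivity
      _ ≤ 2 * C ^ 2 / L ^ 2 * (4 * D) := by gcongr
      _ = C ^ 2 * 8 * D / L ^ 2 := by ring
      _ ≤ ε := hL3

end Part4

section Part6
open MeasureTheory Metric Set

/-- Multiplication by a complex number, through a complex structure `J`. -/
noncomputable def cmul {W : Type*} [NormedAddCommGroup W] [NormedSpace ℝ W]
    (J : W →L[ℝ] W) (c : ℂ) : W →L[ℝ] W :=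
  c.re • ContinuousLinearMap.id ℝ W + c.im • J

section cmul
variable {W : Type*} [NormedAddCommGroup W] [NormedSpace ℝ W]

lemma cmul_apply (J : W →L[ℝ] W) (c : ℂ) (w : W) : cmul J c w = c.re • w + c.im • J w := by
  simp [cmul]

lemma cmul_mul (J : W →L[ℝ] W) (hJ : ∀ a, J (J a) = -a) (c d : ℂ) (w : W) :
    cmul J (c * d) w = cmul J c (cmul J d w) := by
  simp only [cmul_apply, Complex.mul_re, Complex.mul_im, map_add, map_smul, hJ]
  module

lemma cmul_add (J : W →L[ℝ] W) (c d : ℂ) (w : W) :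
    cmul J (c + d) w = cmul J c w + cmul J d w := by
  simp only [cmul_apply, Complex.add_re, Complex.add_im]; module

lemma cmul_neg (J : W →L[ℝ] W) (c : ℂ) (w : W) : cmul J (-c) w = - cmul J c w := by
  simp only [cmul_apply, Complex.neg_re, Complex.neg_im]; module

lemma cmul_sub (J : W →L[ℝ] W) (c d : ℂ) (w : W) :
    cmul J (c - d) w = cmul J c w - cmul J d w := by
  simp only [cmul_apply, Complex.sub_re, Complex.sub_im]; module

lemma cmul_ofReal (J : W →L[ℝ] W) (c : ℝ) (w : W) : cmul J c w = c • w := by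
  simp [cmul_apply]

lemma cmul_one (J : W →L[ℝ] W) (w : W) : cmul J 1 w = w := by
  simp [cmul_apply]

lemma cmul_norm_le (J : W →L[ℝ] W) (c : ℂ) (w : W) : ‖cmul J c w‖ ≤ (1 + ‖J‖) * ‖c‖ * ‖w‖ := by
  rw [cmul_apply]
  calc _ ≤ ‖c.re • w‖ + ‖c.im • J w‖ := norm_add_le _ _
    _ = |c.re| * ‖w‖ + |c.im| * ‖J w‖ := by simp [norm_smul]
    _ ≤ ‖c‖ * ‖w‖ + ‖c‖ * (‖J‖ * ‖w‖) := by
        gcongr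
        · exact Complex.abs_re_le_norm c
        · exact Complex.abs_im_le_norm c
        · exact J.le_opNorm w
    _ = _ := by ring

lemma cmul_continuous (J : W →L[ℝ] W) : Continuous (fun p : ℂ × W => cmul J p.1 p.2) := by
  simp only [cmul_apply]; fun_prop

end cmul

section polar
variable {W : Type*} [NormedAddCommGroup W] [NormedSpace ℝ W]

lemma polar_integrable {W : Type*} [NormedAddCommGroup W] (h : ℝ × ℝ → W) (hc : Continuous h) (R : ℝ)
    (h0 : ∀ p, R < p.1 → h p = 0) :
    IntegrableOn h (Ioi (0:ℝ) ×ˢ Ioo (-Real.pi) Real.pi) := by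
  have h1 : IntegrableOn h (Icc (0:ℝ) R ×ˢ Icc (-Real.pi) Real.pi) :=
    hc.continuousOn.integrableOn_compact (isCompact_Icc.prod isCompact_Icc)
  refine h1.of_forall_sdiff_eq_zero (measurableSet_Ioi.prod measurableSet_Ioo) ?_
  rintro ⟨r, θ⟩ ⟨⟨hr, hθ⟩, hn⟩
  apply h0
  by_contra hlt
  exact hn ⟨⟨le_of_lt hr, not_lt.1 hlt⟩, Ioo_subset_Icc_self hθ⟩

lemma cauchy_rep_zero [CompleteSpace W] (J : W →L[ℝ] W) (hJ : ∀ a, J (J a) = -a)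
    (φ : ℂ → W) (hφ : ContDiff ℝ 1 φ) (hc : HasCompactSupport φ) :
    ∫ η, cmul J (η⁻¹) (fderiv ℝ φ η 1 + J (fderiv ℝ φ η Complex.I))
      = - (2 * Real.pi) • φ 0 := by
  rw [← Complex.integral_comp_polarCoord_symm]
  set e : ℝ → ℂ := fun θ => (Real.cos θ + Real.sin θ * Complex.I) with he
  have ce : Continuous e := by rw [he]; fun_prop
  have ne : ∀ θ, ‖e θ‖ = 1 := by
    intro θ
    have : e θ = Complex.exp (θ * Complex.I) := by
      rw [Complex.exp_mul_I]; simp [he]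
    rw [this]; exact Complex.norm_exp_ofReal_mul_I θ
  have cD : Continuous (fderiv ℝ φ) := hφ.continuous_fderiv one_ne_zero
  obtain ⟨R, hRpos, hR⟩ : ∃ R : ℝ, 0 < R ∧ ∀ z, R < ‖z‖ → φ z = 0 ∧ fderiv ℝ φ z = 0 := by
    obtain ⟨R, hR⟩ := hc.isCompact.isBounded.subset_ball (0:ℂ)
    refine ⟨max R 1, by positivity, fun z hz => ?_⟩
    have hz' : z ∉ tsupport φ := fun hm => by
      have := hR hm
      rw [mem_ball_zero_iff] at this
      exact absurd ((le_max_left R 1).trans_lt hz) (not_lt.2 this.le)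
    refine ⟨image_eq_zero_of_notMem_tsupport hz', ?_⟩
    by_contra hne
    exact hz' (support_fderiv_subset ℝ hne)
  set g1 : ℝ × ℝ → W := fun p => fderiv ℝ φ (p.1 * e p.2) (e p.2) with hg1
  set g2 : ℝ × ℝ → W := fun p => J (fderiv ℝ φ (p.1 * e p.2) (Complex.I * e p.2)) with hg2
  have cg1 : Continuous g1 := by rw [hg1]; fun_prop
  have cg2 : Continuous g2 := by rw [hg2]; fun_prop
  have z12 : ∀ p : ℝ × ℝ, R < p.1 → fderiv ℝ φ (p.1 * e p.2) = 0 := fun p hp => by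
    refine (hR _ ?_).2
    rw [norm_mul, ne, mul_one, Complex.norm_real]
    exact hp.trans_le (le_abs_self _)
  have i1 := polar_integrable g1 cg1 R (fun p hp => by simp [hg1, z12 p hp])
  have i2 := polar_integrable g2 cg2 R (fun p hp => by simp [hg2, z12 p hp])
  have ht : polarCoord.target = Ioi (0:ℝ) ×ˢ Ioo (-Real.pi) Real.pi := rfl
  have step : ∫ p in polarCoord.target, p.1 • (cmul J ((Complex.polarCoord.symm p)⁻¹)
      (fderiv ℝ φ (Complex.polarCoord.symm p) 1
        + J (fderiv ℝ φ (Complex.polarCoord.symm p) Complex.I)))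
      = ∫ p in polarCoord.target, (g1 p + g2 p) := by
    refine setIntegral_congr_fun polarCoord.open_target.measurableSet ?_
    rintro ⟨r, θ⟩ ⟨hr, hθ⟩
    have hr : 0 < r := hr
    simp only [Complex.polarCoord_symm_apply]
    have hee : ((Real.cos θ : ℂ) + Real.sin θ * Complex.I) = e θ := rfl
    simp only [hee]
    have hinv : (e θ)⁻¹ = Real.cos θ - Real.sin θ * Complex.I := by
      apply inv_eq_of_mul_eq_one_right
      rw [← hee]
      have h1 : (Real.cos θ : ℂ) ^ 2 + (Real.sin θ : ℂ) ^ 2 = 1 := by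
        have := Real.cos_sq_add_sin_sq θ
        exact_mod_cast congrArg (fun x : ℝ => (x : ℂ)) this
      linear_combination h1 - (Real.sin θ : ℂ) ^ 2 * Complex.I_sq
    rw [mul_inv, hinv, ← Complex.ofReal_inv, cmul_mul J hJ, cmul_ofReal, smul_smul,
      mul_inv_cancel₀ hr.ne', one_smul]
    simp only [hg1, hg2]
    have lin : ∀ L : ℂ →L[ℝ] W, ∀ c : ℂ, L c = c.re • L 1 + c.im • L Complex.I := by
      intro L c
      rw [← map_smul, ← map_smul, ← map_add]
      congr 1
      apply Complex.ext <;> simp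
    rw [lin _ (e θ), lin _ (Complex.I * e θ), cmul_apply]
    simp only [he, map_add, map_smul, hJ]
    simp
    module
  rw [step, ht, integral_add i1 i2]
  have I1 : ∫ p in Ioi (0:ℝ) ×ˢ Ioo (-Real.pi) Real.pi, g1 p = - (2 * Real.pi) • φ 0 := by
    rw [Measure.volume_eq_prod, ← setIntegral_prod_swap, setIntegral_prod _
      (by rw [Measure.volume_eq_prod] at i1; exact i1.swap)]
    have : ∀ θ ∈ Ioo (-Real.pi) Real.pi, ∫ r in Ioi (0:ℝ), g1 (Prod.swap (θ, r)) = - φ 0 := by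
      intro θ _
      have hd : ∀ r ∈ Ici (0:ℝ), HasDerivAt (fun r : ℝ => φ (r * e θ)) (g1 (r, θ)) r := by
        intro r _
        have h1 : HasDerivAt (fun r : ℝ => (r : ℂ) * e θ) (e θ) r := by
          simpa using (Complex.ofRealCLM.hasDerivAt (x := r)).mul_const (e θ)
        exact ((hφ.differentiable one_ne_zero _).hasFDerivAt).comp_hasDerivAt r h1
      have hint : IntegrableOn (fun r => g1 (r, θ)) (Ioi 0) := by
        have h1 : IntegrableOn (fun r => g1 (r, θ)) (Icc (0:ℝ) R) :=
          (by fun_prop : Continuous fun r => g1 (r, θ)).continuousOn.integrableOn_compact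
            isCompact_Icc
        refine h1.of_forall_sdiff_eq_zero measurableSet_Ioi ?_
        rintro r ⟨hr, hn⟩
        have : R < r := by
          by_contra hlt
          exact hn ⟨le_of_lt hr, not_lt.1 hlt⟩
        have hz := z12 (r, θ) this
        simp only at hz
        simp [hg1, hz]
      have hlim : Filter.Tendsto (fun r : ℝ => φ (r * e θ)) Filter.atTop (nhds 0) := by
        refine tendsto_const_nhds.congr' ?_
        filter_upwards [Filter.eventually_gt_atTop R] with r hr
        rw [(hR _ _).1]
        rw [norm_mul, ne, mul_one, Complex.norm_real]
        exact hr.trans_le (le_abs_self _)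
      have := integral_Ioi_of_hasDerivAt_of_tendsto' hd hint hlim
      simpa using this
    rw [setIntegral_congr_fun measurableSet_Ioo this]
    simp [Real.volume_Ioo]
    rw [max_eq_left (by positivity)]
    module
  have I2 : ∫ p in Ioi (0:ℝ) ×ˢ Ioo (-Real.pi) Real.pi, g2 p = 0 := by
    rw [Measure.volume_eq_prod, setIntegral_prod _ (by rwa [Measure.volume_eq_prod] at i2)]
    have : ∀ r ∈ Ioi (0:ℝ), ∫ θ in Ioo (-Real.pi) Real.pi, g2 (r, θ) = 0 := by
      intro r hr
      have hr : 0 < r := hr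
      have hd : ∀ θ ∈ uIcc (-Real.pi) Real.pi,
          HasDerivAt (fun θ : ℝ => r⁻¹ • J (φ (r * e θ))) (g2 (r, θ)) θ := by
        intro θ _
        have h0 : HasDerivAt e (Complex.I * e θ) θ := by
          have h1 := (Real.hasDerivAt_cos θ).ofReal_comp
          have h2 := ((Real.hasDerivAt_sin θ).ofReal_comp).mul_const Complex.I
          have h12 := h1.add h2
          refine h12.congr_deriv ?_
          have hee : e θ = (Real.cos θ : ℂ) + Real.sin θ * Complex.I := rfl
          rw [hee]; push_cast
          linear_combination -(Complex.sin θ) * Complex.I_sq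
        have h1 : HasDerivAt (fun θ : ℝ => (r : ℂ) * e θ) (r * (Complex.I * e θ)) θ :=
          h0.const_mul _
        have h2 := ((hφ.differentiable one_ne_zero _).hasFDerivAt).comp_hasDerivAt θ h1
        have h3 := (J.hasFDerivAt.comp_hasDerivAt θ h2).const_smul r⁻¹
        refine h3.congr_deriv ?_
        have hgg : g2 (r, θ) = J (fderiv ℝ φ (r * e θ) (Complex.I * e θ)) := rfl
        rw [hgg]
        have : (r : ℂ) * (Complex.I * e θ) = r • (Complex.I * e θ) := by simp
        rw [this, map_smul, map_smul, smul_smul, inv_mul_cancel₀ hr.ne', one_smul]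
      rw [← integral_Ioc_eq_integral_Ioo, ← intervalIntegral.integral_of_le (by linarith [Real.pi_pos]),
        intervalIntegral.integral_eq_sub_of_hasDerivAt hd
          ((by fun_prop : Continuous fun θ => g2 (r, θ)).intervalIntegrable _ _)]
      simp [he]
    rw [setIntegral_congr_fun measurableSet_Ioi this]
    simp
  rw [I1, I2, add_zero]

lemma cauchy_rep [CompleteSpace W] (J : W →L[ℝ] W) (hJ : ∀ a, J (J a) = -a)
    (φ : ℂ → W) (hφ : ContDiff ℝ 1 φ) (hc : HasCompactSupport φ) (z : ℂ) :
    φ z = (2 * Real.pi)⁻¹ •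
      ∫ ζ, cmul J ((z - ζ)⁻¹) (fderiv ℝ φ ζ 1 + J (fderiv ℝ φ ζ Complex.I)) := by
  have h := cauchy_rep_zero J hJ (fun η => φ (η + z)) (hφ.comp (contDiff_id.add contDiff_const))
    (hc.comp_homeomorph (Homeomorph.addRight z))
  simp only [fderiv_comp_add_right, zero_add] at h
  rw [← integral_add_right_eq_self _ z]
  have : ∀ ζ : ℂ, cmul J ((z - (ζ + z))⁻¹) (fderiv ℝ φ (ζ + z) 1 + J (fderiv ℝ φ (ζ + z) Complex.I))
      = - cmul J (ζ⁻¹) (fderiv ℝ φ (ζ + z) 1 + J (fderiv ℝ φ (ζ + z) Complex.I)) := by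
    intro ζ
    rw [← cmul_neg]; congr 2
    rw [← inv_neg]; congr 1; ring
  simp_rw [this]
  rw [integral_neg, h, neg_smul, neg_neg, smul_smul, inv_mul_cancel₀ (by positivity), one_smul]

end polar

end Part6

section Part7
open MeasureTheory Metric Set
open scoped ENNReal

/-- Truncated Cauchy kernel modulus. -/
noncomputable def kker (ρ : ℝ) : ℂ → ℝ≥0∞ := (ball (0:ℂ) ρ).indicator (fun w => ‖w⁻¹‖ₑ)

lemma kker_meas (ρ : ℝ) : Measurable (kker ρ) := by
  unfold kker
  exact Measurable.indicator (by fun_prop) measurableSet_ball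

lemma kker_lintegral (ρ : ℝ) (hρ : 0 < ρ) :
    ∫⁻ w, kker ρ w = ENNReal.ofReal (2 * Real.pi * ρ) := by
  rw [← Complex.lintegral_comp_polarCoord_symm]
  have : ∀ p ∈ polarCoord.target, ENNReal.ofReal p.1 • kker ρ (Complex.polarCoord.symm p)
      = (Iio ρ ×ˢ (univ : Set ℝ)).indicator (fun _ => (1:ℝ≥0∞)) p := by
    rintro ⟨r, θ⟩ ⟨hr, _⟩
    have hr : 0 < r := hr
    have hn : ‖Complex.polarCoord.symm (r, θ)‖ = r := by
      rw [Complex.norm_polarCoord_symm, abs_of_pos hr]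
    by_cases h : r < ρ
    · rw [indicator_of_mem (by simpa using h), kker, indicator_of_mem (by
        rw [mem_ball_zero_iff, hn]; exact h)]
      rw [← ofReal_norm, norm_inv, hn, smul_eq_mul, ← ENNReal.ofReal_mul hr.le,
        mul_inv_cancel₀ hr.ne', ENNReal.ofReal_one]
    · rw [indicator_of_notMem (by simpa using h), kker, indicator_of_notMem (by
        rw [mem_ball_zero_iff, hn]; exact h)]
      simp
  rw [setLIntegral_congr_fun polarCoord.open_target.measurableSet this,
    setLIntegral_indicator (measurableSet_Iio.prod MeasurableSet.univ)]
  have ht : polarCoord.target = Ioi (0:ℝ) ×ˢ Ioo (-Real.pi) Real.pi := rfl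
  rw [setLIntegral_const, one_mul, ht, prod_inter_prod, Measure.volume_eq_prod, Measure.prod_prod]
  have h1 : Iio ρ ∩ Ioi (0:ℝ) = Ioo 0 ρ := by rw [inter_comm]; rfl
  rw [h1, univ_inter, Real.volume_Ioo, Real.volume_Ioo, ← ENNReal.ofReal_mul (by linarith)]
  congr 1; ring

lemma lintegral_cs {α : Type*} [MeasurableSpace α] (μ : Measure α) (k F : α → ℝ≥0∞)
    (hk : Measurable k) (hF : Measurable F) :
    (∫⁻ x, k x * F x ∂μ) ^ 2 ≤ (∫⁻ x, k x ∂μ) * ∫⁻ x, k x * F x ^ 2 ∂μ := by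
  have hpq : (2:ℝ).HolderConjugate 2 := by
    rw [Real.holderConjugate_iff]; norm_num
  have h := ENNReal.lintegral_mul_le_Lp_mul_Lq μ hpq (f := fun x => k x ^ (1/2:ℝ))
    (g := fun x => k x ^ (1/2:ℝ) * F x) (by fun_prop) (by fun_prop)
  have e1 : ∀ x, ((fun x => k x ^ (1/2:ℝ)) * fun x => k x ^ (1/2:ℝ) * F x) x = k x * F x := by
    intro x
    simp only [Pi.mul_apply]
    rw [← mul_assoc, ← ENNReal.rpow_add_of_nonneg _ _ (by norm_num) (by norm_num)]
    norm_num
  have e2 : ∀ x, (k x ^ (1/2:ℝ)) ^ (2:ℝ) = k x := by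
    intro x; rw [← ENNReal.rpow_mul]; norm_num
  have e3 : ∀ x, (k x ^ (1/2:ℝ) * F x) ^ (2:ℝ) = k x * F x ^ 2 := by
    intro x
    rw [ENNReal.mul_rpow_of_nonneg _ _ (by norm_num), e2]
    congr 1
    exact_mod_cast ENNReal.rpow_natCast (F x) 2
  simp only [e1, e2, e3] at h
  calc _ ≤ ((∫⁻ x, k x ∂μ) ^ (1/2:ℝ) * (∫⁻ x, k x * F x ^ 2 ∂μ) ^ (1/2:ℝ)) ^ 2 := by gcongr
    _ = _ := by
      rw [mul_pow]
      have : ∀ y : ℝ≥0∞, (y ^ (1/2:ℝ)) ^ 2 = y := by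
        intro y
        rw [← ENNReal.rpow_natCast, ← ENNReal.rpow_mul]; norm_num
      rw [this, this]

section T
variable {W : Type*} [NormedAddCommGroup W] [NormedSpace ℝ W]

noncomputable def TT (J : W →L[ℝ] W) (f : ℂ → W) (z : ℂ) : W :=
  (2 * Real.pi)⁻¹ • ∫ ζ, cmul J ((z - ζ)⁻¹) (f ζ)

lemma cmul_stronglyMeasurable {α : Type*} [MeasurableSpace α] (J : W →L[ℝ] W) (g : α → ℂ)
    (f : α → W) (hg : Measurable g) (hf : StronglyMeasurable f) :
    StronglyMeasurable (fun x => cmul J (g x) (f x)) := by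
  simp only [cmul_apply]
  have h1 : Measurable fun x => (g x).re := Complex.measurable_re.comp hg
  have h2 : Measurable fun x => (g x).im := Complex.measurable_im.comp hg
  exact (h1.stronglyMeasurable.smul hf).add
    (h2.stronglyMeasurable.smul (J.continuous.comp_stronglyMeasurable hf))

lemma TT_kernel_enorm (J : W →L[ℝ] W) (f : ℂ → W) (a : ℂ) (r : ℝ)
    (hs : ∀ ζ, ζ ∉ ball a r → f ζ = 0) (z : ℂ) (hz : z ∈ ball a r) (ζ : ℂ) :
    ‖cmul J ((z - ζ)⁻¹) (f ζ)‖ₑ ≤ ENNReal.ofReal (1 + ‖J‖) * (kker (2 * r) (z - ζ) * ‖f ζ‖ₑ) := by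
  by_cases h : ζ ∈ ball a r
  · have hk : kker (2 * r) (z - ζ) = ‖(z - ζ)⁻¹‖ₑ := by
      rw [kker, indicator_of_mem]
      rw [mem_ball_zero_iff, ← dist_eq_norm]
      rw [mem_ball] at hz h
      have := dist_triangle_right z ζ a
      linarith
    rw [hk, ← ofReal_norm, ← ofReal_norm, ← ofReal_norm,
      ← ENNReal.ofReal_mul (norm_nonneg _), ← ENNReal.ofReal_mul (by positivity)]
    apply ENNReal.ofReal_le_ofReal
    rw [← mul_assoc]; exact cmul_norm_le J _ _
  · rw [hs ζ h]; simp

lemma TT_integrable (J : W →L[ℝ] W) (f : ℂ → W) (a : ℂ) (r : ℝ) (hr : 0 < r) (hf : Continuous f)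
    (hs : ∀ ζ, ζ ∉ ball a r → f ζ = 0) (z : ℂ) (hz : z ∈ ball a r) :
    Integrable (fun ζ => cmul J ((z - ζ)⁻¹) (f ζ)) := by
  have hc : HasCompactSupport f := HasCompactSupport.intro (isCompact_closedBall a r)
    (fun x hx => hs x fun h => hx (ball_subset_closedBall h))
  obtain ⟨B, hB⟩ := hf.bounded_above_of_compact_support hc
  refine ⟨(cmul_stronglyMeasurable J _ f (by fun_prop) hf.stronglyMeasurable).aestronglyMeasurable, ?_⟩
  rw [hasFiniteIntegral_iff_enorm]
  calc ∫⁻ ζ, ‖cmul J ((z - ζ)⁻¹) (f ζ)‖ₑ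
      ≤ ∫⁻ ζ, (ENNReal.ofReal (1 + ‖J‖) * ENNReal.ofReal B) * kker (2 * r) (z - ζ) := by
        apply lintegral_mono
        intro ζ
        refine (TT_kernel_enorm J f a r hs z hz ζ).trans ?_
        beta_reduce
        rw [mul_assoc]
        refine mul_le_mul_right ?_ _
        rw [mul_comm]
        refine mul_le_mul_left ?_ _
        rw [← ofReal_norm]
        exact ENNReal.ofReal_le_ofReal (hB ζ)
    _ = (ENNReal.ofReal (1 + ‖J‖) * ENNReal.ofReal B) * ENNReal.ofReal (2 * Real.pi * (2 * r)) := by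
        rw [lintegral_const_mul' _ _ (by finiteness),
          lintegral_sub_left_eq_self (fun w => kker (2 * r) w) z, kker_lintegral _ (by positivity)]
    _ < ⊤ := by
        exact ENNReal.mul_lt_top (ENNReal.mul_lt_top ENNReal.ofReal_lt_top ENNReal.ofReal_lt_top)
          ENNReal.ofReal_lt_top

lemma TT_add (J : W →L[ℝ] W) (f g : ℂ → W) (a : ℂ) (r : ℝ) (hr : 0 < r) (hf : Continuous f)
    (hs : ∀ ζ, ζ ∉ ball a r → f ζ = 0) (hg : Continuous g)
    (hsg : ∀ ζ, ζ ∉ ball a r → g ζ = 0) (z : ℂ) (hz : z ∈ ball a r) :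
    TT J (fun ζ => f ζ + g ζ) z = TT J f z + TT J g z := by
  unfold TT
  simp only [map_add]
  rw [integral_add (TT_integrable J f a r hr hf hs z hz) (TT_integrable J g a r hr hg hsg z hz),
    smul_add]

lemma TT_L2 (J : W →L[ℝ] W) (f : ℂ → W) (a : ℂ) (r : ℝ) (hr : 0 < r) (hf : Continuous f)
    (hs : ∀ ζ, ζ ∉ ball a r → f ζ = 0) :
    IntegrableOn (fun z => ‖TT J f z‖ ^ 2) (ball a r) ∧
    ∫ z in ball a r, ‖TT J f z‖ ^ 2 ≤ 4 * (1 + ‖J‖) ^ 2 * r ^ 2 * ∫ z, ‖f z‖ ^ 2 := by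
  have hc : HasCompactSupport f := HasCompactSupport.intro (isCompact_closedBall a r)
    (fun x hx => hs x fun h => hx (ball_subset_closedBall h))
  have hsm : StronglyMeasurable (TT J f) := by
    unfold TT
    refine StronglyMeasurable.const_smul ?_ _
    apply StronglyMeasurable.integral_prod_right (f := fun z ζ : ℂ => cmul J ((z - ζ)⁻¹) (f ζ))
    exact cmul_stronglyMeasurable J (fun p : ℂ × ℂ => (p.1 - p.2)⁻¹) (fun p => f p.2) (by fun_prop)
      (hf.stronglyMeasurable.comp_measurable measurable_snd)
  have hkm : Measurable (kker (2 * r)) := kker_meas _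
  have hFm : Measurable (fun ζ => ‖f ζ‖ₑ) := hf.enorm.measurable
  set K := ENNReal.ofReal (2 * Real.pi * (2 * r)) with hK
  have hpt : ∀ z ∈ ball a r, ‖TT J f z‖ₑ ^ 2 ≤
      (ENNReal.ofReal ((2 * Real.pi)⁻¹ * (1 + ‖J‖))) ^ 2 *
        (K * ∫⁻ ζ, kker (2 * r) (z - ζ) * ‖f ζ‖ₑ ^ 2) := by
    intro z hz
    have h1 : ‖TT J f z‖ₑ ≤ ENNReal.ofReal ((2 * Real.pi)⁻¹ * (1 + ‖J‖)) *
        ∫⁻ ζ, kker (2 * r) (z - ζ) * ‖f ζ‖ₑ := by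
      unfold TT
      rw [enorm_smul, ENNReal.ofReal_mul (by positivity), mul_assoc]
      have : ‖(2 * Real.pi)⁻¹‖ₑ = ENNReal.ofReal ((2 * Real.pi)⁻¹) :=
        Real.enorm_of_nonneg (by positivity)
      rw [this]
      gcongr
      refine (enorm_integral_le_lintegral_enorm _).trans ?_
      rw [← lintegral_const_mul _ (by fun_prop)]
      exact lintegral_mono fun ζ => TT_kernel_enorm J f a r hs z hz ζ
    calc ‖TT J f z‖ₑ ^ 2 ≤ (ENNReal.ofReal ((2 * Real.pi)⁻¹ * (1 + ‖J‖)) *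
        ∫⁻ ζ, kker (2 * r) (z - ζ) * ‖f ζ‖ₑ) ^ 2 := by gcongr
      _ = (ENNReal.ofReal ((2 * Real.pi)⁻¹ * (1 + ‖J‖))) ^ 2 *
        (∫⁻ ζ, kker (2 * r) (z - ζ) * ‖f ζ‖ₑ) ^ 2 := by rw [mul_pow]
      _ ≤ _ := by
        gcongr
        refine (lintegral_cs volume (fun ζ => kker (2 * r) (z - ζ)) (fun ζ => ‖f ζ‖ₑ)
          (by fun_prop) hFm).trans ?_
        rw [lintegral_sub_left_eq_self (fun w => kker (2 * r) w) z, kker_lintegral _ (by positivity)]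
  have hnI := integrable_normsq hf hc
  have hn : ∫⁻ ζ, ‖f ζ‖ₑ ^ 2 = ENNReal.ofReal (∫ z, ‖f z‖ ^ 2) := by
    rw [ofReal_integral_eq_lintegral_ofReal hnI (Filter.Eventually.of_forall fun z => by positivity)]
    apply lintegral_congr; intro z
    rw [ENNReal.ofReal_pow (norm_nonneg _), ofReal_norm]
  have htot : ∫⁻ z in ball a r, ‖TT J f z‖ₑ ^ 2 ≤
      ENNReal.ofReal (4 * (1 + ‖J‖) ^ 2 * r ^ 2 * ∫ z, ‖f z‖ ^ 2) := by
    calc ∫⁻ z in ball a r, ‖TT J f z‖ₑ ^ 2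
        ≤ ∫⁻ z in ball a r, (ENNReal.ofReal ((2 * Real.pi)⁻¹ * (1 + ‖J‖))) ^ 2 *
        (K * ∫⁻ ζ, kker (2 * r) (z - ζ) * ‖f ζ‖ₑ ^ 2) :=
          setLIntegral_mono' measurableSet_ball hpt
      _ ≤ ∫⁻ z, (ENNReal.ofReal ((2 * Real.pi)⁻¹ * (1 + ‖J‖))) ^ 2 *
        (K * ∫⁻ ζ, kker (2 * r) (z - ζ) * ‖f ζ‖ₑ ^ 2) := setLIntegral_le_lintegral _ _
      _ = (ENNReal.ofReal ((2 * Real.pi)⁻¹ * (1 + ‖J‖))) ^ 2 * (K * ∫⁻ z,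
         ∫⁻ ζ, kker (2 * r) (z - ζ) * ‖f ζ‖ₑ ^ 2) := by
          rw [lintegral_const_mul' _ _ (by finiteness), lintegral_const_mul' _ _ (by finiteness)]
      _ = (ENNReal.ofReal ((2 * Real.pi)⁻¹ * (1 + ‖J‖))) ^ 2 * (K *
         (K * ∫⁻ ζ, ‖f ζ‖ₑ ^ 2)) := by
          rw [lintegral_lintegral_swap (by fun_prop)]
          congr 2
          rw [← lintegral_const_mul' _ _ (by finiteness)]
          apply lintegral_congr; intro ζ
          rw [lintegral_mul_const _ (by fun_prop),
            lintegral_sub_right_eq_self (fun w => kker (2 * r) w) ζ, kker_lintegral _ (by positivity)]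
      _ = _ := by
          rw [hn, hK, ← ENNReal.ofReal_pow (by positivity), ← ENNReal.ofReal_mul (by positivity),
            ← ENNReal.ofReal_mul (by positivity), ← ENNReal.ofReal_mul (by positivity)]
          congr 1
          field_simp
          ring
  have hm : AEStronglyMeasurable (fun z => ‖TT J f z‖ ^ 2) (volume.restrict (ball a r)) :=
    (hsm.norm.pow 2).aestronglyMeasurable
  have he : ∀ z, ‖‖TT J f z‖ ^ 2‖ₑ = ‖TT J f z‖ₑ ^ 2 := by
    intro z; simp
  refine ⟨⟨hm, ?_⟩, ?_⟩
  · rw [hasFiniteIntegral_iff_enorm]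
    simp_rw [he]
    exact htot.trans_lt ENNReal.ofReal_lt_top
  · rw [integral_eq_lintegral_of_nonneg_ae (Filter.Eventually.of_forall fun z => by positivity) hm]
    apply ENNReal.toReal_le_of_le_ofReal
    · have : 0 ≤ ∫ z, ‖f z‖ ^ 2 := integral_nonneg fun z => by positivity
      positivity
    · refine le_trans (le_of_eq ?_) htot
      apply lintegral_congr; intro z
      rw [ENNReal.ofReal_pow (norm_nonneg _), ofReal_norm]

end T

end Part7

section Part8
open MeasureTheory Metric Set
open scoped ENNReal

lemma vol_ball (a : ℂ) (r : ℝ) (hr : 0 ≤ r) : volume.real (ball a r) = Real.pi * r ^ 2 := by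
  rw [measureReal_def, Complex.volume_ball]
  rw [ENNReal.toReal_mul, ENNReal.toReal_pow, ENNReal.toReal_ofReal hr]
  simp [mul_comm]

lemma ball_cs (a : ℂ) (r : ℝ) (hr : 0 < r) (g : ℂ → ℝ) (hg : IntegrableOn g (ball a r))
    (hg2 : IntegrableOn (fun z => g z ^ 2) (ball a r)) :
    (∫ z in ball a r, g z) ^ 2 ≤ Real.pi * r ^ 2 * ∫ z in ball a r, g z ^ 2 := by
  set I := ∫ z in ball a r, g z
  set N := ∫ z in ball a r, g z ^ 2
  have hV : 0 < Real.pi * r ^ 2 := by positivity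
  set V := Real.pi * r ^ 2
  set m := I / V with hm
  have hfin : IsFiniteMeasure (volume.restrict (ball a r)) :=
    ⟨by rw [Measure.restrict_apply_univ]; exact measure_ball_lt_top⟩
  have h0 : 0 ≤ ∫ z in ball a r, (g z - m) ^ 2 := integral_nonneg fun z => sq_nonneg _
  have h1 : ∫ z in ball a r, (g z - m) ^ 2 = N - 2 * m * I + m ^ 2 * V := by
    have : ∀ z, (g z - m) ^ 2 = g z ^ 2 - 2 * m * g z + m ^ 2 := fun z => by ring
    simp_rw [this]
    have i1 : Integrable (fun z => g z ^ 2 - 2 * m * g z) (volume.restrict (ball a r)) :=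
      hg2.sub (hg.const_mul _)
    rw [integral_add i1 (integrable_const _),
      integral_sub hg2 (hg.const_mul _), integral_const_mul, integral_const, smul_eq_mul,
      measureReal_restrict_apply_univ, vol_ball a r hr.le]
    ring
  rw [h1] at h0
  have h2 : m * V = I := by rw [hm]; field_simp
  have : 0 ≤ V * (N - 2 * m * I + m ^ 2 * V) := by positivity
  have e : V * (N - 2 * m * I + m ^ 2 * V) = V * N - I ^ 2 := by
    rw [← h2]; ring
  linarith

section T
variable {W : Type*} [NormedAddCommGroup W] [NormedSpace ℝ W]

lemma far_int (J : W →L[ℝ] W) (f : ℂ → W) (a : ℂ) (r : ℝ) (hr : 0 < r) (hf : Continuous f)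
    (hs : ∀ ζ, ζ ∉ ball a r → f ζ = 0) (k : ℂ → ℂ) (hk : Measurable k) (c : ℝ) (hc0 : 0 ≤ c)
    (hkc : ∀ ζ, f ζ ≠ 0 → ‖k ζ‖ ≤ c) :
    Integrable (fun ζ => cmul J (k ζ) (f ζ)) ∧
    ‖∫ ζ, cmul J (k ζ) (f ζ)‖ ^ 2 ≤ ((1 + ‖J‖) * c) ^ 2 * (Real.pi * r ^ 2 * ∫ z, ‖f z‖ ^ 2) := by
  have hc : HasCompactSupport f := HasCompactSupport.intro (isCompact_closedBall a r)
    (fun x hx => hs x fun h => hx (ball_subset_closedBall h))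
  have hfI : Integrable f := hf.integrable_of_hasCompactSupport hc
  have hf2 := integrable_normsq hf hc
  have hpt : ∀ ζ, ‖cmul J (k ζ) (f ζ)‖ ≤ (1 + ‖J‖) * c * ‖f ζ‖ := by
    intro ζ
    by_cases h : f ζ = 0
    · simp [h]
    · refine (cmul_norm_le J _ _).trans ?_
      have := hkc ζ h
      gcongr
  refine ⟨(hfI.norm.const_mul ((1 + ‖J‖) * c)).mono'
    (cmul_stronglyMeasurable J k f hk hf.stronglyMeasurable).aestronglyMeasurable
    (Filter.Eventually.of_forall hpt), ?_⟩
  have h1 : ‖∫ ζ, cmul J (k ζ) (f ζ)‖ ≤ (1 + ‖J‖) * c * ∫ ζ, ‖f ζ‖ := by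
    rw [← integral_const_mul]
    exact norm_integral_le_of_norm_le (hfI.norm.const_mul _) (Filter.Eventually.of_forall hpt)
  have e1 : ∫ ζ, ‖f ζ‖ = ∫ ζ in ball a r, ‖f ζ‖ :=
    (setIntegral_eq_integral_of_forall_compl_eq_zero fun x hx => by simp [hs x hx]).symm
  have e2 : ∫ ζ, ‖f ζ‖ ^ 2 = ∫ ζ in ball a r, ‖f ζ‖ ^ 2 :=
    (setIntegral_eq_integral_of_forall_compl_eq_zero fun x hx => by simp [hs x hx]).symm
  have h2 := ball_cs a r hr (fun z => ‖f z‖) hfI.norm.integrableOn hf2.integrableOn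
  rw [← e1, ← e2] at h2
  calc _ ≤ ((1 + ‖J‖) * c * ∫ ζ, ‖f ζ‖) ^ 2 := by gcongr
    _ = ((1 + ‖J‖) * c) ^ 2 * (∫ ζ, ‖f ζ‖) ^ 2 := by ring
    _ ≤ _ := by gcongr

lemma TT_far [CompleteSpace W] (J : W →L[ℝ] W) (hJ : ∀ a, J (J a) = -a) (f : ℂ → W) (a : ℂ) (r : ℝ)
    (hr : 0 < r) (hf : Continuous f)
    (hs : ∀ ζ, ζ ∉ ball a r → f ζ = 0) (hs2 : ∀ ζ, ζ ∈ ball a (r / 2) → f ζ = 0) :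
    ∃ B : W, ∀ z ∈ ball a (r / 4),
      ‖TT J f z - TT J f a‖ ^ 2 ≤ 64 * (1 + ‖J‖) ^ 2 * ‖z - a‖ ^ 2 * (r ^ 2)⁻¹ * ∫ z, ‖f z‖ ^ 2 ∧
      ‖TT J f z - (TT J f a + cmul J (z - a) B)‖ ^ 2 ≤
        64 * (1 + ‖J‖) ^ 2 * ‖z - a‖ ^ 4 * (r ^ 4)⁻¹ * ∫ z, ‖f z‖ ^ 2 := by
  have hlow : ∀ ζ, f ζ ≠ 0 → r / 2 ≤ ‖a - ζ‖ := by
    intro ζ h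
    by_contra h'
    apply h; apply hs2
    rw [mem_ball', dist_eq_norm]; linarith
  have N0 : 0 ≤ ∫ z, ‖f z‖ ^ 2 := integral_nonneg fun z => by positivity
  set N := ∫ z, ‖f z‖ ^ 2
  have hB : Integrable (fun ζ => cmul J ((a - ζ)⁻¹ ^ 2) (f ζ)) := by
    refine (far_int J f a r hr hf hs _ (by fun_prop) ((r / 2)⁻¹ ^ 2) (by positivity) ?_).1
    intro ζ h
    rw [norm_pow, norm_inv]
    have := hlow ζ h
    gcongr
  refine ⟨-((2 * Real.pi)⁻¹ • ∫ ζ, cmul J ((a - ζ)⁻¹ ^ 2) (f ζ)), fun z hz => ?_⟩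
  have hza : ‖z - a‖ < r / 4 := by rwa [mem_ball, dist_eq_norm] at hz
  have hlow2 : ∀ ζ, f ζ ≠ 0 → r / 4 ≤ ‖z - ζ‖ := by
    intro ζ h
    have h1 := hlow ζ h
    have h2 : ‖a - ζ‖ ≤ ‖z - ζ‖ + ‖z - a‖ := by
      have : a - ζ = (z - ζ) - (z - a) := by ring
      rw [this]; exact norm_sub_le _ _
    linarith
  have hz1 : z ∈ ball a r := ball_subset_ball (by linarith) hz
  have ha1 : a ∈ ball a r := mem_ball_self hr
  have iz := TT_integrable J f a r hr hf hs z hz1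
  have ia := TT_integrable J f a r hr hf hs a ha1
  have hpi := Real.pi_gt_three
  constructor
  · have e : TT J f z - TT J f a =
        (2 * Real.pi)⁻¹ • ∫ ζ, cmul J ((z - ζ)⁻¹ - (a - ζ)⁻¹) (f ζ) := by
      unfold TT
      rw [← smul_sub, ← integral_sub iz ia]
      simp only [cmul_sub, ContinuousLinearMap.sub_apply]
    have hb := (far_int J f a r hr hf hs (fun ζ => (z - ζ)⁻¹ - (a - ζ)⁻¹) (by fun_prop)
      (8 * ‖z - a‖ / r ^ 2) (by positivity) ?_).2
    · rw [e, norm_smul, mul_pow, Real.norm_of_nonneg (by positivity)]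
      calc _ ≤ ((2 * Real.pi)⁻¹) ^ 2 *
            (((1 + ‖J‖) * (8 * ‖z - a‖ / r ^ 2)) ^ 2 * (Real.pi * r ^ 2 * N)) := by gcongr
        _ = (16 / Real.pi) * ((1 + ‖J‖) ^ 2 * ‖z - a‖ ^ 2 * (r ^ 2)⁻¹ * N) := by
          field_simp; ring
        _ ≤ 64 * ((1 + ‖J‖) ^ 2 * ‖z - a‖ ^ 2 * (r ^ 2)⁻¹ * N) := by
          gcongr
          rw [div_le_iff₀ (by positivity)]; linarith
        _ = _ := by ring
    · intro ζ h
      have h1 := hlow ζ h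
      have h2 := hlow2 ζ h
      have n1 : a - ζ ≠ 0 := by rw [← norm_pos_iff]; linarith
      have n2 : z - ζ ≠ 0 := by rw [← norm_pos_iff]; linarith
      have : (z - ζ)⁻¹ - (a - ζ)⁻¹ = -(z - a) * ((z - ζ)⁻¹ * (a - ζ)⁻¹) := by
        field_simp; ring
      rw [this, norm_mul, norm_mul, norm_neg, norm_inv, norm_inv]
      calc _ ≤ ‖z - a‖ * ((r / 4)⁻¹ * (r / 2)⁻¹) := by gcongr
        _ = _ := by field_simp; ring
  · have e : TT J f z - (TT J f a + cmul J (z - a)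
          (-((2 * Real.pi)⁻¹ • ∫ ζ, cmul J ((a - ζ)⁻¹ ^ 2) (f ζ)))) =
        (2 * Real.pi)⁻¹ • ∫ ζ, cmul J ((z - ζ)⁻¹ - (a - ζ)⁻¹ + (z - a) * (a - ζ)⁻¹ ^ 2) (f ζ) := by
      unfold TT
      have : ∀ ζ, cmul J ((z - ζ)⁻¹ - (a - ζ)⁻¹ + (z - a) * (a - ζ)⁻¹ ^ 2) (f ζ) =
        cmul J ((z - ζ)⁻¹) (f ζ) - cmul J ((a - ζ)⁻¹) (f ζ) +
          cmul J (z - a) (cmul J ((a - ζ)⁻¹ ^ 2) (f ζ)) := by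
        intro ζ
        rw [cmul_add, cmul_sub, cmul_mul J hJ]
        try rfl
      simp_rw [this]
      have i1 : Integrable (fun ζ => cmul J ((z - ζ)⁻¹) (f ζ) - cmul J ((a - ζ)⁻¹) (f ζ)) :=
        iz.sub ia
      rw [integral_add i1 ((cmul J (z - a)).integrable_comp hB), integral_sub iz ia,
        ContinuousLinearMap.integral_comp_comm _ hB, map_neg, map_smul]
      simp only [smul_add, smul_sub]
      abel
    have hb := (far_int J f a r hr hf hs (fun ζ => (z - ζ)⁻¹ - (a - ζ)⁻¹ + (z - a) * (a - ζ)⁻¹ ^ 2)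
      (by fun_prop) (16 * ‖z - a‖ ^ 2 / r ^ 3) (by positivity) ?_).2
    · rw [e, norm_smul, mul_pow, Real.norm_of_nonneg (by positivity)]
      calc _ ≤ ((2 * Real.pi)⁻¹) ^ 2 *
            (((1 + ‖J‖) * (16 * ‖z - a‖ ^ 2 / r ^ 3)) ^ 2 * (Real.pi * r ^ 2 * N)) := by gcongr
        _ = (64 / Real.pi) * ((1 + ‖J‖) ^ 2 * ‖z - a‖ ^ 4 * (r ^ 4)⁻¹ * N) := by
          field_simp; ring
        _ ≤ 64 * ((1 + ‖J‖) ^ 2 * ‖z - a‖ ^ 4 * (r ^ 4)⁻¹ * N) := by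
          gcongr
          rw [div_le_iff₀ (by positivity)]; linarith
        _ = _ := by ring
    · intro ζ h
      have h1 := hlow ζ h
      have h2 := hlow2 ζ h
      have n1 : a - ζ ≠ 0 := by rw [← norm_pos_iff]; linarith
      have n2 : z - ζ ≠ 0 := by rw [← norm_pos_iff]; linarith
      have : (z - ζ)⁻¹ - (a - ζ)⁻¹ + (z - a) * (a - ζ)⁻¹ ^ 2
          = (z - a) ^ 2 * ((z - ζ)⁻¹ * (a - ζ)⁻¹ ^ 2) := by
        field_simp; ring
      rw [this, norm_mul, norm_mul, norm_pow, norm_inv, norm_pow, norm_inv]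
      calc _ ≤ ‖z - a‖ ^ 2 * ((r / 4)⁻¹ * (r / 2)⁻¹ ^ 2) := by gcongr
        _ = _ := by field_simp; ring

end T

end Part8

section Part9
open MeasureTheory Metric Set
open scoped ENNReal ContDiff

section C
variable {W : Type*} [NormedAddCommGroup W] [NormedSpace ℝ W]

lemma smul_cont_of_tsupport (G : Set ℂ) (hG : IsOpen G) (η : ℂ → ℝ) (hη : Continuous η)
    (hs : tsupport η ⊆ G) (g : ℂ → W) (hg : ContinuousOn g G) : Continuous fun z => η z • g z := by
  apply continuous_of_tsupport
  intro x hx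
  have hx' : x ∈ tsupport η := closure_mono (Function.support_smul_subset_left η g) hx
  exact hη.continuousAt.smul (hg.continuousAt (hG.mem_nhds (hs hx')))

lemma cut_contDiff (G : Set ℂ) (hG : IsOpen G) (η : ℂ → ℝ) (hη : ContDiff ℝ 1 η)
    (hs : tsupport η ⊆ G) (g : ℂ → W) (hg : ContDiffOn ℝ 1 g G) :
    ContDiff ℝ 1 (fun z => η z • g z) := by
  rw [contDiff_iff_contDiffAt]
  intro z
  by_cases hz : z ∈ tsupport η
  · exact hη.contDiffAt.smul (hg.contDiffAt (hG.mem_nhds (hs hz)))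
  · have : (fun z => η z • g z) =ᶠ[nhds z] fun _ => 0 := by
      filter_upwards [notMem_tsupport_iff_eventuallyEq.1 hz] with y hy
      simp [hy]
    exact contDiffAt_const.congr_of_eventuallyEq this

lemma cut_fderiv (G : Set ℂ) (hG : IsOpen G) (η : ℂ → ℝ) (hη : ContDiff ℝ 1 η)
    (hs : tsupport η ⊆ G) (g : ℂ → W) (hg : ContDiffOn ℝ 1 g G) (z w : ℂ) :
    fderiv ℝ (fun z => η z • g z) z w = η z • fderiv ℝ g z w + fderiv ℝ η z w • g z := by
  by_cases hz : z ∈ tsupport η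
  · have hd : DifferentiableAt ℝ g z :=
      (hg.contDiffAt (hG.mem_nhds (hs hz))).differentiableAt (by simp)
    have := ((hη.differentiable (by simp) z).hasFDerivAt.smul hd.hasFDerivAt).fderiv
    change fderiv ℝ (fun z => η z • g z) z = _ at this
    rw [this]
    simp
  · have h0 := notMem_tsupport_iff_eventuallyEq.1 hz
    have : (fun z => η z • g z) =ᶠ[nhds z] fun _ => 0 := by
      filter_upwards [h0] with y hy
      simp [hy]
    rw [this.fderiv_eq, h0.fderiv_eq, h0.eq_of_nhds]
    simp

lemma dbar_bound (J : W →L[ℝ] W) (L : ℂ →L[ℝ] ℝ) (v : W) :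
    ‖L 1 • v + J (L Complex.I • v)‖ ^ 2 ≤ (1 + ‖J‖) ^ 2 * (‖L‖ ^ 2 * ‖v‖ ^ 2) := by
  have h1 : |L 1| ≤ ‖L‖ := by simpa using L.le_opNorm 1
  have h2 : |L Complex.I| ≤ ‖L‖ := by simpa using L.le_opNorm Complex.I
  have : ‖L 1 • v + J (L Complex.I • v)‖ ≤ (1 + ‖J‖) * (‖L‖ * ‖v‖) := by
    calc _ ≤ ‖L 1 • v‖ + ‖J (L Complex.I • v)‖ := norm_add_le _ _
      _ ≤ |L 1| * ‖v‖ + ‖J‖ * (|L Complex.I| * ‖v‖) := by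
        gcongr
        · rw [norm_smul, Real.norm_eq_abs]
        · refine (J.le_opNorm _).trans ?_
          rw [norm_smul, Real.norm_eq_abs]
      _ ≤ ‖L‖ * ‖v‖ + ‖J‖ * (‖L‖ * ‖v‖) := by gcongr
      _ = _ := by ring
  calc _ ≤ ((1 + ‖J‖) * (‖L‖ * ‖v‖)) ^ 2 := by gcongr
    _ = _ := by ring

lemma norm_add_sq_le (a b : W) : ‖a + b‖ ^ 2 ≤ 2 * ‖a‖ ^ 2 + 2 * ‖b‖ ^ 2 := by
  have := norm_add_le a b
  nlinarith [norm_nonneg (a + b), sq_nonneg (‖a‖ - ‖b‖), norm_nonneg a, norm_nonneg b]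

end C

/-- Caccioppoli inequality. -/
lemma caccioppoli (m : ℕ) (J0 : (Fin m → ℝ) →L[ℝ] (Fin m → ℝ))
    (C : ℝ) (hC : 0 < C) (hen : ∀ φ : ℂ → Fin m → ℝ, ContDiff ℝ 1 φ → HasCompactSupport φ →
      ∫ z, ‖fderiv ℝ φ z Complex.I‖ ^ 2 ≤
        C * ∫ z, ‖fderiv ℝ φ z 1 + J0 (fderiv ℝ φ z Complex.I)‖ ^ 2)
    (δ : ℝ) (hδ : 8 * C * δ ^ 2 ≤ 1) (hδ0 : 0 ≤ δ) (G : Set ℂ) (hG : IsOpen G)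
    (u : ℂ → Fin m → ℝ) (hu : ContDiffOn ℝ 1 u G)
    (JJ : ℂ → (Fin m → ℝ) →L[ℝ] (Fin m → ℝ)) (hJJ : ∀ z ∈ G, ‖J0 - JJ z‖ ≤ δ)
    (heq : ∀ z ∈ G, fderiv ℝ u z 1 + JJ z (fderiv ℝ u z Complex.I) = 0)
    (η : ℂ → ℝ) (hη : ContDiff ℝ 1 η) (hηc : HasCompactSupport η) (hs : tsupport η ⊆ G)
    (c : Fin m → ℝ) :
    ∫ z, ‖η z • fderiv ℝ u z Complex.I‖ ^ 2 ≤
      (4 + 8 * C * (1 + ‖J0‖) ^ 2) * ∫ z, ‖fderiv ℝ η z‖ ^ 2 * ‖u z - c‖ ^ 2 := by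
  have huc : ContDiffOn ℝ 1 (fun z => u z - c) G := hu.sub contDiffOn_const
  have hfd : ∀ z w, fderiv ℝ (fun z => u z - c) z w = fderiv ℝ u z w := by
    intro z w; rw [fderiv_sub_const]
  have hΦ := cut_contDiff G hG η hη hs _ huc
  have hΦ' : ∀ z w, fderiv ℝ (fun z => η z • (u z - c)) z w =
      η z • fderiv ℝ u z w + fderiv ℝ η z w • (u z - c) := by
    intro z w; rw [cut_fderiv G hG η hη hs _ huc, hfd]
  have hΦc : HasCompactSupport fun z => η z • (u z - c) := hηc.smul_right
  have h1 := hen _ hΦ hΦc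
  have cη' := hη.continuous_fderiv one_ne_zero
  have tη' : tsupport (fderiv ℝ η) ⊆ tsupport η := tsupport_fderiv_subset ℝ
  have cuy : ContinuousOn (fun z => fderiv ℝ u z Complex.I) G :=
    (hu.continuousOn_fderiv_of_isOpen hG le_rfl).clm_apply continuousOn_const
  have cX : Continuous fun z => η z • fderiv ℝ u z Complex.I :=
    smul_cont_of_tsupport G hG η hη.continuous hs _ cuy
  have sX : HasCompactSupport fun z => η z • fderiv ℝ u z Complex.I := hηc.smul_right
  have iX := integrable_normsq cX sX
  set X := ∫ z, ‖η z • fderiv ℝ u z Complex.I‖ ^ 2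
  have cY : Continuous fun z => ‖fderiv ℝ η z‖ • (u z - c) := by
    apply smul_cont_of_tsupport G hG _ cη'.norm _ _ huc.continuousOn
    refine Subset.trans ?_ (tη'.trans hs)
    apply closure_mono
    intro z hz hz2
    exact hz (by simp [hz2])
  have sY : HasCompactSupport fun z => ‖fderiv ℝ η z‖ • (u z - c) := by
    have : HasCompactSupport fun z => ‖fderiv ℝ η z‖ := (hηc.fderiv ℝ).norm
    exact this.smul_right
  have iY := integrable_normsq cY sY
  have eY : ∀ z, ‖‖fderiv ℝ η z‖ • (u z - c)‖ ^ 2 = ‖fderiv ℝ η z‖ ^ 2 * ‖u z - c‖ ^ 2 := by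
    intro z; rw [norm_smul, norm_norm, mul_pow]
  simp only [eY] at iY
  set Y := ∫ z, ‖fderiv ℝ η z‖ ^ 2 * ‖u z - c‖ ^ 2
  -- right side
  have p1 : ∀ z, ‖fderiv ℝ (fun z => η z • (u z - c)) z 1 +
      J0 (fderiv ℝ (fun z => η z • (u z - c)) z Complex.I)‖ ^ 2 ≤
      2 * ((1 + ‖J0‖) ^ 2 * (‖fderiv ℝ η z‖ ^ 2 * ‖u z - c‖ ^ 2)) +
      2 * (δ ^ 2 * ‖η z • fderiv ℝ u z Complex.I‖ ^ 2) := by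
    intro z
    have e : fderiv ℝ (fun z => η z • (u z - c)) z 1 +
      J0 (fderiv ℝ (fun z => η z • (u z - c)) z Complex.I) =
      (fderiv ℝ η z 1 • (u z - c) + J0 (fderiv ℝ η z Complex.I • (u z - c))) +
       (J0 - JJ z) (η z • fderiv ℝ u z Complex.I) := by
      rw [hΦ', hΦ', map_add]
      by_cases hz : z ∈ tsupport η
      · have := heq z (hs hz)
        rw [add_eq_zero_iff_eq_neg] at this
        rw [this, sub_apply, map_smul (JJ z)]
        module
      · have : η z = 0 := image_eq_zero_of_notMem_tsupport hz
        rw [this]; simp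
    rw [e]
    refine (norm_add_sq_le _ _).trans ?_
    have h2 := dbar_bound J0 (fderiv ℝ η z) (u z - c)
    have h3 : ‖(J0 - JJ z) (η z • fderiv ℝ u z Complex.I)‖ ^ 2 ≤
        δ ^ 2 * ‖η z • fderiv ℝ u z Complex.I‖ ^ 2 := by
      by_cases hz : z ∈ tsupport η
      · rw [← mul_pow]
        gcongr
        exact ((J0 - JJ z).le_opNorm _).trans (by gcongr; exact hJJ z (hs hz))
      · have : η z = 0 := image_eq_zero_of_notMem_tsupport hz
        rw [this]; simp
    linarith
  have cΦ' := hΦ.continuous_fderiv one_ne_zero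
  have cR : Continuous fun z => fderiv ℝ (fun z => η z • (u z - c)) z 1 +
      J0 (fderiv ℝ (fun z => η z • (u z - c)) z Complex.I) :=
    (cΦ'.clm_apply continuous_const).add (J0.continuous.comp (cΦ'.clm_apply continuous_const))
  have sF : ∀ w, HasCompactSupport fun z => fderiv ℝ (fun z => η z • (u z - c)) z w :=
    fun w => hΦc.fderiv_apply ℝ w
  have sR : HasCompactSupport fun z => fderiv ℝ (fun z => η z • (u z - c)) z 1 +
      J0 (fderiv ℝ (fun z => η z • (u z - c)) z Complex.I) :=
    (sF 1).add ((sF Complex.I).comp_left (map_zero J0))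
  have iR := integrable_normsq cR sR
  have iL := integrable_normsq (cΦ'.clm_apply (continuous_const (y := Complex.I))) (sF Complex.I)
  have h2 : ∫ z, ‖fderiv ℝ (fun z => η z • (u z - c)) z 1 +
      J0 (fderiv ℝ (fun z => η z • (u z - c)) z Complex.I)‖ ^ 2 ≤
      2 * ((1 + ‖J0‖) ^ 2 * Y) + 2 * (δ ^ 2 * X) := by
    rw [← integral_const_mul ((1 + ‖J0‖) ^ 2), ← integral_const_mul 2, ← integral_const_mul (δ ^ 2),
      ← integral_const_mul 2, ← integral_add ((iY.const_mul _).const_mul _) ((iX.const_mul _).const_mul _)]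
    exact integral_mono iR (((iY.const_mul _).const_mul _).add ((iX.const_mul _).const_mul _)) p1
  -- left side
  have h3 : X ≤ 2 * (∫ z, ‖fderiv ℝ (fun z => η z • (u z - c)) z Complex.I‖ ^ 2) + 2 * Y := by
    rw [← integral_const_mul, ← integral_const_mul, ← integral_add (iL.const_mul _) (iY.const_mul _)]
    apply integral_mono iX ((iL.const_mul _).add (iY.const_mul _))
    intro z
    show ‖η z • fderiv ℝ u z Complex.I‖ ^ 2 ≤ 2 * ‖fderiv ℝ (fun z => η z • (u z - c)) z Complex.I‖ ^ 2 +
      2 * (‖fderiv ℝ η z‖ ^ 2 * ‖u z - c‖ ^ 2)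
    have e : η z • fderiv ℝ u z Complex.I = fderiv ℝ (fun z => η z • (u z - c)) z Complex.I +
        (-(fderiv ℝ η z Complex.I • (u z - c))) := by rw [hΦ']; module
    rw [e]
    refine (norm_add_sq_le _ _).trans ?_
    gcongr
    rw [norm_neg, norm_smul, mul_pow]
    gcongr
    simpa using (fderiv ℝ η z).le_opNorm Complex.I
  have X0 : 0 ≤ X := integral_nonneg fun z => by positivity
  have h4 : C * (∫ z, ‖fderiv ℝ (fun z => η z • (u z - c)) z 1 +
      J0 (fderiv ℝ (fun z => η z • (u z - c)) z Complex.I)‖ ^ 2) ≤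
      C * (2 * ((1 + ‖J0‖) ^ 2 * Y) + 2 * (δ ^ 2 * X)) := by gcongr
  have h5 : 8 * C * δ ^ 2 * X ≤ 1 * X := by gcongr
  linarith

end Part9

section Part10
open MeasureTheory Metric Set
open scoped ENNReal ContDiff

lemma exists_bump : ∃ B : ℝ, 0 < B ∧ ∀ (a : ℂ) (r : ℝ), 0 < r → ∃ φ : ℂ → ℝ, ContDiff ℝ 1 φ ∧
    (∀ z, 0 ≤ φ z ∧ φ z ≤ 1) ∧ (∀ z ∈ ball a (r / 2), φ z = 1) ∧
    tsupport φ ⊆ closedBall a (3 * r / 4) ∧ ∀ z, ‖fderiv ℝ φ z‖ ≤ B / r := by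
  let φ0 : ContDiffBump (0 : ℂ) := ⟨1 / 2, 3 / 4, by norm_num, by norm_num⟩
  have h0 : ContDiff ℝ 1 φ0 := φ0.contDiff
  have c0 : Continuous (fderiv ℝ φ0) := h0.continuous_fderiv one_ne_zero
  have s0 : HasCompactSupport (fderiv ℝ φ0) := φ0.hasCompactSupport.fderiv ℝ
  obtain ⟨B, hB⟩ := c0.bounded_above_of_compact_support s0
  refine ⟨|B| + 1, by positivity, ?_⟩
  intro a r hr
  have hz : ∀ z : ℂ, ‖r⁻¹ • (z - a)‖ = r⁻¹ * ‖z - a‖ := by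
    intro z; rw [norm_smul, Real.norm_eq_abs, abs_of_pos (by positivity)]
  have hL : ∀ z : ℂ, HasFDerivAt (fun z : ℂ => r⁻¹ • (z - a)) (r⁻¹ • ContinuousLinearMap.id ℝ ℂ) z := by
    intro z
    exact ((hasFDerivAt_id z).sub_const a).const_smul r⁻¹
  refine ⟨fun z => φ0 (r⁻¹ • (z - a)), ?_, fun z => ⟨φ0.nonneg, φ0.le_one⟩, ?_, ?_, ?_⟩
  · exact h0.comp ((contDiff_id.sub contDiff_const).const_smul r⁻¹)
  · intro z hz1
    apply φ0.one_of_mem_closedBall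
    rw [mem_closedBall, dist_zero_right, hz]
    rw [mem_ball, dist_eq_norm] at hz1
    change r⁻¹ * ‖z - a‖ ≤ 1 / 2
    rw [inv_mul_le_iff₀ hr]; linarith
  · apply closure_minimal _ isClosed_closedBall
    intro z hz1
    rw [Function.mem_support] at hz1
    by_contra hz2
    apply hz1
    apply φ0.zero_of_le_dist
    rw [mem_closedBall, not_le, dist_eq_norm] at hz2
    rw [dist_zero_right, hz]
    change 3 / 4 ≤ r⁻¹ * ‖z - a‖
    rw [le_inv_mul_iff₀ hr]; linarith
  · intro z
    have := (((h0.differentiable one_ne_zero) (r⁻¹ • (z - a))).hasFDerivAt.comp z (hL z)).fderiv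
    change fderiv ℝ (fun z => φ0 (r⁻¹ • (z - a))) z = _ at this
    rw [this]
    have e : (fderiv ℝ φ0 (r⁻¹ • (z - a))).comp (r⁻¹ • ContinuousLinearMap.id ℝ ℂ) =
        r⁻¹ • fderiv ℝ φ0 (r⁻¹ • (z - a)) := by
      ext w; simp
    rw [e, norm_smul, Real.norm_eq_abs, abs_of_pos (by positivity : (0:ℝ) < r⁻¹), div_eq_inv_mul]
    gcongr
    exact (hB _).trans ((le_abs_self B).trans (by linarith))

section S
variable {W : Type*} [NormedAddCommGroup W] [NormedSpace ℝ W]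

/-- the affine map `α + (z-a) β` -/
noncomputable def aff (A : W →L[ℝ] W) (a : ℂ) (α β : W) (z : ℂ) : W := α + cmul A (z - a) β

lemma aff_fderiv (A : W →L[ℝ] W) (a : ℂ) (α β : W) (z : ℂ) :
    HasFDerivAt (aff A a α β) (Complex.reCLM.smulRight β + Complex.imCLM.smulRight (A β)) z := by
  have : aff A a α β = fun z => (Complex.reCLM.smulRight β + Complex.imCLM.smulRight (A β)) z +
      (α - (Complex.reCLM.smulRight β + Complex.imCLM.smulRight (A β)) a) := by
    funext z
    simp only [aff, cmul_apply, add_apply, ContinuousLinearMap.smulRight_apply, Complex.reCLM_apply,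
      Complex.imCLM_apply, Complex.sub_re, Complex.sub_im]
    module
  rw [this]
  exact (ContinuousLinearMap.hasFDerivAt _).add_const _

lemma aff_contDiff (A : W →L[ℝ] W) (a : ℂ) (α β : W) : ContDiff ℝ 1 (aff A a α β) := by
  have : aff A a α β = fun z => (Complex.reCLM.smulRight β + Complex.imCLM.smulRight (A β)) z +
      (α - (Complex.reCLM.smulRight β + Complex.imCLM.smulRight (A β)) a) := by
    funext z
    simp only [aff, cmul_apply, add_apply, ContinuousLinearMap.smulRight_apply, Complex.reCLM_apply,
      Complex.imCLM_apply, Complex.sub_re, Complex.sub_im]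
    module
  rw [this]
  exact (ContinuousLinearMap.contDiff _).add contDiff_const

end S

end Part10

section Part11
open MeasureTheory Metric Set
open scoped ENNReal ContDiff

section S
variable {W : Type*} [NormedAddCommGroup W] [NormedSpace ℝ W]

lemma step_core [CompleteSpace W] (E : Set ℂ) (z0 : ℂ) (R : ℝ) (hG : IsOpen (ball z0 R \ E))
    (A : W →L[ℝ] W) (hA : ∀ w, A (A w) = -w)
    (u : ℂ → W) (hu : ContinuousOn u (closedBall z0 R)) (huG : ContDiffOn ℝ 1 u (ball z0 R \ E))
    (JJ : ℂ → W →L[ℝ] W) (hJc : ContinuousOn JJ (ball z0 R \ E))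
    (heq : ∀ z ∈ ball z0 R \ E, fderiv ℝ u z 1 + JJ z (fderiv ℝ u z Complex.I) = 0)
    (a : ℂ) (r : ℝ) (hr : 0 < r) (hsub : ball a r ⊆ ball z0 R)
    (φ : ℂ → ℝ) (hφ : ContDiff ℝ 1 φ) (hφ1 : ∀ z ∈ ball a (r / 2), φ z = 1)
    (hφs : tsupport φ ⊆ closedBall a (3 * r / 4))
    (χ : ℂ → ℝ) (hχ : ContDiff ℝ 1 χ) (hχ1 : ∀ z, 0 ≤ χ z ∧ χ z ≤ 1)
    (U : Set ℂ) (hU : IsOpen U) (hEU : E ∩ closedBall z0 R ⊆ U) (hχU : ∀ x ∈ U, χ x = 1)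
    (α β : W) :
    tsupport (fun z => φ z * (1 - χ z)) ⊆ ball z0 R \ E ∧
    ∃ f g : ℂ → W, Continuous f ∧ Continuous g ∧ (∀ ζ, ζ ∉ ball a r → f ζ = 0) ∧
      (∀ ζ, ζ ∉ ball a r → g ζ = 0) ∧ (∀ ζ ∈ ball a (r / 2), g ζ = 0) ∧
      (∀ z ∈ ball a (r / 2), u z - aff A a α β z =
        TT A f z + TT A g z + χ z • (u z - aff A a α β z)) ∧
      (∀ z, ‖f z‖ ^ 2 ≤ 2 * ‖(A - JJ z) ((φ z * (1 - χ z)) • fderiv ℝ u z Complex.I)‖ ^ 2 +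
        2 * ((1 + ‖A‖) ^ 2 * (‖fderiv ℝ χ z‖ ^ 2 * ‖φ z • (u z - aff A a α β z)‖ ^ 2))) ∧
      (∀ z, ‖g z‖ ^ 2 ≤ (1 + ‖A‖) ^ 2 * (‖fderiv ℝ φ z‖ ^ 2 * ‖u z - aff A a α β z‖ ^ 2)) := by
  have hb : closedBall a (3 * r / 4) ⊆ ball a r := closedBall_subset_ball (by linarith)
  have hη : ContDiff ℝ 1 (fun z => φ z * (1 - χ z)) := hφ.mul (contDiff_const.sub hχ)
  have hs : tsupport (fun z => φ z * (1 - χ z)) ⊆ ball z0 R \ E := by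
    intro z hz
    have h1 : z ∈ tsupport φ := tsupport_mul_subset_left hz
    have h2 : z ∈ ball z0 R := hsub (hb (hφs h1))
    refine ⟨h2, fun hE => ?_⟩
    have hzU := hEU ⟨hE, ball_subset_closedBall h2⟩
    rw [← not_not (a := z ∈ tsupport _)] at hz
    apply hz
    rw [notMem_tsupport_iff_eventuallyEq]
    filter_upwards [hU.mem_nhds hzU] with y hy
    simp [hχU y hy]
  refine ⟨hs, ?_⟩
  set G := ball z0 R \ E with hGdef
  set v : ℂ → W := fun z => u z - aff A a α β z with hv
  set η : ℂ → ℝ := fun z => φ z * (1 - χ z) with hηd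
  have hvG : ContDiffOn ℝ 1 v G := huG.sub (aff_contDiff A a α β).contDiffOn
  have hvc : ContinuousOn v (ball z0 R) :=
    (hu.mono ball_subset_closedBall).sub (aff_contDiff A a α β).continuous.continuousOn
  have cuy : ContinuousOn (fun z => fderiv ℝ u z Complex.I) G :=
    (huG.continuousOn_fderiv_of_isOpen hG le_rfl).clm_apply continuousOn_const
  have hφb : tsupport φ ⊆ ball z0 R := hφs.trans (hb.trans hsub)
  have cχ : Continuous (fderiv ℝ χ) := hχ.continuous_fderiv one_ne_zero
  have cφ : Continuous (fderiv ℝ φ) := hφ.continuous_fderiv one_ne_zero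
  have tφ : tsupport (fderiv ℝ φ) ⊆ tsupport φ := tsupport_fderiv_subset ℝ
  have φ0 : ∀ z, z ∉ ball a r → φ z = 0 := fun z hz =>
    image_eq_zero_of_notMem_tsupport fun h => hz (hb (hφs h))
  have φ0' : ∀ z, z ∉ ball a r → fderiv ℝ φ z = 0 := fun z hz =>
    image_eq_zero_of_notMem_tsupport fun h => hz (hb (hφs (tφ h)))
  have hφw : ∀ w, Continuous fun z => fderiv ℝ φ z w • ((1 - χ z) • v z) := by
    intro w
    apply smul_cont_of_tsupport (ball z0 R) isOpen_ball _ (cφ.clm_apply continuous_const)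
    · refine Subset.trans (closure_mono ?_) (tφ.trans hφb)
      intro z hz h0
      exact hz (by simp [h0])
    · exact (continuousOn_const.sub hχ.continuous.continuousOn).smul hvc
  obtain ⟨f, hf⟩ : ∃ f : ℂ → W, f = fun z => η z • ((A - JJ z) (fderiv ℝ u z Complex.I)) -
      φ z • (fderiv ℝ χ z 1 • v z + A (fderiv ℝ χ z Complex.I • v z)) := ⟨_, rfl⟩
  obtain ⟨g, hg⟩ : ∃ g : ℂ → W, g = fun z => fderiv ℝ φ z 1 • ((1 - χ z) • v z) +
      A (fderiv ℝ φ z Complex.I • ((1 - χ z) • v z)) := ⟨_, rfl⟩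
  have cf : Continuous f := by
    rw [hf]
    apply Continuous.sub
    · exact smul_cont_of_tsupport G hG η hη.continuous hs _
        ((continuousOn_const.sub hJc).clm_apply cuy)
    · apply smul_cont_of_tsupport (ball z0 R) isOpen_ball φ hφ.continuous hφb
      apply ContinuousOn.add
      · exact (cχ.clm_apply continuous_const).continuousOn.smul hvc
      · exact A.continuous.comp_continuousOn
          ((cχ.clm_apply continuous_const).continuousOn.smul hvc)
  have cg : Continuous g := by
    rw [hg]
    exact (hφw 1).add (A.continuous.comp (hφw Complex.I))
  have zf : ∀ ζ, ζ ∉ ball a r → f ζ = 0 := by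
    intro z hz; simp [hf, hηd, φ0 z hz]
  have zg : ∀ ζ, ζ ∉ ball a r → g ζ = 0 := by
    intro z hz; simp [hg, φ0' z hz]
  refine ⟨f, g, cf, cg, zf, zg, ?_, ?_, ?_, ?_⟩
  · intro z hz
    have : φ =ᶠ[nhds z] fun _ => 1 := by
      filter_upwards [isOpen_ball.mem_nhds hz] with y hy using hφ1 y hy
    simp [hg, this.fderiv_eq]
  · intro z hz
    have hzr : z ∈ ball a r := ball_subset_ball (by linarith) hz
    have hηc : HasCompactSupport η := HasCompactSupport.intro (isCompact_closedBall a r)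
      (fun x hx => by
        have := φ0 x fun h => hx (ball_subset_closedBall h)
        simp [hηd, this])
    have hrep := cauchy_rep A hA (fun z => η z • v z) (cut_contDiff G hG η hη hs v hvG)
      hηc.smul_right z
    have hd : ∀ ζ, fderiv ℝ (fun z => η z • v z) ζ 1 +
        A (fderiv ℝ (fun z => η z • v z) ζ Complex.I) = f ζ + g ζ := by
      intro ζ
      have hη' : ∀ w, fderiv ℝ η ζ w = fderiv ℝ φ ζ w * (1 - χ ζ) - φ ζ * fderiv ℝ χ ζ w := by
        intro w
        have := (((hφ.differentiable one_ne_zero) ζ).hasFDerivAt.mul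
          (((hχ.differentiable one_ne_zero) ζ).hasFDerivAt.const_sub 1)).fderiv
        change fderiv ℝ η ζ = _ at this
        rw [this]
        simp
        ring
      rw [cut_fderiv G hG η hη hs v hvG, cut_fderiv G hG η hη hs v hvG, hη', hη', hf, hg]
      beta_reduce
      by_cases hz : ζ ∈ tsupport η
      · have hζ := hs hz
        have hv' : ∀ w, fderiv ℝ v ζ w = fderiv ℝ u ζ w - (w.re • β + w.im • A β) := by
          intro w
          have h1 : DifferentiableAt ℝ u ζ :=
            (huG.contDiffAt (hG.mem_nhds hζ)).differentiableAt one_ne_zero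
          have := (h1.hasFDerivAt.sub (aff_fderiv A a α β ζ)).fderiv
          change fderiv ℝ v ζ = _ at this
          rw [this]
          simp
        have he := heq ζ hζ
        rw [add_eq_zero_iff_eq_neg] at he
        rw [hv', hv', he]
        simp only [Complex.one_re, Complex.one_im, Complex.I_re, Complex.I_im, sub_apply,
          map_add, map_sub, map_smul, hA]
        module
      · have : η ζ = 0 := image_eq_zero_of_notMem_tsupport hz
        rw [this]
        simp only [map_add, map_smul]
        module
    simp only [hd] at hrep
    have h2 := TT_add A f g a r hr cf zf cg zg z hzr
    unfold TT at h2 ⊢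
    rw [← h2, ← hrep, hηd]
    simp only [hφ1 z hz, hv]
    module
  · intro z
    rw [hf]
    have e : η z • ((A - JJ z) (fderiv ℝ u z Complex.I)) -
      φ z • (fderiv ℝ χ z 1 • v z + A (fderiv ℝ χ z Complex.I • v z)) =
      (A - JJ z) (η z • fderiv ℝ u z Complex.I) +
      -(fderiv ℝ χ z 1 • (φ z • v z) + A (fderiv ℝ χ z Complex.I • (φ z • v z))) := by
      simp only [map_smul]; module
    beta_reduce
    rw [e]
    refine (norm_add_sq_le _ _).trans ?_
    rw [norm_neg]
    have := dbar_bound A (fderiv ℝ χ z) (φ z • v z)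
    linarith
  · intro z
    rw [hg]
    refine (dbar_bound A (fderiv ℝ φ z) ((1 - χ z) • v z)).trans ?_
    gcongr
    rw [norm_smul, Real.norm_eq_abs]
    have := hχ1 z
    rw [abs_of_nonneg (by linarith)]
    nlinarith [norm_nonneg (v z)]

end S

end Part11

section Part12
open MeasureTheory Metric Set
open scoped ENNReal ContDiff

lemma setInt_le {s : Set ℂ} (hs : MeasurableSet s) {f g : ℂ → ℝ} (hf : ∀ z ∈ s, 0 ≤ f z)
    (hg : IntegrableOn g s) (h : ∀ z ∈ s, f z ≤ g z) : ∫ z in s, f z ≤ ∫ z in s, g z := by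
  apply integral_mono_of_nonneg
  · exact ae_restrict_of_forall_mem hs hf
  · exact hg
  · exact ae_restrict_of_forall_mem hs h

section S
variable {W : Type*} [NormedAddCommGroup W] [NormedSpace ℝ W]

/-- local set-up -/
structure LocSetup (MJ K C1 : ℝ) (E : Set ℂ) (z0 : ℂ) (R : ℝ) (u : ℂ → W)
    (JJ : ℂ → W →L[ℝ] W) : Prop where
  hR : 0 < R
  hG : IsOpen (ball z0 R \ E)
  hu : ContinuousOn u (closedBall z0 R)
  huG : ContDiffOn ℝ 1 u (ball z0 R \ E)
  heq : ∀ z ∈ ball z0 R \ E, fderiv ℝ u z 1 + JJ z (fderiv ℝ u z Complex.I) = 0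
  hJc : ContinuousOn JJ (ball z0 R \ E)
  hsq : ∀ z w, JJ z (JJ z w) = -w
  hMJ : ∀ z ∈ ball z0 R, ‖JJ z‖ ≤ MJ
  hK : ∀ z ∈ ball z0 R, ∀ z' ∈ ball z0 R, ‖JJ z - JJ z'‖ ≤ K * ‖u z - u z'‖
  hcac : ∀ η : ℂ → ℝ, ContDiff ℝ 1 η → HasCompactSupport η → tsupport η ⊆ ball z0 R \ E →
    ∀ c : W, ∫ z, ‖η z • fderiv ℝ u z Complex.I‖ ^ 2 ≤ C1 * ∫ z, ‖fderiv ℝ η z‖ ^ 2 * ‖u z - c‖ ^ 2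
  hcut : ∀ ε > 0, ∃ χ : ℂ → ℝ, ContDiff ℝ 1 χ ∧ (∀ z, 0 ≤ χ z ∧ χ z ≤ 1) ∧
    (∃ U, IsOpen U ∧ E ∩ closedBall z0 R ⊆ U ∧ ∀ x ∈ U, χ x = 1) ∧
    ∫ z in ball z0 R, χ z ^ 2 ≤ ε ∧ ∫ z in ball z0 R, ‖fderiv ℝ χ z‖ ^ 2 ≤ ε

/-- normalised square deviation -/
noncomputable def nn (u : ℂ → W) (a : ℂ) (r : ℝ) (P : ℂ → W) : ℝ :=
  (r ^ 2)⁻¹ * ∫ z in ball a r, ‖u z - P z‖ ^ 2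

lemma norm_add3_sq_le (a b c : W) :
    ‖a + b + c‖ ^ 2 ≤ 3 * ‖a‖ ^ 2 + 3 * ‖b‖ ^ 2 + 3 * ‖c‖ ^ 2 := by
  have := norm_add₃_le (a := a) (b := b) (c := c)
  nlinarith [norm_nonneg (a + b + c), sq_nonneg (‖a‖ - ‖b‖), sq_nonneg (‖a‖ - ‖c‖),
    sq_nonneg (‖b‖ - ‖c‖), norm_nonneg a, norm_nonneg b, norm_nonneg c]

set_option maxHeartbeats 1600000 in
lemma step_est [CompleteSpace W] (MJ K C1 : ℝ) (hMJ0 : 0 ≤ MJ) (hK0 : 0 ≤ K) (hC10 : 0 ≤ C1) :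
    ∃ C : ℝ, 0 < C ∧ ∀ (E : Set ℂ) (z0 : ℂ) (R : ℝ) (u : ℂ → W) (JJ : ℂ → W →L[ℝ] W),
      LocSetup MJ K C1 E z0 R u JJ → ∀ (a : ℂ) (r : ℝ), 0 < r → ball a r ⊆ ball z0 R →
      ∀ om : ℝ, 0 ≤ om → (∀ z ∈ ball a r, ‖u z - u a‖ ≤ om) → ∀ θ : ℝ, 0 < θ → θ ≤ 1 / 4 →
      ∀ (α β c : W) (ε : ℝ), 0 < ε →
      (∃ α' β' : W, nn u a (θ * r) (aff (JJ a) a α' β') ≤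
        C * θ ^ 4 * nn u a r (aff (JJ a) a α β) + C * (θ ^ 2)⁻¹ * om ^ 2 * nn u a r (fun _ => c) + ε) ∧
      (∃ α' : W, nn u a (θ * r) (aff (JJ a) a α' β) ≤
        C * θ ^ 2 * nn u a r (aff (JJ a) a α β) + C * (θ ^ 2)⁻¹ * om ^ 2 * nn u a r (fun _ => c) + ε) := by
  obtain ⟨B, hB, hbump⟩ := exists_bump
  refine ⟨48 * (1 + MJ) ^ 2 * K ^ 2 * C1 * B ^ 2 + 192 * Real.pi * (1 + MJ) ^ 4 * B ^ 2 + 1,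
    by positivity, ?_⟩
  intro E z0 R u JJ S a r hr hsub om hom hosc θ hθ hθ4 α β c ε hε
  have hasub : a ∈ ball z0 R := hsub (mem_ball_self hr)
  obtain ⟨A, hAd⟩ : ∃ A, A = JJ a := ⟨_, rfl⟩
  rw [← hAd]
  have hA : ∀ w, A (A w) = -w := by rw [hAd]; exact S.hsq a
  have hAM : ‖A‖ ≤ MJ := by rw [hAd]; exact S.hMJ a hasub
  have hAJ : ∀ z ∈ ball a r, ‖A - JJ z‖ ≤ K * om := by
    intro z hz
    rw [hAd]
    refine (S.hK a hasub z (hsub hz)).trans ?_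
    gcongr
    rw [norm_sub_rev]; exact hosc z hz
  obtain ⟨φ, hφ, hφ01, hφ1, hφs, hφd⟩ := hbump a r hr
  -- bounds
  have cv : ContinuousOn (fun z => u z - aff A a α β z) (closedBall z0 R) :=
    S.hu.sub (aff_contDiff A a α β).continuous.continuousOn
  have cc : ContinuousOn (fun z => u z - c) (closedBall z0 R) := S.hu.sub continuousOn_const
  obtain ⟨s1, hs1⟩ := (isCompact_closedBall z0 R).exists_bound_of_continuousOn cv
  obtain ⟨s2, hs2⟩ := (isCompact_closedBall z0 R).exists_bound_of_continuousOn cc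
  obtain ⟨s, hs0, hsv, hsc⟩ : ∃ s : ℝ, 0 ≤ s ∧ (∀ z ∈ ball a r, ‖u z - aff A a α β z‖ ^ 2 ≤ s) ∧
      (∀ z ∈ ball a r, ‖u z - c‖ ^ 2 ≤ s) := by
    refine ⟨(max s1 s2) ^ 2, by positivity, ?_, ?_⟩
    · intro z hz
      have := (hs1 z (ball_subset_closedBall (hsub hz))).trans (le_max_left s1 s2)
      gcongr
    · intro z hz
      have := (hs2 z (ball_subset_closedBall (hsub hz))).trans (le_max_right s1 s2)
      gcongr
  have hcl : ∀ f : ℂ → ℝ, ContinuousOn f (closedBall z0 R) → IntegrableOn f (ball a r) := by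
    intro f hf
    exact (hf.integrableOn_compact (isCompact_closedBall z0 R)).mono_set
      (hsub.trans ball_subset_closedBall)
  have hcl0 : ∀ f : ℂ → ℝ, Continuous f → IntegrableOn f (ball z0 R) := by
    intro f hf
    exact (hf.continuousOn.integrableOn_compact (isCompact_closedBall z0 R)).mono_set
      ball_subset_closedBall
  obtain ⟨Q, hQ⟩ : ∃ Q : ℝ, Q = 12 * (1 + MJ) ^ 2 * (θ ^ 2)⁻¹ * (4 * K ^ 2 * om ^ 2 * C1 * s +
    2 * (1 + MJ) ^ 2 * s) + 3 * s * ((θ * r) ^ 2)⁻¹ := ⟨_, rfl⟩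
  have hQ0 : 0 ≤ Q := by rw [hQ]; positivity
  obtain ⟨e, he0, heQ⟩ : ∃ e : ℝ, 0 < e ∧ e * Q ≤ ε := by
    refine ⟨ε / (Q + 1), by positivity, ?_⟩
    rw [div_mul_eq_mul_div, div_le_iff₀ (by positivity)]
    nlinarith
  obtain ⟨χ, hχ, hχ01, ⟨U, hU, hEU, hχU⟩, hχi, hχd⟩ := S.hcut e he0
  obtain ⟨hts, f, g, cf, cg, zf, zg, zg2, hrep, hfb, hgb⟩ := step_core E z0 R S.hG A hA u S.hu S.huG
    JJ S.hJc S.heq a r hr hsub φ hφ hφ1 hφs χ hχ hχ01 U hU hEU hχU α β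
  have cχ : Continuous (fderiv ℝ χ) := hχ.continuous_fderiv one_ne_zero
  have hχd' : ∫ z in ball a r, ‖fderiv ℝ χ z‖ ^ 2 ≤ e :=
    (setIntegral_mono_set (hcl0 _ (cχ.norm.pow 2)) (Filter.Eventually.of_forall fun z => sq_nonneg _)
      hsub.eventuallyLE).trans hχd
  have iχd : IntegrableOn (fun z => ‖fderiv ℝ χ z‖ ^ 2) (ball a r) :=
    (hcl0 _ (cχ.norm.pow 2)).mono_set hsub
  have ic : IntegrableOn (fun z => ‖u z - c‖ ^ 2) (ball a r) := hcl _ (cc.norm.pow 2)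
  have iv : IntegrableOn (fun z => ‖u z - aff A a α β z‖ ^ 2) (ball a r) := hcl _ (cv.norm.pow 2)
  set nv := nn u a r (aff A a α β) with hnv
  set nc := nn u a r (fun _ => c) with hnc
  have hnv0 : 0 ≤ nv := by
    rw [hnv, nn]
    exact mul_nonneg (by positivity) (integral_nonneg fun z => by positivity)
  have hnc0 : 0 ≤ nc := by
    rw [hnc, nn]
    exact mul_nonneg (by positivity) (integral_nonneg fun z => by positivity)
  -- N3
  have N3 : ∫ z, ‖g z‖ ^ 2 ≤ (1 + MJ) ^ 2 * B ^ 2 * nv := by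
    rw [← setIntegral_eq_integral_of_forall_compl_eq_zero (s := ball a r)
      (fun z hz => by simp [zg z hz])]
    calc _ ≤ ∫ z in ball a r, ((1 + MJ) ^ 2 * (B / r) ^ 2) * ‖u z - aff A a α β z‖ ^ 2 := by
          apply setInt_le measurableSet_ball (fun z _ => by positivity) (iv.const_mul _)
          intro z hz
          refine (hgb z).trans ?_
          have := hφd z
          rw [← mul_assoc]
          gcongr
      _ = _ := by
          rw [integral_const_mul, hnv, nn]; field_simp
  -- gradient of the cutoff
  have hη : ContDiff ℝ 1 (fun z => φ z * (1 - χ z)) := hφ.mul (contDiff_const.sub hχ)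
  have hb : closedBall a (3 * r / 4) ⊆ ball a r := closedBall_subset_ball (by linarith)
  have htb : tsupport (fun z => φ z * (1 - χ z)) ⊆ ball a r :=
    (tsupport_mul_subset_left).trans (hφs.trans hb)
  have hηc : HasCompactSupport (fun z => φ z * (1 - χ z)) := by
    apply HasCompactSupport.intro (isCompact_closedBall a r)
    intro x hx
    exact image_eq_zero_of_notMem_tsupport (f := fun z => φ z * (1 - χ z))
      fun h => hx (ball_subset_closedBall (htb h))
  have hηd : ∀ z, ‖fderiv ℝ (fun z => φ z * (1 - χ z)) z‖ ^ 2 ≤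
      2 * (B / r) ^ 2 + 2 * ‖fderiv ℝ χ z‖ ^ 2 := by
    intro z
    have h1 : fderiv ℝ (fun z => φ z * (1 - χ z)) z =
        (1 - χ z) • fderiv ℝ φ z + (- φ z) • fderiv ℝ χ z := by
      have := (((hφ.differentiable one_ne_zero) z).hasFDerivAt.mul
          (((hχ.differentiable one_ne_zero) z).hasFDerivAt.const_sub 1)).fderiv
      change fderiv ℝ (fun z => φ z * (1 - χ z)) z = _ at this
      rw [this]; module
    rw [h1]
    refine (norm_add_sq_le _ _).trans ?_
    rw [norm_smul, norm_smul, Real.norm_eq_abs, Real.norm_eq_abs, abs_neg]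
    have h2 := hφ01 z
    have h3 := hχ01 z
    rw [abs_of_nonneg h2.1, abs_of_nonneg (by linarith : 0 ≤ 1 - χ z)]
    have h4 := hφd z
    have h5 : (1 - χ z) * ‖fderiv ℝ φ z‖ ≤ B / r := by
      nlinarith [norm_nonneg (fderiv ℝ φ z)]
    have h6 : φ z * ‖fderiv ℝ χ z‖ ≤ ‖fderiv ℝ χ z‖ := by
      nlinarith [norm_nonneg (fderiv ℝ χ z)]
    have h7 : 0 ≤ (1 - χ z) * ‖fderiv ℝ φ z‖ := mul_nonneg (by linarith) (norm_nonneg _)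
    have h8 : 0 ≤ φ z * ‖fderiv ℝ χ z‖ := mul_nonneg (by linarith) (norm_nonneg _)
    gcongr
  have hcac := S.hcac _ hη hηc hts c
  have hN0 : ∫ z, ‖fderiv ℝ (fun z => φ z * (1 - χ z)) z‖ ^ 2 * ‖u z - c‖ ^ 2 ≤
      2 * B ^ 2 * nc + 2 * s * e := by
    rw [← setIntegral_eq_integral_of_forall_compl_eq_zero (s := ball a r)
      (fun z hz => by
        have : fderiv ℝ (fun z => φ z * (1 - χ z)) z = 0 :=
          image_eq_zero_of_notMem_tsupport fun h => hz (htb (tsupport_fderiv_subset ℝ h))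
        simp [this])]
    have i1 : IntegrableOn (fun z => 2 * (B / r) ^ 2 * ‖u z - c‖ ^ 2) (ball a r) := ic.const_mul _
    have i2 : IntegrableOn (fun z => 2 * s * ‖fderiv ℝ χ z‖ ^ 2) (ball a r) := iχd.const_mul _
    have i12 : IntegrableOn (fun z => 2 * (B / r) ^ 2 * ‖u z - c‖ ^ 2 +
      2 * s * ‖fderiv ℝ χ z‖ ^ 2) (ball a r) := i1.add i2
    calc _ ≤ ∫ z in ball a r, (2 * (B / r) ^ 2 * ‖u z - c‖ ^ 2 + 2 * s * ‖fderiv ℝ χ z‖ ^ 2) := by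
          apply setInt_le measurableSet_ball (fun z _ => by positivity) i12
          intro z hz
          have h1 := hηd z
          have h2 := hsc z hz
          have h3 := mul_le_mul_of_nonneg_right h1 (sq_nonneg ‖u z - c‖)
          have h4 := mul_le_mul_of_nonneg_left h2 (sq_nonneg ‖fderiv ℝ χ z‖)
          refine h3.trans ?_
          rw [add_mul, mul_assoc 2 (‖fderiv ℝ χ z‖ ^ 2)]
          have h5 : 2 * s * ‖fderiv ℝ χ z‖ ^ 2 = 2 * (‖fderiv ℝ χ z‖ ^ 2 * s) := by ring
          rw [h5]
          exact add_le_add_right (mul_le_mul_of_nonneg_left h4 (by norm_num)) _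
      _ ≤ _ := by
          rw [integral_add i1 i2, integral_const_mul, integral_const_mul, hnc, nn]
          have : 2 * (B / r) ^ 2 * ∫ z in ball a r, ‖u z - c‖ ^ 2 =
            2 * B ^ 2 * ((r ^ 2)⁻¹ * ∫ z in ball a r, ‖u z - c‖ ^ 2) := by field_simp
          rw [this]
          gcongr
  have cuy : ContinuousOn (fun z => fderiv ℝ u z Complex.I) (ball z0 R \ E) :=
    (S.huG.continuousOn_fderiv_of_isOpen S.hG le_rfl).clm_apply continuousOn_const
  have cX : Continuous fun z => (φ z * (1 - χ z)) • fderiv ℝ u z Complex.I :=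
    smul_cont_of_tsupport _ S.hG _ hη.continuous hts _ cuy
  have sX : HasCompactSupport fun z => (φ z * (1 - χ z)) • fderiv ℝ u z Complex.I := hηc.smul_right
  have iX := integrable_normsq cX sX
  have N12 : ∫ z, ‖f z‖ ^ 2 ≤ 2 * (K * om) ^ 2 * (C1 * (2 * B ^ 2 * nc + 2 * s * e)) +
      2 * (1 + MJ) ^ 2 * s * e := by
    rw [← setIntegral_eq_integral_of_forall_compl_eq_zero (s := ball a r)
      (fun z hz => by simp [zf z hz])]
    have i1 : IntegrableOn (fun z => 2 * (K * om) ^ 2 *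
      ‖(φ z * (1 - χ z)) • fderiv ℝ u z Complex.I‖ ^ 2) (ball a r) := (iX.const_mul _).integrableOn
    have i2 : IntegrableOn (fun z => 2 * (1 + MJ) ^ 2 * s * ‖fderiv ℝ χ z‖ ^ 2) (ball a r) :=
      iχd.const_mul _
    have i12 : IntegrableOn (fun z => 2 * (K * om) ^ 2 *
      ‖(φ z * (1 - χ z)) • fderiv ℝ u z Complex.I‖ ^ 2 +
          2 * (1 + MJ) ^ 2 * s * ‖fderiv ℝ χ z‖ ^ 2) (ball a r) := i1.add i2
    calc _ ≤ ∫ z in ball a r, (2 * (K * om) ^ 2 *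
      ‖(φ z * (1 - χ z)) • fderiv ℝ u z Complex.I‖ ^ 2 +
          2 * (1 + MJ) ^ 2 * s * ‖fderiv ℝ χ z‖ ^ 2) := by
          apply setInt_le measurableSet_ball (fun z _ => by positivity) i12
          intro z hz
          refine (hfb z).trans ?_
          have h1 : ‖(A - JJ z) ((φ z * (1 - χ z)) • fderiv ℝ u z Complex.I)‖ ^ 2 ≤
              (K * om) ^ 2 * ‖(φ z * (1 - χ z)) • fderiv ℝ u z Complex.I‖ ^ 2 := by
            rw [← mul_pow]
            gcongr
            exact ((A - JJ z).le_opNorm _).trans (by gcongr; exact hAJ z hz)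
          have h2 : ‖φ z • (u z - aff A a α β z)‖ ^ 2 ≤ s := by
            refine le_trans ?_ (hsv z hz)
            rw [norm_smul, Real.norm_eq_abs]
            have := hφ01 z
            rw [abs_of_nonneg this.1]
            have h0 : 0 ≤ φ z * ‖u z - aff A a α β z‖ := mul_nonneg this.1 (norm_nonneg _)
            gcongr
            nlinarith [norm_nonneg (u z - aff A a α β z)]
          have h3 : (1 + ‖A‖) ^ 2 * (‖fderiv ℝ χ z‖ ^ 2 * ‖φ z • (u z - aff A a α β z)‖ ^ 2) ≤
            (1 + MJ) ^ 2 * (‖fderiv ℝ χ z‖ ^ 2 * s) := by gcongr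
          have h5 : 2 * (1 + MJ) ^ 2 * s * ‖fderiv ℝ χ z‖ ^ 2 =
            2 * ((1 + MJ) ^ 2 * (‖fderiv ℝ χ z‖ ^ 2 * s)) := by ring
          rw [h5, mul_assoc 2 ((K * om) ^ 2)]
          exact add_le_add (mul_le_mul_of_nonneg_left h1 (by norm_num))
            (mul_le_mul_of_nonneg_left h3 (by norm_num))
      _ ≤ _ := by
          rw [integral_add i1 i2, integral_const_mul, integral_const_mul]
          have : ∫ z in ball a r, ‖(φ z * (1 - χ z)) • fderiv ℝ u z Complex.I‖ ^ 2 ≤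
              ∫ z, ‖(φ z * (1 - χ z)) • fderiv ℝ u z Complex.I‖ ^ 2 :=
            setIntegral_le_integral iX (Filter.Eventually.of_forall fun z => by positivity)
          have h2 := this.trans (hcac.trans (mul_le_mul_of_nonneg_left hN0 hC10))
          gcongr
  have hθr : ball a (θ * r) ⊆ ball a (r / 4) := ball_subset_ball (by nlinarith)
  have hr42 : ball a (r / 4) ⊆ ball a (r / 2) := ball_subset_ball (by linarith)
  have hr4 : ball a (r / 4) ⊆ ball a r := ball_subset_ball (by linarith)
  obtain ⟨iT, hT⟩ := TT_L2 A f a r hr cf zf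
  have key : ∀ (p : ℂ → W) (κ : ℝ), 0 ≤ κ → (∀ z ∈ ball a (θ * r), ‖TT A g z - p z‖ ^ 2 ≤
      64 * (1 + ‖A‖) ^ 2 * κ * ∫ z, ‖g z‖ ^ 2) →
      nn u a (θ * r) (fun z => aff A a α β z + p z) ≤
      (48 * (1 + MJ) ^ 2 * K ^ 2 * C1 * B ^ 2 + 192 * Real.pi * (1 + MJ) ^ 4 * B ^ 2 + 1) * κ * nv +
      (48 * (1 + MJ) ^ 2 * K ^ 2 * C1 * B ^ 2 + 192 * Real.pi * (1 + MJ) ^ 4 * B ^ 2 + 1) * (θ ^ 2)⁻¹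
        * om ^ 2 * nc + ε := by
    intro p κ hκ hp
    set q : ℝ := 64 * (1 + MJ) ^ 2 * κ * ((1 + MJ) ^ 2 * B ^ 2 * nv) with hq
    have hp' : ∀ z ∈ ball a (θ * r), ‖TT A g z - p z‖ ^ 2 ≤ q := by
      intro z hz
      refine (hp z hz).trans ?_
      rw [hq]
      gcongr
    have iT' : IntegrableOn (fun z => 3 * ‖TT A f z‖ ^ 2) (ball a (θ * r)) :=
      (iT.mono_set (hθr.trans hr4)).const_mul _
    have iq : IntegrableOn (fun _ : ℂ => 3 * q) (ball a (θ * r)) := by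
      exact integrableOn_const (measure_ball_lt_top.ne) enorm_ne_top
    have iχ : IntegrableOn (fun z => 3 * s * χ z ^ 2) (ball a (θ * r)) :=
      ((hcl0 _ (hχ.continuous.pow 2)).mono_set ((hθr.trans hr4).trans hsub)).const_mul _
    have i3 : IntegrableOn (fun z => 3 * ‖TT A f z‖ ^ 2 + 3 * q) (ball a (θ * r)) := iT'.add iq
    have i4 : IntegrableOn (fun z => 3 * ‖TT A f z‖ ^ 2 + 3 * q + 3 * s * χ z ^ 2)
      (ball a (θ * r)) := i3.add iχ
    have hI : ∫ z in ball a (θ * r), ‖u z - (aff A a α β z + p z)‖ ^ 2 ≤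
        3 * (4 * (1 + MJ) ^ 2 * r ^ 2 * (2 * (K * om) ^ 2 * (C1 * (2 * B ^ 2 * nc + 2 * s * e)) +
      2 * (1 + MJ) ^ 2 * s * e)) + 3 * q * (Real.pi * (θ * r) ^ 2) + 3 * s * e := by
      calc _ ≤ ∫ z in ball a (θ * r), (3 * ‖TT A f z‖ ^ 2 + 3 * q + 3 * s * χ z ^ 2) := by
            apply setInt_le measurableSet_ball (fun z _ => by positivity) i4
            intro z hz
            have h1 := hrep z (hr42 (hθr hz))
            have e1 : u z - (aff A a α β z + p z) =
                TT A f z + (TT A g z - p z) + χ z • (u z - aff A a α β z) := by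
              rw [← sub_sub]
              nth_rewrite 1 [h1]
              abel
            rw [e1]
            refine (norm_add3_sq_le _ _ _).trans ?_
            have h2 := hp' z hz
            have h3 : ‖χ z • (u z - aff A a α β z)‖ ^ 2 ≤ s * χ z ^ 2 := by
              rw [norm_smul, Real.norm_eq_abs, mul_pow, sq_abs, mul_comm]
              exact mul_le_mul_of_nonneg_right (hsv z (hr4 (hθr hz))) (sq_nonneg _)
            linarith
        _ = 3 * (∫ z in ball a (θ * r), ‖TT A f z‖ ^ 2) + 3 * q * (Real.pi * (θ * r) ^ 2) +
            3 * s * ∫ z in ball a (θ * r), χ z ^ 2 := by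
            rw [integral_add i3 iχ, integral_add iT' iq, integral_const_mul, integral_const_mul (3 * s),
              setIntegral_const, vol_ball a _ (by positivity), smul_eq_mul]
            ring
        _ ≤ _ := by
            have h1 : ∫ z in ball a (θ * r), ‖TT A f z‖ ^ 2 ≤
              4 * (1 + MJ) ^ 2 * r ^ 2 * (2 * (K * om) ^ 2 * (C1 * (2 * B ^ 2 * nc + 2 * s * e)) +
                2 * (1 + MJ) ^ 2 * s * e) := by
              refine (setIntegral_mono_set iT (Filter.Eventually.of_forall fun z => by positivity)
                (hθr.trans hr4).eventuallyLE).trans (hT.trans ?_)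
              have : 0 ≤ ∫ z, ‖f z‖ ^ 2 := integral_nonneg fun z => by positivity
              gcongr
            have h2 : ∫ z in ball a (θ * r), χ z ^ 2 ≤ e :=
              (setIntegral_mono_set (hcl0 _ (hχ.continuous.pow 2))
                (Filter.Eventually.of_forall fun z => sq_nonneg _)
                ((hθr.trans hr4).trans hsub).eventuallyLE).trans hχi
            gcongr
    unfold nn
    have hpos : 0 < (θ * r) ^ 2 := by positivity
    rw [inv_mul_le_iff₀ hpos]
    refine hI.trans ?_
    have e2 : 3 * (4 * (1 + MJ) ^ 2 * r ^ 2 * (2 * (K * om) ^ 2 * (C1 * (2 * B ^ 2 * nc + 2 * s * e)) +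
      2 * (1 + MJ) ^ 2 * s * e)) + 3 * q * (Real.pi * (θ * r) ^ 2) + 3 * s * e =
      (θ * r) ^ 2 * ((192 * Real.pi * (1 + MJ) ^ 4 * B ^ 2) * κ * nv +
        (48 * (1 + MJ) ^ 2 * K ^ 2 * C1 * B ^ 2) * (θ ^ 2)⁻¹ * om ^ 2 * nc + e * Q) := by
      rw [hq, hQ]; field_simp; ring
    rw [e2]
    have hpi := Real.pi_pos
    have k1 : 192 * Real.pi * (1 + MJ) ^ 4 * B ^ 2 ≤ 48 * (1 + MJ) ^ 2 * K ^ 2 * C1 * B ^ 2 +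
        192 * Real.pi * (1 + MJ) ^ 4 * B ^ 2 + 1 := by
      have : 0 ≤ 48 * (1 + MJ) ^ 2 * K ^ 2 * C1 * B ^ 2 := by positivity
      linarith
    have k2 : 48 * (1 + MJ) ^ 2 * K ^ 2 * C1 * B ^ 2 ≤ 48 * (1 + MJ) ^ 2 * K ^ 2 * C1 * B ^ 2 +
        192 * Real.pi * (1 + MJ) ^ 4 * B ^ 2 + 1 := by
      have : 0 ≤ 192 * Real.pi * (1 + MJ) ^ 4 * B ^ 2 := by positivity
      linarith
    gcongr
  obtain ⟨b, hb2⟩ := TT_far A hA g a r hr cg zg zg2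
  have hG0 : 0 ≤ ∫ z, ‖g z‖ ^ 2 := integral_nonneg fun z => by positivity
  have hza : ∀ z ∈ ball a (θ * r), ‖z - a‖ ≤ θ * r := by
    intro z hz
    rw [mem_ball, dist_eq_norm] at hz
    exact hz.le
  constructor
  · refine ⟨α + TT A g a, β + b, ?_⟩
    have := key (fun z => TT A g a + cmul A (z - a) b) (θ ^ 4) (by positivity) ?_
    · convert this using 2
      funext z
      simp only [aff, map_add]; abel
    · intro z hz
      refine (hb2 z (hθr hz)).2.trans ?_
      have h1 : ‖z - a‖ ^ 4 * (r ^ 4)⁻¹ ≤ θ ^ 4 := by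
        rw [mul_inv_le_iff₀ (by positivity), ← mul_pow]
        have := hza z hz
        gcongr
      calc _ = 64 * (1 + ‖A‖) ^ 2 * (‖z - a‖ ^ 4 * (r ^ 4)⁻¹) * ∫ z, ‖g z‖ ^ 2 := by ring
        _ ≤ _ := by gcongr
  · refine ⟨α + TT A g a, ?_⟩
    have := key (fun z => TT A g a) (θ ^ 2) (by positivity) ?_
    · convert this using 2
      funext z
      simp only [aff]; abel
    · intro z hz
      refine (hb2 z (hθr hz)).1.trans ?_
      have h1 : ‖z - a‖ ^ 2 * (r ^ 2)⁻¹ ≤ θ ^ 2 := by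
        rw [mul_inv_le_iff₀ (by positivity), ← mul_pow]
        have := hza z hz
        gcongr
      calc _ = 64 * (1 + ‖A‖) ^ 2 * (‖z - a‖ ^ 2 * (r ^ 2)⁻¹) * ∫ z, ‖g z‖ ^ 2 := by ring
        _ ≤ _ := by gcongr

end S

end Part12

section Part13
open MeasureTheory Metric Set
open scoped ENNReal ContDiff

section S
variable {W : Type*} [NormedAddCommGroup W] [NormedSpace ℝ W]

lemma center_le (f : ℂ → W) (hf : Continuous f) (p : ℂ) (ρ : ℝ) (hρ : 0 ≤ ρ)
    (hm : ∀ t, f (p + t) + f (p - t) = (2 : ℝ) • f p) :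
    Real.pi * ρ ^ 2 * ‖f p‖ ^ 2 ≤ ∫ z in ball p ρ, ‖f z‖ ^ 2 := by
  have i1 : IntegrableOn (fun z => ‖f z‖ ^ 2) (ball p ρ) :=
    ((hf.norm.pow 2).continuousOn.integrableOn_compact (isCompact_closedBall p ρ)).mono_set
      ball_subset_closedBall
  have c2 : Continuous fun z => f (2 * p - z) := hf.comp (by fun_prop)
  have i2 : IntegrableOn (fun z => ‖f (2 * p - z)‖ ^ 2) (ball p ρ) :=
    ((c2.norm.pow 2).continuousOn.integrableOn_compact (isCompact_closedBall p ρ)).mono_set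
      ball_subset_closedBall
  have e1 : ∫ z in ball p ρ, ‖f (2 * p - z)‖ ^ 2 = ∫ z in ball p ρ, ‖f z‖ ^ 2 := by
    rw [← integral_indicator measurableSet_ball, ← integral_indicator measurableSet_ball,
      ← integral_sub_left_eq_self ((ball p ρ).indicator fun z => ‖f z‖ ^ 2) volume (2 * p)]
    congr 1
    funext z
    by_cases hz : z ∈ ball p ρ
    · rw [indicator_of_mem hz, indicator_of_mem]
      rw [mem_ball, dist_eq_norm] at hz ⊢
      have : 2 * p - z - p = -(z - p) := by ring
      rwa [this, norm_neg]
    · rw [indicator_of_notMem hz, indicator_of_notMem]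
      intro h
      apply hz
      rw [mem_ball, dist_eq_norm] at h ⊢
      have : 2 * p - z - p = -(z - p) := by ring
      rwa [this, norm_neg] at h
  have i3 : IntegrableOn (fun z => 2⁻¹ * ‖f z‖ ^ 2 + 2⁻¹ * ‖f (2 * p - z)‖ ^ 2) (ball p ρ) :=
    (i1.const_mul _).add (i2.const_mul _)
  calc Real.pi * ρ ^ 2 * ‖f p‖ ^ 2 = ∫ z in ball p ρ, ‖f p‖ ^ 2 := by
        rw [setIntegral_const, vol_ball p ρ hρ, smul_eq_mul]
    _ ≤ ∫ z in ball p ρ, (2⁻¹ * ‖f z‖ ^ 2 + 2⁻¹ * ‖f (2 * p - z)‖ ^ 2) := by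
        apply setInt_le measurableSet_ball (fun z _ => by positivity) i3
        intro z _
        have h1 := hm (z - p)
        have h2 : p + (z - p) = z := by ring
        have h3 : p - (z - p) = 2 * p - z := by ring
        rw [h2, h3] at h1
        have h4 := norm_add_sq_le (f z) (f (2 * p - z))
        rw [h1, norm_smul, mul_pow] at h4
        norm_num at h4
        linarith
    _ = _ := by
        rw [integral_add (i1.const_mul _) (i2.const_mul _), integral_const_mul, integral_const_mul, e1]
        ring

/-- real affine map -/
noncomputable def raff (a : ℂ) (p : W) (L : ℂ →L[ℝ] W) (z : ℂ) : W := p + L (z - a)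

lemma raff_cont (a : ℂ) (p : W) (L : ℂ →L[ℝ] W) : Continuous (raff a p L) := by
  unfold raff; fun_prop

lemma compare (u : ℂ → W) (z0 : ℂ) (R : ℝ) (hu : ContinuousOn u (closedBall z0 R))
    (a b : ℂ) (r s : ℝ) (hr : 0 < r) (hs : 0 < s) (ha : ball a r ⊆ ball z0 R)
    (hb : ball b s ⊆ ball z0 R) (p : ℂ) (ρ : ℝ) (hρ : 0 < ρ) (hpa : ball p ρ ⊆ ball a r)
    (hpb : ball p ρ ⊆ ball b s) (a' b' : ℂ) (q q' : W) (L L' : ℂ →L[ℝ] W) (X Y : ℝ)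
    (hX : nn u a r (raff a' q L) ≤ X) (hY : nn u b s (raff b' q' L') ≤ Y) :
    ‖raff a' q L p - raff b' q' L' p‖ ^ 2 ≤ (r / ρ) ^ 2 * X + (s / ρ) ^ 2 * Y := by
  have h1 := center_le (fun z => raff a' q L z - raff b' q' L' z)
    ((raff_cont _ _ _).sub (raff_cont _ _ _)) p ρ hρ.le (by
      intro t
      simp only [raff]
      have e1 : ∀ c : ℂ, p + t - c = (p - c) + t := fun c => by ring
      have e2 : ∀ c : ℂ, p - t - c = (p - c) - t := fun c => by ring
      simp only [e1, e2, map_add L, map_add L', map_sub L _ t, map_sub L' _ t]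
      module)
  have hcl : ∀ f : ℂ → ℝ, ContinuousOn f (closedBall z0 R) → IntegrableOn f (ball z0 R) := by
    intro f hf
    exact (hf.integrableOn_compact (isCompact_closedBall z0 R)).mono_set ball_subset_closedBall
  have iX := hcl _ ((hu.sub (raff_cont a' q L).continuousOn).norm.pow 2)
  have iY := hcl _ ((hu.sub (raff_cont b' q' L').continuousOn).norm.pow 2)
  have iX' : IntegrableOn (fun z => 2 * ‖u z - raff a' q L z‖ ^ 2) (ball p ρ) :=
    (iX.mono_set (hpa.trans ha)).const_mul 2
  have iY' : IntegrableOn (fun z => 2 * ‖u z - raff b' q' L' z‖ ^ 2) (ball p ρ) :=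
    (iY.mono_set (hpb.trans hb)).const_mul 2
  have i3 : IntegrableOn (fun z => 2 * ‖u z - raff a' q L z‖ ^ 2 + 2 * ‖u z - raff b' q' L' z‖ ^ 2)
    (ball p ρ) := iX'.add iY'
  have h2 : ∫ z in ball p ρ, ‖raff a' q L z - raff b' q' L' z‖ ^ 2 ≤
      2 * (r ^ 2 * X) + 2 * (s ^ 2 * Y) := by
    calc _ ≤ ∫ z in ball p ρ, (2 * ‖u z - raff a' q L z‖ ^ 2 + 2 * ‖u z - raff b' q' L' z‖ ^ 2) := by
          apply setInt_le measurableSet_ball (fun z _ => by positivity) i3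
          intro z _
          have : raff a' q L z - raff b' q' L' z =
            (u z - raff b' q' L' z) + -(u z - raff a' q L z) := by abel
          rw [this]
          refine (norm_add_sq_le _ _).trans ?_
          rw [norm_neg]; linarith
      _ ≤ _ := by
          rw [integral_add iX' iY', integral_const_mul, integral_const_mul]
          have k1 : ∫ z in ball p ρ, ‖u z - raff a' q L z‖ ^ 2 ≤ r ^ 2 * X := by
            refine (setIntegral_mono_set (iX.mono_set ha)
              (Filter.Eventually.of_forall fun z => sq_nonneg _) hpa.eventuallyLE).trans ?_
            unfold nn at hX
            rwa [inv_mul_le_iff₀ (by positivity)] at hX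
          have k2 : ∫ z in ball p ρ, ‖u z - raff b' q' L' z‖ ^ 2 ≤ s ^ 2 * Y := by
            refine (setIntegral_mono_set (iY.mono_set hb)
              (Filter.Eventually.of_forall fun z => sq_nonneg _) hpb.eventuallyLE).trans ?_
            unfold nn at hY
            rwa [inv_mul_le_iff₀ (by positivity)] at hY
          gcongr
  have h3 := h1.trans h2
  have h4 : 0 ≤ ‖raff a' q L p - raff b' q' L' p‖ ^ 2 := by positivity
  have h5 : 2 * (ρ ^ 2 * ‖raff a' q L p - raff b' q' L' p‖ ^ 2) ≤
      2 * (r ^ 2 * X) + 2 * (s ^ 2 * Y) := by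
    refine le_trans ?_ h3
    rw [mul_assoc]
    gcongr
    linarith [Real.pi_gt_three]
  rw [div_pow, div_pow, div_mul_eq_mul_div, div_mul_eq_mul_div, ← add_div, le_div_iff₀ (by positivity)]
  linarith

lemma slope_bound (b : ℂ) (q : W) (L : ℂ →L[ℝ] W) (ρ N : ℝ) (hρ : 0 < ρ) (hN : 0 ≤ N)
    (h : ∀ p ∈ ball b ρ, ‖q + L (p - b)‖ ≤ N) : ‖L‖ ≤ 4 * N / ρ := by
  apply L.opNorm_le_bound (by positivity)
  intro w
  by_cases hw : w = 0
  · simp [hw]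
  have hw' : 0 < ‖w‖ := norm_pos_iff.2 hw
  set t : ℝ := ρ / (2 * ‖w‖) with ht
  have ht0 : 0 < t := by positivity
  have h1 := h (b + t • w) (by
    rw [mem_ball, dist_eq_norm, add_sub_cancel_left, norm_smul, Real.norm_eq_abs, abs_of_pos ht0, ht]
    field_simp; linarith)
  have h2 := h b (mem_ball_self hρ)
  rw [add_sub_cancel_left, map_smul] at h1
  rw [sub_self, map_zero, add_zero] at h2
  have h3 : ‖t • L w‖ ≤ 2 * N := by
    have : t • L w = (q + t • L w) - q := by abel
    rw [this]
    exact (norm_sub_le _ _).trans (by linarith)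
  rw [norm_smul, Real.norm_eq_abs, abs_of_pos ht0, ht] at h3
  rw [div_mul_eq_mul_div, div_le_iff₀ (by positivity)] at h3
  rw [div_mul_eq_mul_div, le_div_iff₀ hρ]
  linarith

end S

end Part13

section Part14
open MeasureTheory Metric Set
open scoped ENNReal ContDiff

section S
variable {W : Type*} [NormedAddCommGroup W] [NormedSpace ℝ W]

/-- Campanato data -/
structure Camp (u : ℂ → W) (z0 : ℂ) (R : ℝ) (S : Set ℂ) (r0 θ q M : ℝ) (p : ℂ → ℕ → W)
    (L : ℂ → ℕ → ℂ →L[ℝ] W) : Prop where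
  hu : ContinuousOn u (closedBall z0 R)
  hr0 : 0 < r0
  hS : ∀ a ∈ S, ball a r0 ⊆ ball z0 R
  hθ : 0 < θ
  hθ1 : θ < 1
  hq : 0 < q
  hq1 : q < 1
  hM : 0 ≤ M
  hn : ∀ a ∈ S, ∀ k, nn u a (θ ^ k * r0) (raff a (p a k) (L a k)) ≤ (M * q ^ k) ^ 2

variable {u : ℂ → W} {z0 : ℂ} {R : ℝ} {S : Set ℂ} {r0 θ q M : ℝ} {p : ℂ → ℕ → W}
    {L : ℂ → ℕ → ℂ →L[ℝ] W}

lemma Camp.sub (H : Camp u z0 R S r0 θ q M p L) (a : ℂ) (ha : a ∈ S) (k : ℕ) :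
    ball a (θ ^ k * r0) ⊆ ball z0 R := by
  refine Subset.trans (ball_subset_ball ?_) (H.hS a ha)
  have : θ ^ k ≤ 1 := pow_le_one₀ H.hθ.le H.hθ1.le
  nlinarith [H.hr0]

lemma Camp.rpos (H : Camp u z0 R S r0 θ q M p L) (k : ℕ) : 0 < θ ^ k * r0 := by
  have := H.hθ
  have := H.hr0
  positivity

/-- comparison of consecutive scales -/
lemma Camp.consec (H : Camp u z0 R S r0 θ q M p L) (a : ℂ) (ha : a ∈ S) (k : ℕ) (x : ℂ)
    (hx : x ∈ ball a (θ ^ (k + 1) * r0 / 2)) :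
    ‖raff a (p a k) (L a k) x - raff a (p a (k + 1)) (L a (k + 1)) x‖ ≤ 4 * M / θ * q ^ k := by
  have h1 := H.rpos k
  have h2 := H.rpos (k + 1)
  have hθ := H.hθ
  have hθ1 := H.hθ1
  have hq := H.hq
  have hM := H.hM
  have hr0 := H.hr0
  rw [mem_ball] at hx
  have e : θ ^ (k + 1) * r0 = θ * (θ ^ k * r0) := by ring
  have s1 : ball x (θ ^ (k + 1) * r0 / 2) ⊆ ball a (θ ^ (k + 1) * r0) :=
    ball_subset_ball' (by linarith)
  have s2 : ball a (θ ^ (k + 1) * r0) ⊆ ball a (θ ^ k * r0) := ball_subset_ball (by rw [e]; nlinarith)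
  have h := compare u z0 R H.hu a a _ _ h1 h2 (H.sub a ha k) (H.sub a ha (k + 1)) x _
    (by positivity : 0 < θ ^ (k + 1) * r0 / 2) (s1.trans s2) s1 a a _ _ _ _ _ _
    (H.hn a ha k) (H.hn a ha (k + 1))
  have e1 : θ ^ k * r0 / (θ ^ (k + 1) * r0 / 2) = 2 / θ := by rw [e]; field_simp
  have e2 : θ ^ (k + 1) * r0 / (θ ^ (k + 1) * r0 / 2) = 2 := by field_simp
  rw [e1, e2] at h
  apply le_of_sq_le_sq _ (by positivity)
  refine h.trans ?_
  have h3 : (M * q ^ (k + 1)) ^ 2 ≤ (M * q ^ k) ^ 2 := by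
    have : q ^ (k + 1) ≤ q ^ k := pow_le_pow_of_le_one hq.le H.hq1.le (by omega)
    gcongr
  have h4 : (2 : ℝ) ≤ 2 / θ := by rw [le_div_iff₀ hθ]; linarith
  calc (2 / θ) ^ 2 * (M * q ^ k) ^ 2 + 2 ^ 2 * (M * q ^ (k + 1)) ^ 2
      ≤ (2 / θ) ^ 2 * (M * q ^ k) ^ 2 + (2 / θ) ^ 2 * (M * q ^ k) ^ 2 := by gcongr
    _ ≤ (2 / θ) ^ 2 * (M * q ^ k) ^ 2 + 3 * ((2 / θ) ^ 2 * (M * q ^ k) ^ 2) := by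
        have : 0 ≤ (2 / θ) ^ 2 * (M * q ^ k) ^ 2 := by positivity
        linarith
    _ = _ := by field_simp; ring

/-- comparison of two centres -/
lemma Camp.centres (H : Camp u z0 R S r0 θ q M p L) (a : ℂ) (ha : a ∈ S) (b : ℂ) (hb : b ∈ S) (k : ℕ)
    (hab : dist b a ≤ θ ^ k * r0 / 2) (x : ℂ) (hx : x ∈ ball b (θ ^ k * r0 / 4)) :
    ‖raff a (p a k) (L a k) x - raff b (p b k) (L b k) x‖ ≤ 6 * M * q ^ k := by
  have h1 := H.rpos k
  have hM := H.hM
  have hq := H.hq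
  rw [mem_ball] at hx
  have s1 : ball x (θ ^ k * r0 / 4) ⊆ ball b (θ ^ k * r0) := ball_subset_ball' (by linarith)
  have s2 : ball x (θ ^ k * r0 / 4) ⊆ ball a (θ ^ k * r0) :=
    ball_subset_ball' (by linarith [dist_triangle x b a])
  have h := compare u z0 R H.hu a b _ _ h1 h1 (H.sub a ha k) (H.sub b hb k) x _
    (by positivity : 0 < θ ^ k * r0 / 4) s2 s1 a b _ _ _ _ _ _ (H.hn a ha k) (H.hn b hb k)
  have hθ := H.hθ
  have hr0 := H.hr0
  have e2 : θ ^ k * r0 / (θ ^ k * r0 / 4) = 4 := by field_simp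
  rw [e2] at h
  apply le_of_sq_le_sq _ (by positivity)
  refine h.trans ?_
  nlinarith [sq_nonneg (M * q ^ k)]

lemma Camp.tendsto (H : Camp u z0 R S r0 θ q M p L) (a : ℂ) (ha : a ∈ S) :
    Filter.Tendsto (p a) Filter.atTop (nhds (u a)) := by
  rw [Metric.tendsto_atTop]
  intro ε hε
  have haR : a ∈ ball z0 R := H.hS a ha (mem_ball_self H.hr0)
  have hc : ContinuousAt u a := H.hu.continuousAt (closedBall_mem_nhds_of_mem haR)
  obtain ⟨δ, hδ, hδu⟩ := Metric.continuousAt_iff.1 hc (ε / 4) (by positivity)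
  have t1 : Filter.Tendsto (fun k : ℕ => θ ^ k * r0) Filter.atTop (nhds 0) := by
    simpa using (tendsto_pow_atTop_nhds_zero_of_lt_one H.hθ.le H.hθ1).mul_const r0
  have t2 : Filter.Tendsto (fun k : ℕ => M * q ^ k) Filter.atTop (nhds 0) := by
    simpa using (tendsto_pow_atTop_nhds_zero_of_lt_one H.hq.le H.hq1).const_mul M
  obtain ⟨N, hN⟩ := Filter.eventually_atTop.1
    ((t1.eventually_lt_const hδ).and (t2.eventually_lt_const (by positivity : (0:ℝ) < ε / 2)))
  refine ⟨N, fun k hk => ?_⟩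
  obtain ⟨k1, k2⟩ := hN k hk
  have h1 := H.rpos k
  have hb : nn u a (θ ^ k * r0) (raff a (u a) 0) ≤ Real.pi * (ε / 4) ^ 2 := by
    unfold nn
    rw [inv_mul_le_iff₀ (by positivity)]
    have hc : ∫ z in ball a (θ ^ k * r0), ‖u z - raff a (u a) 0 z‖ ^ 2 ≤
        ∫ z in ball a (θ ^ k * r0), (ε / 4) ^ 2 := by
      apply setInt_le measurableSet_ball (fun z _ => by positivity)
      · exact integrableOn_const (measure_ball_lt_top.ne) enorm_ne_top
      · intro z hz
        have := hδu (lt_trans (mem_ball.1 hz) k1)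
        rw [dist_eq_norm] at this
        simp only [raff, zero_apply, add_zero]
        gcongr
    rw [setIntegral_const, vol_ball a _ h1.le, smul_eq_mul] at hc
    refine hc.trans (le_of_eq ?_)
    ring
  have h := compare u z0 R H.hu a a _ _ h1 h1 (H.sub a ha k) (H.sub a ha k) a _ h1 subset_rfl subset_rfl
    a a _ _ _ _ _ _ (H.hn a ha k) hb
  rw [div_self h1.ne'] at h
  simp only [raff, sub_self, map_zero, add_zero, one_pow, one_mul] at h
  rw [dist_eq_norm]
  have h3 : (M * q ^ k) ^ 2 < (ε / 2) ^ 2 := by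
    have : 0 ≤ M * q ^ k := mul_nonneg H.hM (pow_nonneg H.hq.le k)
    gcongr
  apply lt_of_pow_lt_pow_left₀ 2 hε.le
  nlinarith [Real.pi_lt_four, sq_nonneg ε]

lemma Camp.pt (H : Camp u z0 R S r0 θ q M p L) :
    ∃ C : ℝ, 0 ≤ C ∧ ∀ a ∈ S, ∀ b ∈ S, ∀ k, dist b a ≤ θ ^ k * r0 / 2 →
      ‖u b - raff a (p a k) (L a k) b‖ ≤ C * q ^ k := by
  have hθ := H.hθ
  have hq := H.hq
  have hq1 := H.hq1
  have hM := H.hM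
  have hq1' : 0 < 1 - q := by linarith
  refine ⟨4 * M / θ / (1 - q) + 6 * M, by positivity, ?_⟩
  intro a ha b hb k hab
  have h1 := H.centres a ha b hb k hab b (mem_ball_self (by have := H.rpos k; positivity))
  have h2 := dist_le_of_le_geometric_of_tendsto q (4 * M / θ) H.hq1 (f := p b) (a := u b) (by
    intro k
    have := H.consec b hb k b (mem_ball_self (by have := H.rpos (k + 1); positivity))
    simpa [raff, dist_eq_norm] using this) (H.tendsto b hb) k
  rw [dist_eq_norm] at h2
  simp only [raff, sub_self, map_zero, add_zero] at h1 ⊢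
  have : u b - (p a k + L a k (b - a)) = -(p b k - u b) + -(p a k + L a k (b - a) - p b k) := by abel
  rw [this]
  refine (norm_add_le _ _).trans ?_
  rw [norm_neg, norm_neg, add_mul]
  refine add_le_add (h2.trans (le_of_eq ?_)) h1
  ring

end S

end Part14

section Part15
open MeasureTheory Metric Set
open scoped ENNReal ContDiff

section S
variable {W : Type*} [NormedAddCommGroup W] [NormedSpace ℝ W]
variable {u : ℂ → W} {z0 : ℂ} {R : ℝ} {S : Set ℂ} {r0 θ q M : ℝ} {p : ℂ → ℕ → W}
    {L : ℂ → ℕ → ℂ →L[ℝ] W}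

lemma raff_sub_bound (a b : ℂ) (q q' : W) (L L' : ℂ →L[ℝ] W) (ρ N : ℝ) (hρ : 0 < ρ) (hN : 0 ≤ N)
    (h : ∀ x ∈ ball b ρ, ‖raff a q L x - raff b q' L' x‖ ≤ N) : ‖L - L'‖ ≤ 4 * N / ρ := by
  apply slope_bound b (q + L (b - a) - q') (L - L') ρ N hρ hN
  intro x hx
  have := h x hx
  have e : raff a q L x - raff b q' L' x = q + L (b - a) - q' + (L - L') (x - b) := by
    simp only [raff, sub_apply]
    have : x - a = (b - a) + (x - b) := by ring
    rw [this, map_add]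
    abel
  rwa [← e]

lemma Camp.c1 [CompleteSpace W] (τ : ℝ) (hτ : 0 < τ) (hτ1 : τ < 1) (hqt : q = θ * τ)
    (hSo : IsOpen S) (H : Camp u z0 R S r0 θ q M p L) :
    ∃ D : ℂ → ℂ →L[ℝ] W, (∀ a ∈ S, HasFDerivAt u (D a) a) ∧ ContinuousOn D S ∧
      ∀ a ∈ S, Filter.Tendsto (L a) Filter.atTop (nhds (D a)) := by
  have hθ := H.hθ
  have hθ1 := H.hθ1
  have hq := H.hq
  have hM := H.hM
  have hr0 := H.hr0
  have hτ' : 0 < 1 - τ := by linarith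
  have hqk : ∀ k : ℕ, q ^ k = θ ^ k * τ ^ k := by intro k; rw [hqt, mul_pow]
  obtain ⟨C1, hC1⟩ : ∃ C1 : ℝ, C1 = 32 * M / θ ^ 2 / r0 := ⟨_, rfl⟩
  have hC10 : 0 ≤ C1 := by rw [hC1]; positivity
  obtain ⟨C2, hC2⟩ : ∃ C2 : ℝ, C2 = 96 * M / r0 := ⟨_, rfl⟩
  have hC20 : 0 ≤ C2 := by rw [hC2]; positivity
  have k1 : ∀ a ∈ S, ∀ k, dist (L a k) (L a (k + 1)) ≤ C1 * τ ^ k := by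
    intro a ha k
    have hpos := H.rpos (k + 1)
    have := raff_sub_bound a a _ _ _ _ _ _ (by positivity : 0 < θ ^ (k + 1) * r0 / 2)
      (by positivity) (H.consec a ha k)
    rw [dist_eq_norm]
    refine this.trans (le_of_eq ?_)
    rw [hC1, hqk, pow_succ]
    field_simp
    ring
  have k2 : ∀ a ∈ S, ∀ b ∈ S, ∀ k, dist b a ≤ θ ^ k * r0 / 2 → dist (L a k) (L b k) ≤ C2 * τ ^ k := by
    intro a ha b hb k hab
    have hpos := H.rpos k
    have := raff_sub_bound a b _ _ _ _ _ _ (by positivity : 0 < θ ^ k * r0 / 4)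
      (by positivity) (H.centres a ha b hb k hab)
    rw [dist_eq_norm]
    refine this.trans (le_of_eq ?_)
    rw [hC2, hqk]
    field_simp
    ring
  have hlim : ∀ a, ∃ l : ℂ →L[ℝ] W, a ∈ S → Filter.Tendsto (L a) Filter.atTop (nhds l) := by
    intro a
    by_cases ha : a ∈ S
    · obtain ⟨l, hl⟩ := cauchySeq_tendsto_of_complete (cauchySeq_of_le_geometric τ C1 hτ1 (k1 a ha))
      exact ⟨l, fun _ => hl⟩
    · exact ⟨0, fun h => absurd h ha⟩
  choose D hD using hlim
  have k3 : ∀ a ∈ S, ∀ k, dist (L a k) (D a) ≤ C1 / (1 - τ) * τ ^ k := by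
    intro a ha k
    refine (dist_le_of_le_geometric_of_tendsto τ C1 hτ1 (k1 a ha) (hD a ha) k).trans (le_of_eq ?_)
    ring
  obtain ⟨C3, hC3⟩ : ∃ C3 : ℝ, C3 = C1 / (1 - τ) := ⟨_, rfl⟩
  rw [← hC3] at k3
  have hC30 : 0 ≤ C3 := by rw [hC3]; positivity
  obtain ⟨C4, hC40, hpt⟩ := H.pt
  have htau : Filter.Tendsto (fun k : ℕ => τ ^ k) Filter.atTop (nhds 0) :=
    tendsto_pow_atTop_nhds_zero_of_lt_one hτ.le hτ1
  have hsmall : ∀ c : ℝ, ∀ ε > 0, ∃ N : ℕ, c * τ ^ N < ε := by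
    intro c ε hε
    have : Filter.Tendsto (fun k : ℕ => c * τ ^ k) Filter.atTop (nhds 0) := by
      simpa using htau.const_mul c
    exact (this.eventually_lt_const hε).exists
  refine ⟨D, ?_, ?_, hD⟩
  · intro a ha
    -- main estimate
    have hmain : ∀ b ∈ S, ∀ k, dist b a ≤ θ ^ k * r0 / 2 →
        ‖u b - u a - D a (b - a)‖ ≤ (2 * C4 + C3 * r0) * q ^ k := by
      intro b hb k hab
      have h1 := hpt a ha b hb k hab
      have hpos := H.rpos k
      have h2 := hpt a ha a ha k (by rw [dist_self]; positivity)
      have h3 : ‖(L a k - D a) (b - a)‖ ≤ C3 * r0 * q ^ k := by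
        refine ((L a k - D a).le_opNorm _).trans ?_
        have h4 := k3 a ha k
        rw [dist_eq_norm] at h4 hab
        calc ‖L a k - D a‖ * ‖b - a‖ ≤ (C3 * τ ^ k) * (θ ^ k * r0) := by
              gcongr
              linarith
          _ = _ := by rw [hqk]; ring
      have e : u b - u a - D a (b - a) = (u b - raff a (p a k) (L a k) b) +
          -(u a - raff a (p a k) (L a k) a) + (L a k - D a) (b - a) := by
        simp only [raff, sub_apply, sub_self, map_zero, add_zero]
        abel
      rw [e]
      refine (norm_add₃_le).trans ?_
      rw [norm_neg]
      linarith
    obtain ⟨C5, hC5⟩ : ∃ C5 : ℝ, C5 = 2 * C4 + C3 * r0 := ⟨_, rfl⟩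
    rw [← hC5] at hmain
    have hC50 : 0 ≤ C5 := by rw [hC5]; positivity
    rw [hasFDerivAt_iff_isLittleO, Asymptotics.isLittleO_iff]
    intro ε hε
    obtain ⟨N, hN⟩ := hsmall (C5 * (2 / (θ * r0))) ε hε
    filter_upwards [hSo.mem_nhds ha, ball_mem_nhds a (by have := H.rpos N; positivity :
      0 < θ ^ N * r0 / 2)] with b hb hbN
    by_cases hba : b = a
    · simp [hba]
    have hd : 0 < dist b a := dist_pos.2 hba
    rw [mem_ball] at hbN
    have hN1 : θ ^ N ≤ 1 := pow_le_one₀ hθ.le hθ1.le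
    have hxN : 2 * dist b a / r0 < θ ^ N := by rw [div_lt_iff₀ hr0]; linarith
    obtain ⟨n, hn1, hn2⟩ := exists_nat_pow_near_of_lt_one (x := 2 * dist b a / r0) (y := θ)
      (by positivity) (by linarith) hθ hθ1
    have hnN : N ≤ n := by
      by_contra hcon
      have : θ ^ N ≤ θ ^ (n + 1) := pow_le_pow_of_le_one hθ.le hθ1.le (by omega)
      linarith
    have h1 := hmain b hb n (by rw [div_le_iff₀ hr0] at hn2; linarith)
    refine h1.trans ?_
    have h2 : τ ^ n ≤ τ ^ N := pow_le_pow_of_le_one hτ.le hτ1.le hnN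
    have h3 : θ ^ n ≤ 2 / (θ * r0) * ‖b - a‖ := by
      rw [← dist_eq_norm, div_mul_eq_mul_div, le_div_iff₀ (by positivity)]
      rw [lt_div_iff₀ hr0, pow_succ] at hn1
      linarith
    calc C5 * q ^ n = C5 * (θ ^ n * τ ^ n) := by rw [hqk]
      _ ≤ C5 * ((2 / (θ * r0) * ‖b - a‖) * τ ^ N) := by gcongr
      _ = (C5 * (2 / (θ * r0)) * τ ^ N) * ‖b - a‖ := by ring
      _ ≤ _ := by gcongr
  · rw [Metric.continuousOn_iff]
    intro a ha ε hε
    obtain ⟨N, hN⟩ := hsmall (2 * C3 + C2) ε hε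
    refine ⟨θ ^ N * r0 / 2, by have := H.rpos N; positivity, ?_⟩
    intro b hb hab
    have h1 := k3 a ha N
    have h2 := k3 b hb N
    have h3 := k2 a ha b hb N hab.le
    calc dist (D b) (D a) ≤ dist (D b) (L b N) + dist (L b N) (L a N) + dist (L a N) (D a) :=
          dist_triangle4 _ _ _ _
      _ ≤ C3 * τ ^ N + C2 * τ ^ N + C3 * τ ^ N := by
          rw [dist_comm] at h2 h3
          exact add_le_add (add_le_add h2 h3) h1
      _ < ε := by linarith

end S

end Part15

section Part16
open MeasureTheory Metric Set
open scoped ENNReal ContDiff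

section S
variable {W : Type*} [NormedAddCommGroup W] [NormedSpace ℝ W]

/-- linear part -/
noncomputable def lin (A : W →L[ℝ] W) (β : W) : ℂ →L[ℝ] W :=
  Complex.reCLM.smulRight β + Complex.imCLM.smulRight (A β)

lemma aff_eq_raff (A : W →L[ℝ] W) (a : ℂ) (α β : W) : aff A a α β = raff a α (lin A β) := by
  funext z
  simp [aff, raff, lin, cmul_apply]

lemma lin_zero (A : W →L[ℝ] W) : lin A 0 = 0 := by
  ext; simp [lin]

lemma lin_I (A : W →L[ℝ] W) (β : W) : lin A β Complex.I = A (lin A β 1) := by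
  simp [lin]

lemma nn_const_le (u : ℂ → W) (a : ℂ) (r N : ℝ) (hr : 0 < r) (c : W)
    (h : ∀ z ∈ ball a r, ‖u z - c‖ ≤ N) : nn u a r (fun _ => c) ≤ Real.pi * N ^ 2 := by
  unfold nn
  rw [inv_mul_le_iff₀ (by positivity)]
  have hc : ∫ z in ball a r, ‖u z - c‖ ^ 2 ≤ ∫ z in ball a r, N ^ 2 := by
    apply setInt_le measurableSet_ball (fun z _ => by positivity)
    · exact integrableOn_const (measure_ball_lt_top.ne) enorm_ne_top
    · intro z hz
      have := h z hz
      gcongr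
  rw [setIntegral_const, vol_ball a _ hr.le, smul_eq_mul] at hc
  refine hc.trans (le_of_eq ?_)
  ring

lemma raff_const (a : ℂ) (c : W) : raff a c (0 : ℂ →L[ℝ] W) = fun _ => c := by
  funext z; simp [raff]

set_option maxHeartbeats 1600000 in
lemma local_reg [CompleteSpace W] (MJ K C1 : ℝ) (hMJ0 : 0 ≤ MJ) (hK0 : 0 ≤ K) (hC10 : 0 ≤ C1) :
    ∃ om0 : ℝ, 0 < om0 ∧ ∀ (E : Set ℂ) (z0 : ℂ) (R : ℝ) (u : ℂ → W) (JJ : ℂ → W →L[ℝ] W),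
      LocSetup MJ K C1 E z0 R u JJ →
      (∀ z ∈ ball z0 R, ∀ z' ∈ ball z0 R, ‖u z - u z'‖ ≤ om0) →
      ∃ D : ℂ → ℂ →L[ℝ] W, (∀ a ∈ ball z0 (R / 4), HasFDerivAt u (D a) a ∧
        D a Complex.I = JJ a (D a 1)) ∧ ContinuousOn D (ball z0 (R / 4)) := by
  obtain ⟨C, hC, hstep⟩ := step_est (W := W) MJ K C1 hMJ0 hK0 hC10
  obtain ⟨τ, hτ, hτ2, hCτ⟩ : ∃ τ : ℝ, 0 < τ ∧ τ ≤ 1 / 2 ∧ C * τ ^ 2 ≤ 1 / 3 := by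
    refine ⟨1 / (3 * C + 2), by positivity, ?_, ?_⟩
    · rw [div_le_div_iff₀ (by positivity) (by norm_num)]; linarith
    · rw [div_pow, mul_div_assoc', div_le_div_iff₀ (by positivity) (by norm_num)]
      nlinarith
  have hτ1 : τ < 1 := by linarith
  have hθ4 : τ ^ 4 ≤ 1 / 4 := by
    have : τ ^ 4 ≤ (1 / 2) ^ 4 := by gcongr
    norm_num at this; linarith
  have hθ0 : 0 < τ ^ 4 := by positivity
  obtain ⟨om0, hom0, hom⟩ : ∃ om0 : ℝ, 0 < om0 ∧ C * ((τ ^ 4) ^ 2)⁻¹ * om0 ^ 2 ≤ τ ^ 6 / 3 := by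
    set c := C * ((τ ^ 4) ^ 2)⁻¹ with hc
    have hc0 : 0 < c := by positivity
    refine ⟨Real.sqrt (τ ^ 6 / 3 / c), by positivity, ?_⟩
    rw [Real.sq_sqrt (by positivity)]
    apply le_of_eq; field_simp
  refine ⟨om0, hom0, ?_⟩
  intro E z0 R u JJ S hosc
  have hR := S.hR
  have hC8 : C * (τ ^ 4) ^ 2 ≤ τ ^ 6 / 3 := by
    have : C * (τ ^ 4) ^ 2 = (C * τ ^ 2) * τ ^ 6 := by ring
    rw [this]
    have h6 : 0 < τ ^ 6 := by positivity
    nlinarith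
  have hC16 : C * (τ ^ 4) ^ 4 ≤ τ ^ 10 / 3 := by
    have : C * (τ ^ 4) ^ 4 = (C * τ ^ 2) * (τ ^ 10 * τ ^ 4) := by ring
    rw [this]
    have h6 : 0 < τ ^ 10 := by positivity
    have h7 : τ ^ 10 * τ ^ 4 ≤ τ ^ 10 := by nlinarith
    have h8 : 0 ≤ τ ^ 10 * τ ^ 4 := by positivity
    nlinarith
  -- phase 1
  have hs1 : ∀ a ∈ ball z0 (R / 2), ball a (R / 2) ⊆ ball z0 R := by
    intro a ha
    rw [mem_ball] at ha
    exact ball_subset_ball' (by linarith)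
  have hpow : ∀ k, ((τ ^ 4) ^ k) ≤ 1 := fun k => pow_le_one₀ hθ0.le (by linarith)
  have hs1k : ∀ a ∈ ball z0 (R / 2), ∀ k : ℕ, ball a ((τ ^ 4) ^ k * (R / 2)) ⊆ ball z0 R := by
    intro a ha k
    refine Subset.trans (ball_subset_ball ?_) (hs1 a ha)
    have := hpow k
    nlinarith
  obtain ⟨M1, hM1d⟩ : ∃ M1 : ℝ, M1 = Real.pi * om0 ^ 2 := ⟨_, rfl⟩
  have hM1 : 0 < M1 := by rw [hM1d]; positivity
  have ph1 : ∀ a ∈ ball z0 (R / 2), ∀ k : ℕ, ∃ α : W,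
      nn u a ((τ ^ 4) ^ k * (R / 2)) (raff a α 0) ≤ M1 * (τ ^ 6) ^ k := by
    intro a ha k
    induction k with
    | zero =>
      refine ⟨u a, ?_⟩
      rw [raff_const]
      simp only [pow_zero, one_mul, mul_one]
      rw [hM1d]
      apply nn_const_le u a _ _ (by positivity)
      intro z hz
      exact hosc z (hs1 a ha hz) a (hs1 a ha (mem_ball_self (by positivity)))
    | succ k ih =>
      obtain ⟨α, hα⟩ := ih
      have hrpos : 0 < (τ ^ 4) ^ k * (R / 2) := by positivity
      obtain ⟨-, α', h⟩ := hstep E z0 R u JJ S a ((τ ^ 4) ^ k * (R / 2)) hrpos (hs1k a ha k) om0 hom0.le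
        (fun z hz => hosc z (hs1k a ha k hz) a (hs1k a ha k (mem_ball_self hrpos))) (τ ^ 4) hθ0 hθ4
        α 0 α (M1 * (τ ^ 6) ^ (k + 1) / 3) (by positivity)
      refine ⟨α', ?_⟩
      rw [aff_eq_raff, aff_eq_raff, lin_zero, raff_const a α] at h
      rw [raff_const a α] at hα
      have e : (τ ^ 4) ^ (k + 1) * (R / 2) = τ ^ 4 * ((τ ^ 4) ^ k * (R / 2)) := by ring
      rw [e]
      refine h.trans ?_
      set x := nn u a ((τ ^ 4) ^ k * (R / 2)) (fun _ => α) with hx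
      have hx0 : 0 ≤ x := by
        rw [hx, nn]
        exact mul_nonneg (by positivity) (integral_nonneg fun z => by positivity)
      calc _ ≤ τ ^ 6 / 3 * x + τ ^ 6 / 3 * x + M1 * (τ ^ 6) ^ (k + 1) / 3 := by gcongr
        _ ≤ τ ^ 6 / 3 * (M1 * (τ ^ 6) ^ k) + τ ^ 6 / 3 * (M1 * (τ ^ 6) ^ k) +
            M1 * (τ ^ 6) ^ (k + 1) / 3 := by gcongr
        _ = _ := by ring
  have ph1' : ∀ a, ∀ k : ℕ, ∃ α : W, a ∈ ball z0 (R / 2) →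
      nn u a ((τ ^ 4) ^ k * (R / 2)) (raff a α 0) ≤ M1 * (τ ^ 6) ^ k := by
    intro a k
    by_cases ha : a ∈ ball z0 (R / 2)
    · obtain ⟨α, h⟩ := ph1 a ha k
      exact ⟨α, fun _ => h⟩
    · exact ⟨0, fun h => absurd h ha⟩
  choose p hp using ph1'
  have camp1 : Camp u z0 R (ball z0 (R / 2)) (R / 2) (τ ^ 4) (τ ^ 3) (Real.sqrt M1) p (fun _ _ => 0) :=
    { hu := S.hu
      hr0 := by positivity
      hS := hs1
      hθ := hθ0
      hθ1 := by linarith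
      hq := by positivity
      hq1 := pow_lt_one₀ hτ.le hτ1 (by norm_num)
      hM := by positivity
      hn := by
        intro a ha k
        refine (hp a k ha).trans (le_of_eq ?_)
        rw [mul_pow, Real.sq_sqrt hM1.le]
        ring }
  obtain ⟨C2, hC20, hpt⟩ := camp1.pt
  have hol : ∀ a ∈ ball z0 (R / 2), ∀ b ∈ ball z0 (R / 2), ∀ k : ℕ,
      dist b a ≤ (τ ^ 4) ^ k * (R / 2) / 2 → ‖u b - u a‖ ≤ 2 * C2 * (τ ^ 3) ^ k := by
    intro a ha b hb k hab
    have h1 := hpt a ha b hb k hab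
    have h2 := hpt a ha a ha k (by rw [dist_self]; positivity)
    simp only [raff, zero_apply, add_zero] at h1 h2
    have e : u b - u a = (u b - p a k) - (u a - p a k) := by abel
    rw [e]
    refine (norm_sub_le _ _).trans ?_
    linarith
  -- phase 2
  have hs2 : ∀ a ∈ ball z0 (R / 4), ball a (R / 4) ⊆ ball z0 (R / 2) := by
    intro a ha
    rw [mem_ball] at ha
    exact ball_subset_ball' (by linarith)
  have hs12 : ball z0 (R / 2) ⊆ ball z0 R := ball_subset_ball (by linarith)
  have hs2k : ∀ a ∈ ball z0 (R / 4), ∀ k : ℕ, ball a ((τ ^ 4) ^ k * (R / 4)) ⊆ ball z0 (R / 2) := by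
    intro a ha k
    refine Subset.trans (ball_subset_ball ?_) (hs2 a ha)
    have := hpow k
    nlinarith
  obtain ⟨N, hN⟩ : ∃ N : ℝ, N = 2 * C2 := ⟨_, rfl⟩
  have hN0 : 0 ≤ N := by rw [hN]; positivity
  rw [← hN] at hol
  obtain ⟨M2, hM2⟩ : ∃ M2 : ℝ, M2 = Real.pi * N ^ 2 +
    3 * (C * ((τ ^ 4) ^ 2)⁻¹ * N ^ 2 * (Real.pi * N ^ 2)) * (τ ^ 10)⁻¹ + 1 := ⟨_, rfl⟩
  have hM20 : 0 < M2 := by rw [hM2]; positivity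
  have hM2a : Real.pi * N ^ 2 ≤ M2 := by
    have : 0 ≤ 3 * (C * ((τ ^ 4) ^ 2)⁻¹ * N ^ 2 * (Real.pi * N ^ 2)) * (τ ^ 10)⁻¹ := by positivity
    linarith
  have hM2b : C * ((τ ^ 4) ^ 2)⁻¹ * N ^ 2 * (Real.pi * N ^ 2) ≤ τ ^ 10 * M2 / 3 := by
    have h1 : 0 ≤ Real.pi * N ^ 2 := by positivity
    have h2 : 3 * (C * ((τ ^ 4) ^ 2)⁻¹ * N ^ 2 * (Real.pi * N ^ 2)) * (τ ^ 10)⁻¹ ≤ M2 := by linarith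
    rw [mul_inv_le_iff₀ (by positivity)] at h2
    linarith
  have ph2 : ∀ a ∈ ball z0 (R / 4), ∀ k : ℕ, ∃ α β : W,
      nn u a ((τ ^ 4) ^ k * (R / 4)) (raff a α (lin (JJ a) β)) ≤ M2 * (τ ^ 10) ^ k := by
    intro a ha k
    have hol' : ∀ k : ℕ, ∀ z ∈ ball a ((τ ^ 4) ^ k * (R / 4)), ‖u z - u a‖ ≤ N * (τ ^ 3) ^ k := by
      intro k z hz
      have hrpos : 0 < (τ ^ 4) ^ k * (R / 4) := by positivity
      refine hol a (hs2k a ha k (mem_ball_self hrpos)) z (hs2k a ha k hz) k ?_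
      rw [mem_ball] at hz
      linarith
    induction k with
    | zero =>
      refine ⟨u a, 0, ?_⟩
      rw [lin_zero, raff_const]
      have h0 := hol' 0
      simp only [pow_zero, one_mul, mul_one] at h0 ⊢
      exact (nn_const_le u a _ _ (by positivity) _ h0).trans hM2a
    | succ k ih =>
      obtain ⟨α, β, hα⟩ := ih
      have hrpos : 0 < (τ ^ 4) ^ k * (R / 4) := by positivity
      obtain ⟨⟨α', β', h⟩, -⟩ := hstep E z0 R u JJ S a ((τ ^ 4) ^ k * (R / 4)) hrpos
        ((hs2k a ha k).trans hs12) (N * (τ ^ 3) ^ k) (by positivity) (hol' k) (τ ^ 4) hθ0 hθ4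
        α β (u a) (M2 * (τ ^ 10) ^ (k + 1) / 3) (by positivity)
      refine ⟨α', β', ?_⟩
      rw [aff_eq_raff, aff_eq_raff] at h
      have e : (τ ^ 4) ^ (k + 1) * (R / 4) = τ ^ 4 * ((τ ^ 4) ^ k * (R / 4)) := by ring
      rw [e]
      refine h.trans ?_
      have hy := nn_const_le u a _ _ hrpos _ (hol' k)
      set y := nn u a ((τ ^ 4) ^ k * (R / 4)) (fun _ => u a) with hyd
      set x := nn u a ((τ ^ 4) ^ k * (R / 4)) (raff a α (lin (JJ a) β)) with hx
      have hx0 : 0 ≤ x := by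
        rw [hx, nn]
        exact mul_nonneg (by positivity) (integral_nonneg fun z => by positivity)
      have h12 : (τ ^ 12) ^ k ≤ (τ ^ 10) ^ k := by
        gcongr ?_ ^ k
        exact pow_le_pow_of_le_one hτ.le hτ1.le (by norm_num)
      have t2 : C * ((τ ^ 4) ^ 2)⁻¹ * (N * (τ ^ 3) ^ k) ^ 2 * y ≤ τ ^ 10 * M2 / 3 * (τ ^ 10) ^ k := by
        calc _ ≤ C * ((τ ^ 4) ^ 2)⁻¹ * (N * (τ ^ 3) ^ k) ^ 2 * (Real.pi * (N * (τ ^ 3) ^ k) ^ 2) := by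
              gcongr
          _ = C * ((τ ^ 4) ^ 2)⁻¹ * N ^ 2 * (Real.pi * N ^ 2) * (τ ^ 12) ^ k := by ring
          _ ≤ τ ^ 10 * M2 / 3 * (τ ^ 10) ^ k := by gcongr
      calc _ ≤ τ ^ 10 / 3 * (M2 * (τ ^ 10) ^ k) + τ ^ 10 * M2 / 3 * (τ ^ 10) ^ k +
            M2 * (τ ^ 10) ^ (k + 1) / 3 := by gcongr
        _ = _ := by ring
  have ph2' : ∀ a, ∀ k : ℕ, ∃ α β : W, a ∈ ball z0 (R / 4) →
      nn u a ((τ ^ 4) ^ k * (R / 4)) (raff a α (lin (JJ a) β)) ≤ M2 * (τ ^ 10) ^ k := by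
    intro a k
    by_cases ha : a ∈ ball z0 (R / 4)
    · obtain ⟨α, β, h⟩ := ph2 a ha k
      exact ⟨α, β, fun _ => h⟩
    · exact ⟨0, 0, fun h => absurd h ha⟩
  choose p2 b2 hp2 using ph2'
  have camp2 : Camp u z0 R (ball z0 (R / 4)) (R / 4) (τ ^ 4) (τ ^ 4 * τ) (Real.sqrt M2) p2
      (fun a k => lin (JJ a) (b2 a k)) :=
    { hu := S.hu
      hr0 := by positivity
      hS := fun a ha => (hs2 a ha).trans hs12
      hθ := hθ0
      hθ1 := by linarith
      hq := by positivity
      hq1 := by nlinarith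
      hM := by positivity
      hn := by
        intro a ha k
        refine (hp2 a k ha).trans (le_of_eq ?_)
        rw [mul_pow, Real.sq_sqrt hM20.le]
        ring }
  obtain ⟨D, hD1, hD2, hD3⟩ := camp2.c1 τ hτ hτ1 rfl isOpen_ball
  refine ⟨D, fun a ha => ⟨hD1 a ha, ?_⟩, hD2⟩
  have t := hD3 a ha
  have tI : Filter.Tendsto (fun k => lin (JJ a) (b2 a k) Complex.I) Filter.atTop
      (nhds (D a Complex.I)) :=
    ((ContinuousLinearMap.apply ℝ W Complex.I).continuous.tendsto _).comp t
  have t1 : Filter.Tendsto (fun k => JJ a (lin (JJ a) (b2 a k) 1)) Filter.atTop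
      (nhds (JJ a (D a 1))) :=
    ((JJ a).continuous.tendsto _).comp
      (((ContinuousLinearMap.apply ℝ W (1 : ℂ)).continuous.tendsto _).comp t)
  simp only [lin_I] at tI
  exact tendsto_nhds_unique tI t1

end S

end Part16

section Part17
open MeasureTheory Metric Set
open scoped ENNReal ContDiff

lemma local_final (n : ℕ) (Ω : Set ℂ) (hΩ : IsOpen Ω)
    (E : Set ℂ)
    (hEclosed : ∀ z ∈ Ω, z ∈ closure E → z ∈ E)
    (hpolar : PolarIn E Ω)
    (J : (Fin (2 * n) → ℝ) → ((Fin (2 * n) → ℝ) →L[ℝ] (Fin (2 * n) → ℝ)))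
    (hJ : IsAcs n J)
    (u : ℂ → Fin (2 * n) → ℝ) (hu : ContinuousOn u Ω)
    (huJ : JHoloOn n J u (Ω \ E)) (z0 : ℂ) (hz0 : z0 ∈ Ω) :
    ContDiffAt ℝ 1 u z0 ∧ fderiv ℝ u z0 Complex.I = J (u z0) (fderiv ℝ u z0 1) := by
  obtain ⟨hJ1, hJ2⟩ := hJ
  have hsq : ∀ x w, J x (J x w) = -w := fun x w => by
    have := congrArg (fun L => L w) (hJ2 x); simpa using this
  obtain ⟨C, hC, hen⟩ := energy_ineq (2 * n) (J (u z0)) (hJ2 (u z0))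
  obtain ⟨δ, hδ, hδ1, hδC⟩ : ∃ δ : ℝ, 0 < δ ∧ δ ≤ 1 ∧ 8 * C * δ ^ 2 ≤ 1 := by
    refine ⟨1 / (8 * C + 1), by positivity, ?_, ?_⟩
    · rw [div_le_one (by positivity)]; linarith
    · rw [div_pow, mul_div_assoc', div_le_one (by positivity)]
      nlinarith
  obtain ⟨K, t, ht, hLip⟩ := (hJ1.contDiffAt (x := u z0)).exists_lipschitzOnWith
  obtain ⟨om0, hom0, hreg⟩ := local_reg (W := Fin (2 * n) → ℝ) (‖J (u z0)‖ + 1) (K : ℝ)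
    (4 + 8 * C * (1 + ‖J (u z0)‖) ^ 2) (by positivity) (by positivity) (by positivity)
  obtain ⟨R0, hR0, hsub0, hcut⟩ := cutoffs E Ω hΩ hEclosed hpolar z0 hz0
  have hua : ContinuousAt u z0 := hu.continuousAt (hΩ.mem_nhds hz0)
  have hJu : ContinuousAt (fun z => J (u z)) z0 := hJ1.continuous.continuousAt.comp hua
  have h1 : ∀ᶠ z in nhds z0, u z ∈ t := hua ht
  have h2 : ∀ᶠ z in nhds z0, dist (u z) (u z0) < om0 / 2 :=
    hua (Metric.ball_mem_nhds _ (by positivity))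
  have h3 : ∀ᶠ z in nhds z0, dist (J (u z)) (J (u z0)) < δ :=
    hJu (Metric.ball_mem_nhds _ hδ)
  obtain ⟨R1, hR1, hb⟩ := Metric.eventually_nhds_iff_ball.1 (h1.and (h2.and h3))
  set R := min R0 R1 with hRdef
  have hR : 0 < R := lt_min hR0 hR1
  have hRR0 : R ≤ R0 := min_le_left _ _
  have hbR : ∀ z ∈ ball z0 R, u z ∈ t ∧ dist (u z) (u z0) < om0 / 2 ∧
      dist (J (u z)) (J (u z0)) < δ := fun z hz => hb z (ball_subset_ball (min_le_right _ _) hz)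
  have hcbΩ : closedBall z0 R ⊆ Ω := (closedBall_subset_closedBall hRR0).trans hsub0
  have hbΩ : ball z0 R ⊆ Ω := ball_subset_closedBall.trans hcbΩ
  have hG : IsOpen (ball z0 R \ E) := by
    have : ball z0 R \ E = ball z0 R ∩ (closure E)ᶜ := by
      ext z; constructor
      · rintro ⟨hz, hzE⟩; exact ⟨hz, fun h => hzE (hEclosed z (hbΩ hz) h)⟩
      · rintro ⟨hz, hzE⟩; exact ⟨hz, fun h => hzE (subset_closure h)⟩
    rw [this]; exact isOpen_ball.inter isClosed_closure.isOpen_compl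
  have hGs : ball z0 R \ E ⊆ Ω \ E := diff_subset_diff_left hbΩ
  have huG : ContDiffOn ℝ 1 u (ball z0 R \ E) := huJ.1.mono hGs
  have heq : ∀ z ∈ ball z0 R \ E, fderiv ℝ u z 1 + J (u z) (fderiv ℝ u z Complex.I) = 0 := by
    intro z hz
    rw [huJ.2 z (hGs hz), hsq]; simp
  have hL : LocSetup (‖J (u z0)‖ + 1) (K : ℝ) (4 + 8 * C * (1 + ‖J (u z0)‖) ^ 2) E z0 R u
      (fun z => J (u z)) := by
    refine ⟨hR, hG, hu.mono hcbΩ, huG, heq, ?_, fun z w => hsq _ w, ?_, ?_, ?_, ?_⟩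
    · exact hJ1.continuous.comp_continuousOn huG.continuousOn
    · intro z hz
      have h := (hbR z hz).2.2
      rw [dist_eq_norm] at h
      have := norm_add_le (J (u z) - J (u z0)) (J (u z0))
      rw [sub_add_cancel] at this
      linarith
    · intro z hz z' hz'
      have := hLip.dist_le_mul _ (hbR z hz).1 _ (hbR z' hz').1
      rwa [dist_eq_norm, dist_eq_norm] at this
    · intro η hη hηc hs c
      refine caccioppoli (2 * n) (J (u z0)) C hC hen δ hδC hδ.le _ hG u huG _ ?_ heq η hη hηc hs c
      intro z hz
      have h := (hbR z hz.1).2.2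
      rw [dist_comm, dist_eq_norm] at h
      exact h.le
    · intro ε hε
      obtain ⟨χ, hχ, hχ01, ⟨U, hU, hEU, hU1⟩, hi1, hi2⟩ := hcut ε hε
      have mono : ∀ f : ℂ → ℝ, Continuous f → (∀ z, 0 ≤ f z) →
          ∫ z in ball z0 R, f z ≤ ∫ z in ball z0 R0, f z := by
        intro f hf hf0
        refine setIntegral_mono_set ?_ (Filter.Eventually.of_forall hf0)
          (ball_subset_ball hRR0).eventuallyLE
        exact (hf.continuousOn.integrableOn_compact (isCompact_closedBall z0 R0)).mono_set
          ball_subset_closedBall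
      refine ⟨χ, hχ, hχ01, ⟨U, hU, (inter_subset_inter_right _
        (closedBall_subset_closedBall hRR0)).trans hEU, hU1⟩, ?_, ?_⟩
      · exact (mono (fun z => χ z ^ 2) (hχ.continuous.pow 2) (fun z => sq_nonneg _)).trans hi1
      · exact (mono (fun z => ‖fderiv ℝ χ z‖ ^ 2)
          ((hχ.continuous_fderiv (by norm_num)).norm.pow 2) (fun z => sq_nonneg _)).trans hi2
  obtain ⟨D, hD, hDc⟩ := hreg E z0 R u _ hL (by
    intro z hz z' hz'
    have a1 := (hbR z hz).2.1
    have a2 := (hbR z' hz').2.1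
    rw [← dist_eq_norm]
    have := dist_triangle_right (u z) (u z') (u z0)
    linarith)
  have hmem : z0 ∈ ball z0 (R / 4) := mem_ball_self (by positivity)
  constructor
  · have hcd : ContDiffOn ℝ 1 u (ball z0 (R / 4)) := by
      rw [show (1 : WithTop ℕ∞) = 0 + 1 by simp, contDiffOn_succ_iff_fderiv_of_isOpen isOpen_ball]
      refine ⟨fun a ha => (hD a ha).1.differentiableAt.differentiableWithinAt, by simp, ?_⟩
      rw [contDiffOn_zero]
      exact hDc.congr fun a ha => (hD a ha).1.fderiv
    exact hcd.contDiffAt (isOpen_ball.mem_nhds hmem)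
  · rw [(hD z0 hmem).1.fderiv]
    exact (hD z0 hmem).2


end Part17

/-- **Theorem B.**  Let `Ω ⊆ ℂ` be open and `E` a closed polar subset of `Ω`.
Let `J` be a `C¹` almost complex structure on `ℝ^{2n}` and `u : Ω → ℝ^{2n}` a
continuous map which is `J`-holomorphic on `Ω \ E`.  Then `u` is (`C¹` and)
`J`-holomorphic on all of `Ω`. -/
theorem thm_B (n : ℕ) (Ω : Set ℂ) (hΩ : IsOpen Ω)
    (E : Set ℂ) (hE : E ⊆ Ω)
    (hEclosed : ∀ z ∈ Ω, z ∈ closure E → z ∈ E)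
    (hpolar : PolarIn E Ω)
    (J : (Fin (2 * n) → ℝ) → ((Fin (2 * n) → ℝ) →L[ℝ] (Fin (2 * n) → ℝ)))
    (hJ : IsAcs n J)
    (u : ℂ → Fin (2 * n) → ℝ) (hu : ContinuousOn u Ω)
    (huJ : JHoloOn n J u (Ω \ E)) :
    ContDiffOn ℝ 1 u Ω ∧ JHoloOn n J u Ω := by
  have h := local_final n Ω hΩ E hEclosed hpolar J hJ u hu huJ
  have h1 : ContDiffOn ℝ 1 u Ω := fun z hz => (h z hz).1.contDiffWithinAt
  exact ⟨h1, h1, fun z hz => (h z hz).2⟩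

end
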